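/- arXiv:1602.03259 — 2 statements merged into one kernel-verified Lean document; each statement's English description precedes it below -/
import Mathlib

section
/- Let M be a Riemannian manifold with inj(M) > 0, let {b_i(t)}_{i∈ℤ/n} be cyclic pursuit curves on M, and let β^t be the associated family of piecewise geodesic loops. Suppose there is a sequence t_j → ∞ and a closed geodesic α : ℝ/ℤ → M such that β^{t_j} → α uniformly. If sup_{s∈S^1} d(β^t(s), α(S^1)) → 0 as t → ∞, then β^t converges to α as t → ∞ in the sense that inf_{c∈ℝ} sup_{s∈ℝ/ℤ} d(β^t(s), α(s+c)) → 0. -/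
open Set Filter Metric Asymptotics Function
open scoped Topology Real

/-!  A synthetic framework for Riemannian manifolds with positive injectivity radius,
formulated on a metric space `M`.  `injAt p` is the injectivity radius at the point `p`,
`inj` (the injectivity radius of `M`) is a lower bound for it, and whenever
`dist p q < injAt p` there is a unique shortest geodesic `[p,q]` from `p` to `q`,
parameterized at constant speed on `[0,1]`, denoted `geod p q`. -/
structure GeodesicStructure (M : Type*) [MetricSpace M] where
  /-- the injectivity radius `inj M` of the manifold -/
  inj : ℝ
  /-- the injectivity radius at a point -/
  injAt : M → ℝ
  inj_le_injAt : ∀ p, inj ≤ injAt p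
  /-- `geod p q` is the shortest geodesic `[p,q] : [0,1] → M` (junk unless
  `dist p q < injAt p`). -/
  geod : M → M → ℝ → M
  geod_zero : ∀ p q, dist p q < injAt p → geod p q 0 = p
  geod_one : ∀ p q, dist p q < injAt p → geod p q 1 = q
  geod_dist : ∀ p q, dist p q < injAt p → ∀ s ∈ Icc (0:ℝ) 1, ∀ u ∈ Icc (0:ℝ) 1,
    dist (geod p q s) (geod p q u) = |s - u| * dist p q
  geod_unique : ∀ p q, dist p q < injAt p → ∀ γ : ℝ → M, γ 0 = p → γ 1 = q →
    (∀ s ∈ Icc (0:ℝ) 1, ∀ u ∈ Icc (0:ℝ) 1, dist (γ s) (γ u) = |s - u| * dist p q) →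
    ∀ s ∈ Icc (0:ℝ) 1, γ s = geod p q s

variable {M : Type*} [MetricSpace M]

/-- **Cyclic pursuit on a Riemannian manifold** `M` with `inj M > 0`, with initial
positions satisfying `dist (b i 0) (b (i+1) 0) < inj M`:  a collection of (piecewise
smooth, in particular continuous) curves `b i : [0,∞) → M`, `i ∈ ℤ/n`, such that
(1) whenever `b i t ≠ b (i+1) t`, bug `i` moves with unit speed along the shortest
    geodesic towards bug `i+1`; metrically: `b i (t+h)` agrees to first order (as
    `h → 0⁺`) with the point at arclength parameter `h` along the unique shortest
    geodesic from `b i t` to `b (i+1) t` — i.e. the velocity of `b i` at `t` is the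
    initial unit tangent vector of that geodesic;
(2) bugs that have met stay together;
(3) once all the bugs coincide, they halt. -/
structure IsCyclicPursuit (G : GeodesicStructure M) (n : ℕ) (b : ZMod n → ℝ → M) :
    Prop where
  init_sep : ∀ i, dist (b i 0) (b (i + 1) 0) < G.inj
  cont : ∀ i, ContinuousOn (b i) (Ici 0)
  chase : ∀ (i : ZMod n) (t : ℝ), 0 ≤ t → b i t ≠ b (i + 1) t →
    dist (b i t) (b (i + 1) t) < G.injAt (b i t) →
    (fun h : ℝ => dist (b i (t + h))
        (G.geod (b i t) (b (i + 1) t) (h / dist (b i t) (b (i + 1) t))))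
      =o[𝓝[≥] (0:ℝ)] (fun h => h)
  merge : ∀ (i : ZMod n) (t₀ : ℝ), 0 ≤ t₀ → b i t₀ = b (i + 1) t₀ →
    ∀ t, t₀ < t → b i t = b (i + 1) t
  halt : ∀ t₀ : ℝ, 0 ≤ t₀ → (∀ i, b i t₀ = b 0 t₀) → ∀ t, t₀ < t → ∀ i, b i t = b 0 t₀

/-- `β : ℝ/ℤ → M` (a `1`-periodic map `ℝ → M`) is the constant-speed piecewise geodesic
loop through the cyclic configuration `b : ℤ/n → M`: it traverses the shortest geodesics
`[b i, b (i+1)]`, `i = 0, …, n-1`, in order, each parameterized proportionally to its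
length, with `β 0 = b 0`. -/
def IsPursuitLoop (G : GeodesicStructure M) {n : ℕ} [NeZero n]
    (b : ZMod n → M) (β : ℝ → M) : Prop :=
  Function.Periodic β 1 ∧ β 0 = b 0 ∧
  ∃ σ : ℕ → ℝ, σ 0 = 0 ∧ σ n = 1 ∧ Monotone σ ∧
    (∀ i : ℕ, i < n →
      (σ (i + 1) - σ i) * (∑ j : ZMod n, dist (b j) (b (j + 1)))
        = dist (b (i : ZMod n)) (b ((i : ZMod n) + 1))) ∧
    (∀ i : ℕ, i < n → ∀ s ∈ Icc (σ i) (σ (i + 1)),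
      β s = G.geod (b (i : ZMod n)) (b ((i : ZMod n) + 1)) ((s - σ i) / (σ (i + 1) - σ i)))

/-- A **closed geodesic** of length `L`, parameterized proportionally to arclength by
`ℝ/ℤ` (a `1`-periodic map `ℝ → M`): it is nonconstant and locally an isometry up to the
scale factor `L` (every Riemannian geodesic is locally length-minimizing, and conversely). -/
def IsClosedGeodesic (α : ℝ → M) (L : ℝ) : Prop :=
  Function.Periodic α 1 ∧ 0 < L ∧
    ∃ e > (0:ℝ), ∀ s u : ℝ, |s - u| ≤ e → dist (α s) (α u) = L * |s - u|

/-- Convergence `β t → α` as `t → ∞` of a family of loops to a loop, in the quotient of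
`C⁰(S¹, M)` by rotations of the domain:  `inf_{c} sup_{s} d (β t s) (α (s + c)) → 0`. -/
def LoopTendsto (β : ℝ → ℝ → M) (α : ℝ → M) : Prop :=
  ∀ ε > (0:ℝ), ∃ T : ℝ, ∀ t : ℝ, T ≤ t → ∃ c : ℝ, ∀ s : ℝ, dist (β t s) (α (s + c)) < ε

/-- The comparison (Euclidean) angle at `p` of the triangle `p x y`. -/
noncomputable def comparisonAngle (p x y : M) : ℝ :=
  Real.arccos ((dist p x ^ 2 + dist p y ^ 2 - dist x y ^ 2) / (2 * dist p x * dist p y))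

/-- The angle at `p` between the shortest geodesics `[p, q₁]` and `[p, q₂]`, defined
synthetically as the limit of comparison angles. -/
noncomputable def GeodesicStructure.angle (G : GeodesicStructure M) (p q₁ q₂ : M) : ℝ :=
  limsup (fun s : ℝ => comparisonAngle p (G.geod p q₁ s) (G.geod p q₂ s)) (𝓝[>] (0:ℝ))

/-- Synthetic rendering of "`U` has **nonpositive sectional curvature**": for any two
geodesics whose images lie in `U` and which are joined through `U` (as in the second
variation argument), the distance between corresponding points is a convex function of
the parameter. -/
def NonposCurvedOn (G : GeodesicStructure M) (U : Set M) : Prop :=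
  ∀ p₁ p₂ q₁ q₂ : M, dist p₁ p₂ < G.injAt p₁ → dist q₁ q₂ < G.injAt q₁ →
    (∀ s ∈ Icc (0:ℝ) 1, G.geod p₁ p₂ s ∈ U) →
    (∀ s ∈ Icc (0:ℝ) 1, G.geod q₁ q₂ s ∈ U) →
    (∀ s ∈ Icc (0:ℝ) 1, dist (G.geod p₁ p₂ s) (G.geod q₁ q₂ s)
        < G.injAt (G.geod p₁ p₂ s)) →
    (∀ s ∈ Icc (0:ℝ) 1, ∀ u ∈ Icc (0:ℝ) 1,
        G.geod (G.geod p₁ p₂ s) (G.geod q₁ q₂ s) u ∈ U) →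
    ConvexOn ℝ (Icc (0:ℝ) 1) (fun s => dist (G.geod p₁ p₂ s) (G.geod q₁ q₂ s))

/-- The two curves `γ₁, γ₂` (on `[0,1]`) lie along a common geodesic. -/
def OnSameGeodesic (G : GeodesicStructure M) (γ₁ γ₂ : ℝ → M) : Prop :=
  ∃ (a c : M) (x₁ y₁ x₂ y₂ : ℝ), dist a c < G.injAt a ∧
    (∀ s ∈ Icc (0:ℝ) 1, γ₁ s = G.geod a c (x₁ + y₁ * s)) ∧
    (∀ s ∈ Icc (0:ℝ) 1, γ₂ s = G.geod a c (x₂ + y₂ * s))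

/-- Synthetic rendering of "`U` has **negative sectional curvature**": in addition to the
convexity above, the squared distance between corresponding points of two geodesics in `U`
is *strictly* convex, unless the two geodesics lie along a common geodesic. -/
def NegCurvedOn (G : GeodesicStructure M) (U : Set M) : Prop :=
  NonposCurvedOn G U ∧
  ∀ p₁ p₂ q₁ q₂ : M, dist p₁ p₂ < G.injAt p₁ → dist q₁ q₂ < G.injAt q₁ →
    (∀ s ∈ Icc (0:ℝ) 1, G.geod p₁ p₂ s ∈ U) →
    (∀ s ∈ Icc (0:ℝ) 1, G.geod q₁ q₂ s ∈ U) →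
    (∀ s ∈ Icc (0:ℝ) 1, dist (G.geod p₁ p₂ s) (G.geod q₁ q₂ s)
        < G.injAt (G.geod p₁ p₂ s)) →
    (∀ s ∈ Icc (0:ℝ) 1, ∀ u ∈ Icc (0:ℝ) 1,
        G.geod (G.geod p₁ p₂ s) (G.geod q₁ q₂ s) u ∈ U) →
    ¬ OnSameGeodesic G (G.geod p₁ p₂) (G.geod q₁ q₂) →
    StrictConvexOn ℝ (Icc (0:ℝ) 1)
      (fun s => dist (G.geod p₁ p₂ s) (G.geod q₁ q₂ s) ^ 2)


namespace PursuitAux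

theorem cg_continuous {α : ℝ → M} {L e : ℝ} (hL : 0 < L) (he : 0 < e)
    (hiso : ∀ s u : ℝ, |s - u| ≤ e → dist (α s) (α u) = L * |s - u|) : Continuous α := by
  rw [Metric.continuous_iff]
  intro u ε hε
  refine ⟨min e (ε / L), lt_min he (div_pos hε hL), fun s hs => ?_⟩
  rw [Real.dist_eq] at hs
  have h1 := lt_of_lt_of_le hs (min_le_left _ _)
  have h2 := lt_of_lt_of_le hs (min_le_right _ _)
  rw [hiso s u h1.le]
  rw [lt_div_iff₀ hL] at h2
  linarith

theorem periodic_range {X : Type*} {α : ℝ → X} (hp : Function.Periodic α 1) :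
    range α = α '' Icc 0 1 := by
  apply Subset.antisymm
  · rintro _ ⟨s, rfl⟩
    refine ⟨Int.fract s, ⟨Int.fract_nonneg s, (Int.fract_lt_one s).le⟩, ?_⟩
    have := hp.sub_int_mul_eq (x := s) ⌊s⌋
    rw [mul_one] at this
    exact this
  · rintro _ ⟨s, _, rfl⟩
    exact ⟨s, rfl⟩

def Reg (α : ℝ → M) (e u : ℝ) : Prop :=
  ∀ᶠ x in 𝓝 (α u), x ∈ range α → ∃ v, x = α v ∧ |v - u| ≤ e / 4

theorem reg_dense {α : ℝ → M} {L e : ℝ} (hp : Function.Periodic α 1) (hL : 0 < L) (he : 0 < e)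
    (hiso : ∀ s u : ℝ, |s - u| ≤ e → dist (α s) (α u) = L * |s - u|) :
    ∃ U : Set ℝ, IsOpen U ∧ Dense U ∧ ∀ u ∈ U, Reg α e u := by
  have hc := cg_continuous hL he hiso
  obtain ⟨N, hN⟩ := exists_nat_gt (1 / e)
  have hNpos : (0:ℝ) < N := lt_trans (by positivity) hN
  have hNe : 1 / (N:ℝ) ≤ e := by
    rw [div_le_iff₀ hNpos]; rw [div_lt_iff₀ he] at hN; linarith
  let I : Fin N → Set ℝ := fun k => Icc ((k:ℕ) / (N:ℝ)) ((((k:ℕ):ℝ) + 1) / N)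
  have hIc : ∀ k, IsCompact (α '' I k) := fun k => isCompact_Icc.image hc
  have hIs : ∀ k, ∀ a ∈ I k, ∀ b ∈ I k, |a - b| ≤ e := by
    intro k a ha b hb
    refine le_trans ?_ hNe
    have h : (((k:ℕ):ℝ) + 1) / N = (k:ℕ) / (N:ℝ) + 1 / N := by ring
    have ha1 := ha.1
    have ha2 := ha.2
    have hb1 := hb.1
    have hb2 := hb.2
    rw [h] at ha2 hb2
    rw [abs_le]
    constructor <;> linarith
  have hcl : ∀ k, IsClosed (α ⁻¹' (α '' I k)) := fun k => (hIc k).isClosed.preimage hc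
  refine ⟨⋂ k, (frontier (α ⁻¹' (α '' I k)))ᶜ, ?_, ?_, ?_⟩
  · exact isOpen_iInter_of_finite fun k => isClosed_frontier.isOpen_compl
  · apply dense_iInter_of_isOpen
    · exact fun k => isClosed_frontier.isOpen_compl
    · intro k
      rw [← interior_eq_empty_iff_dense_compl]
      exact interior_frontier (hcl k)
  · intro u hu
    rw [mem_iInter] at hu
    have key : ∀ k, ∀ᶠ x in 𝓝 (α u), x ∈ α '' I k → ∃ v, x = α v ∧ |v - u| ≤ e / 4 := by
      intro k
      by_cases hk : α u ∈ α '' I k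
      · have hmemInt : u ∈ interior (α ⁻¹' (α '' I k)) := by
          by_contra hcon
          apply hu k
          rw [(hcl k).frontier_eq]
          exact ⟨hk, hcon⟩
        rw [mem_interior_iff_mem_nhds, Metric.mem_nhds_iff] at hmemInt
        obtain ⟨δ, hδ, hball⟩ := hmemInt
        obtain ⟨w, hw, hwu⟩ := hk
        have hm : 0 < L * min δ (e / 4) := by positivity
        filter_upwards [Metric.ball_mem_nhds (α u) hm] with x hx
        rintro ⟨v', hv', rfl⟩
        rw [Metric.mem_ball, ← hwu, hiso v' w (hIs k _ hv' _ hw)] at hx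
        have hx := lt_of_mul_lt_mul_left hx hL.le
        have hr1 := lt_of_lt_of_le hx (min_le_left _ _)
        have hr2 := lt_of_lt_of_le hx (min_le_right _ _)
        set r := |v' - w| with hr
        have hr0 : 0 ≤ r := abs_nonneg _
        have hb1 : u + r ∈ ball u δ := by
          rw [Metric.mem_ball, Real.dist_eq, add_sub_cancel_left, abs_of_nonneg hr0]; exact hr1
        have hb2 : u - r ∈ ball u δ := by
          rw [Metric.mem_ball, Real.dist_eq, sub_sub_cancel_left, abs_neg, abs_of_nonneg hr0]
          exact hr1
        obtain ⟨w1, hw1, h1⟩ := hball hb1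
        obtain ⟨w2, hw2, h2⟩ := hball hb2
        have a1 : |u + r - u| = r := by rw [add_sub_cancel_left, abs_of_nonneg hr0]
        have a2 : |u - r - u| = r := by rw [sub_sub_cancel_left, abs_neg, abs_of_nonneg hr0]
        have a3 : |(u + r) - (u - r)| = 2 * r := by
          rw [show (u + r) - (u - r) = 2 * r by ring, abs_of_nonneg (by linarith)]
        have d1 : |w1 - w| = r := by
          have := hiso (u + r) u (by rw [a1]; linarith)
          rw [← h1, ← hwu, hiso _ _ (hIs k _ hw1 _ hw), a1] at this
          exact mul_left_cancel₀ hL.ne' this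
        have d2 : |w2 - w| = r := by
          have := hiso (u - r) u (by rw [a2]; linarith)
          rw [← h2, ← hwu, hiso _ _ (hIs k _ hw2 _ hw), a2] at this
          exact mul_left_cancel₀ hL.ne' this
        have d3 : |w1 - w2| = 2 * r := by
          have := hiso (u + r) (u - r) (by rw [a3]; linarith)
          rw [← h1, ← h2, hiso _ _ (hIs k _ hw1 _ hw2), a3] at this
          exact mul_left_cancel₀ hL.ne' this
        have : v' = w1 ∨ v' = w2 := by
          rcases abs_cases (v' - w) with h | h <;> rcases abs_cases (w1 - w) with h' | h' <;>
          rcases abs_cases (w2 - w) with h'' | h'' <;> rcases abs_cases (w1 - w2) with h3 | h3 <;>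
          first
          | (left; linarith)
          | (right; linarith)
        rcases this with rfl | rfl
        · exact ⟨u + r, h1, by rw [a1]; linarith⟩
        · exact ⟨u - r, h2, by rw [a2]; linarith⟩
      · filter_upwards [(hIc k).isClosed.isOpen_compl.mem_nhds hk] with x hx hx'
        exact absurd hx' hx
    filter_upwards [eventually_all.2 key] with x hx hxr
    rw [periodic_range hp] at hxr
    obtain ⟨s, hs, rfl⟩ := hxr
    have hex : ∃ k : Fin N, s ∈ I k := by
      rcases eq_or_lt_of_le hs.2 with h1 | h1
      · have hN0 : 0 < N := by exact_mod_cast hNpos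
        refine ⟨⟨N - 1, by omega⟩, ?_⟩
        have : ((N - 1 : ℕ) : ℝ) = N - 1 := by
          rw [Nat.cast_sub hN0]; simp
        simp only [I, this, h1, mem_Icc]
        rw [div_le_one hNpos, one_le_div hNpos]
        constructor <;> linarith
      · have h0 : 0 ≤ s * N := by nlinarith [hs.1]
        refine ⟨⟨⌊s * N⌋₊, ?_⟩, ?_⟩
        · rw [Nat.floor_lt h0]; nlinarith
        · simp only [I, mem_Icc]
          rw [div_le_iff₀ hNpos, le_div_iff₀ hNpos]
          exact ⟨Nat.floor_le h0, (Nat.lt_floor_add_one _).le⟩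
    obtain ⟨k, hk⟩ := hex
    exact hx k ⟨s, hk, rfl⟩

theorem crossing {α : ℝ → M} {L e : ℝ} (hL : 0 < L) (he : 0 < e)
    (hiso : ∀ s u : ℝ, |s - u| ≤ e → dist (α s) (α u) = L * |s - u|)
    {u κ : ℝ} (hκ : 0 < κ) (hu : Reg α e u) :
    ∀ᶠ ε in 𝓝[>] (0:ℝ), ∀ γ : ℝ → M, Continuous γ → (∀ s, γ s ∈ range α) →
      (∀ s, dist (γ s) (α s) < ε) → ∃ τ, |τ - u| ≤ κ ∧ γ τ = α u := by
  unfold Reg at hu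
  rw [Metric.eventually_nhds_iff] at hu
  obtain ⟨η, hη, hu⟩ := hu
  obtain ⟨k, hk0, hk⟩ : ∃ k > 0, k ≤ κ ∧ k ≤ e / 4 ∧ L * k ≤ η / 2 := by
    refine ⟨min κ (min (e / 4) (η / 2 / L)), by positivity, min_le_left _ _,
      (min_le_right _ _).trans (min_le_left _ _), ?_⟩
    have : min κ (min (e / 4) (η / 2 / L)) ≤ η / 2 / L :=
      (min_le_right _ _).trans (min_le_right _ _)
    rw [le_div_iff₀ hL] at this
    linarith
  obtain ⟨hk1, hk2, hk3⟩ := hk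
  have hpos : 0 < min (η / 2) (L * k) := by positivity
  filter_upwards [Ioo_mem_nhdsGT hpos] with ε hε γ hγ hr hd
  have hε1 := hε.2.trans_le (min_le_left _ _)
  have hε2 := hε.2.trans_le (min_le_right _ _)
  have hf : ContinuousOn (fun s => dist (γ s) (α (u - e / 4))) (Icc (u - k) (u + k)) :=
    (hγ.dist continuous_const).continuousOn
  have e1 : dist (α (u - k)) (α (u - e / 4)) = L * (e / 4 - k) := by
    have h : |u - k - (u - e / 4)| = e / 4 - k := by
      rw [abs_of_nonneg] <;> linarith
    rw [hiso _ _ (by rw [h]; linarith), h]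
  have e2 : dist (α (u + k)) (α (u - e / 4)) = L * (e / 4 + k) := by
    have h : |u + k - (u - e / 4)| = e / 4 + k := by
      rw [abs_of_nonneg] <;> linarith
    rw [hiso _ _ (by rw [h]; linarith), h]
  have hlow : dist (γ (u - k)) (α (u - e / 4)) ≤ L * (e / 4) := by
    have := dist_triangle (γ (u - k)) (α (u - k)) (α (u - e / 4))
    have := hd (u - k)
    linarith
  have hhigh : L * (e / 4) ≤ dist (γ (u + k)) (α (u - e / 4)) := by
    have := dist_triangle_left (α (u + k)) (α (u - e / 4)) (γ (u + k))
    have := hd (u + k)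
    linarith
  obtain ⟨τ, hτ, hτe⟩ := intermediate_value_Icc (by linarith) hf ⟨hlow, hhigh⟩
  have hτu : |τ - u| ≤ k := by rw [abs_le]; constructor <;> linarith [hτ.1, hτ.2]
  refine ⟨τ, hτu.trans hk1, ?_⟩
  have hdist : dist (γ τ) (α u) < η := by
    have h1 := dist_triangle (γ τ) (α τ) (α u)
    have h2 := hd τ
    have h3 := hiso τ u (by linarith)
    have : L * |τ - u| ≤ L * k := by gcongr
    linarith
  obtain ⟨v, hv, hvu⟩ := hu hdist (hr τ)
  rw [abs_le] at hvu
  have h : |v - (u - e / 4)| = v - u + e / 4 := by rw [abs_of_nonneg] <;> linarith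
  simp only [hv] at hτe
  rw [hiso _ _ (by rw [h]; linarith), h] at hτe
  have := mul_left_cancel₀ hL.ne' hτe
  rw [hv, show v = u by linarith]

theorem lip_eq {γ : ℝ → M} {L : ℝ} (hlip : ∀ s u, dist (γ s) (γ u) ≤ L * |s - u|)
    {a b : ℝ} (hab : dist (γ a) (γ b) = L * (b - a)) :
    ∀ s ∈ Icc a b, ∀ u ∈ Icc a b, dist (γ s) (γ u) = L * |s - u| := by
  have main : ∀ s ∈ Icc a b, ∀ u ∈ Icc a b, s ≤ u → dist (γ s) (γ u) = L * |s - u| := by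
    intro s hs u hu hsu
    apply le_antisymm (hlip s u)
    have h1 := dist_triangle4 (γ a) (γ s) (γ u) (γ b)
    have h2 := hlip a s
    have h3 := hlip u b
    rw [abs_sub_comm, abs_of_nonneg (by linarith [hs.1])] at h2
    rw [abs_sub_comm, abs_of_nonneg (by linarith [hu.2])] at h3
    rw [abs_sub_comm, abs_of_nonneg (by linarith)]
    linarith [hu.2]
  intro s hs u hu
  rcases le_total s u with h | h
  · exact main s hs u hu h
  · rw [dist_comm, abs_sub_comm]; exact main u hu s hs h

theorem isolation (G : GeodesicStructure M) (hinj : 0 < G.inj) {α : ℝ → M} {L : ℝ}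
    (hα : IsClosedGeodesic α L) :
    ∃ ε > 0, ∀ γ : ℝ → M, Function.Periodic γ 1 → (∀ s, γ s ∈ range α) →
      (∀ s u, dist (γ s) (γ u) ≤ L * |s - u|) → (∀ s, dist (γ s) (α s) < ε) →
      ∃ c, ∀ s, γ s = α (s + c) := by
  obtain ⟨hp, hL, e, he, hiso⟩ := hα
  obtain ⟨U, hUo, hUd, hU⟩ := reg_dense hp hL he hiso
  obtain ⟨N, hN⟩ := exists_nat_gt (max (1 / e) (L / G.inj))
  have hN1 := (le_max_left _ _).trans_lt hN
  have hN2 := (le_max_right _ _).trans_lt hN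
  have hNpos : (0:ℝ) < N := lt_trans (by positivity) hN1
  have hN0 : 0 < N := by exact_mod_cast hNpos
  have hNe : 1 / (N:ℝ) ≤ e := by
    rw [div_le_iff₀ hNpos]; rw [div_lt_iff₀ he] at hN1; linarith
  have hNi : L * (1 / (N:ℝ)) < G.inj := by
    rw [mul_one_div, div_lt_iff₀ hNpos]; rw [div_lt_iff₀ hinj] at hN2; linarith
  have hdense : Dense (⋂ j : ℕ, (fun x : ℝ => x + j / N) ⁻¹' U) := by
    apply dense_iInter_of_isOpen
    · exact fun j => hUo.preimage (by fun_prop)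
    · exact fun j => hUd.preimage (Homeomorph.addRight ((j:ℝ) / N)).isOpenMap
  obtain ⟨u0, hu0⟩ := hdense.nonempty
  rw [mem_iInter] at hu0
  set u : ℕ → ℝ := fun j => u0 + j / N with hudef
  have hreg : ∀ j, Reg α e (u j) := fun j => hU _ (hu0 j)
  have hκ : (0:ℝ) < 1 / (4 * N) := by positivity
  have hev : ∀ᶠ ε in 𝓝[>] (0:ℝ), ∀ j : Fin N, ∀ γ : ℝ → M, Continuous γ →
      (∀ s, γ s ∈ range α) →
      (∀ s, dist (γ s) (α s) < ε) → ∃ τ, |τ - u j| ≤ 1 / (4 * N) ∧ γ τ = α (u j) :=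
    eventually_all.2 fun j => crossing hL he hiso hκ (hreg j)
  obtain ⟨ε, hεc, hε0⟩ := (hev.and self_mem_nhdsWithin).exists
  refine ⟨ε, hε0, fun γ hγp hγr hlip hd => ?_⟩
  have hγc : Continuous γ := by
    refine (LipschitzWith.of_dist_le_mul (K := ⟨L, hL.le⟩) fun x y => ?_).continuous
    rw [Real.dist_eq]; exact hlip x y
  have hcr : ∀ j : ℕ, ∃ τ, j < N → |τ - u j| ≤ 1 / (4 * N) ∧ γ τ = α (u j) := by
    intro j
    by_cases hj : j < N
    · obtain ⟨τ, h⟩ := hεc ⟨j, hj⟩ γ hγc hγr hd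
      exact ⟨τ, fun _ => h⟩
    · exact ⟨0, fun h => absurd h hj⟩
  choose τ0 hτ0 using hcr
  let τ : ℕ → ℝ := fun k => τ0 (k % N) + (k / N : ℕ)
  have hus : ∀ k : ℕ, u k = u (k % N) + (k / N : ℕ) := by
    intro k
    have h : (k:ℝ) = (k % N : ℕ) + N * (k / N : ℕ) := by
      exact_mod_cast (Nat.mod_add_div k N).symm
    simp only [hudef]
    rw [h, add_div, mul_div_cancel_left₀ _ hNpos.ne']
    ring
  have hγn : ∀ (x : ℝ) (m : ℕ), γ (x + m) = γ x := by
    intro x m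
    have := hγp.nat_mul m x
    rwa [mul_one] at this
  have hαn : ∀ (x : ℝ) (m : ℕ), α (x + m) = α x := by
    intro x m
    have := hp.nat_mul m x
    rwa [mul_one] at this
  have hτ : ∀ k, |τ k - u k| ≤ 1 / (4 * N) ∧ γ (τ k) = α (u k) := by
    intro k
    obtain ⟨h1, h2⟩ := hτ0 (k % N) (Nat.mod_lt _ hN0)
    rw [hus k]
    refine ⟨?_, ?_⟩
    · simp only [τ]; rw [add_sub_add_right_eq_sub]; exact h1
    · simp only [τ]; rw [hγn, hαn, h2]
  have hstep : ∀ k, u (k + 1) = u k + 1 / N := by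
    intro k; simp only [hudef]; push_cast; ring
  have hdu : ∀ k, dist (α (u k)) (α (u (k + 1))) = L * (1 / N) := by
    intro k
    have : |u k - u (k + 1)| = 1 / N := by
      rw [hstep, sub_add_cancel_left, abs_neg, abs_of_nonneg (by positivity)]
    rw [hiso _ _ (by rw [this]; exact hNe), this]
  have hmono : Monotone (fun k => τ k - u k) := by
    apply monotone_nat_of_le_succ
    intro k
    have h1 := hlip (τ k) (τ (k + 1))
    rw [(hτ k).2, (hτ (k + 1)).2, hdu k] at h1
    have h2 := le_of_mul_le_mul_left h1 hL
    have h3 := abs_le.1 (hτ k).1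
    have h4 := abs_le.1 (hτ (k + 1)).1
    have h5 := hstep k
    have h6 : (1:ℝ) / (4 * N) = 1 / N / 4 := by field_simp
    have h7 : (0:ℝ) < 1 / N := by positivity
    rw [h6] at h3 h4
    rw [abs_sub_comm, abs_of_nonneg (by linarith)] at h2
    linarith
  have hper : ∀ k, τ (k + N) - u (k + N) = τ k - u k := by
    intro k
    have h1 : u (k + N) = u k + 1 := by
      simp only [hudef]; push_cast; field_simp; ring
    have h2 : τ (k + N) = τ k + 1 := by
      simp only [τ]; rw [Nat.add_mod_right, Nat.add_div_right _ hN0]; push_cast; ring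
    rw [h1, h2]; ring
  have hconst : ∀ k, τ k - u k = τ 0 - u 0 := by
    intro k
    induction k with
    | zero => rfl
    | succ k ih =>
      rw [← ih]
      apply le_antisymm
      · rw [← hper k]; exact hmono (by omega)
      · exact hmono (by omega)
  set g := τ 0 - u 0
  have hpos : ∀ s, u 0 + g ≤ s → γ s = α (s - g) := by
    intro s hs
    have hu00 : u 0 = u0 := by simp [hudef]
    have h0 : 0 ≤ (s - g - u0) * N := by
      apply mul_nonneg _ hNpos.le; linarith
    set k := ⌊(s - g - u0) * N⌋₊
    have hk1 : u k ≤ s - g := by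
      have := Nat.floor_le h0
      have : (k:ℝ) / N ≤ s - g - u0 := by rw [div_le_iff₀ hNpos]; exact this
      simp only [hudef]; linarith
    have hk2 : s - g ≤ u (k + 1) := by
      have := (Nat.lt_floor_add_one ((s - g - u0) * N)).le
      have : s - g - u0 ≤ ((k:ℝ) + 1) / N := by rw [le_div_iff₀ hNpos]; exact this
      simp only [hudef]; push_cast; linarith
    have t1 : τ k = u k + g := by linarith [hconst k]
    have t2 : τ (k + 1) = u k + g + 1 / N := by linarith [hconst (k + 1), hstep k]
    have hinjk : dist (α (u k)) (α (u (k + 1))) < G.injAt (α (u k)) := by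
      rw [hdu]; exact hNi.trans_le (G.inj_le_injAt _)
    set x := (s - g - u k) * N with hx
    have hxm : x ∈ Icc (0:ℝ) 1 := by
      refine ⟨mul_nonneg (by linarith) hNpos.le, ?_⟩
      rw [hstep] at hk2
      have : s - g - u k ≤ 1 / N := by linarith
      rwa [le_div_iff₀ hNpos] at this
    have hxs : x / N = s - g - u k := by rw [hx]; field_simp
    have habs : ∀ a b c : ℝ, |c + a / N - (c + b / N)| = |a - b| * (1 / N) := by
      intro a b c
      rw [add_sub_add_left_eq_sub, ← sub_div, abs_div, abs_of_pos hNpos]; ring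
    have hle : ∀ a ∈ Icc (0:ℝ) 1, a / N ∈ Icc (0:ℝ) (1 / N) := by
      intro a ha
      exact ⟨div_nonneg ha.1 hNpos.le, by gcongr; exact ha.2⟩
    have E1 := G.geod_unique _ _ hinjk (fun y => γ (u k + g + y / N))
      (by simp only [zero_div, add_zero]; rw [← t1, (hτ k).2])
      (by rw [← t2, (hτ (k+1)).2])
      (by
        intro a ha b hb
        have ha' := hle a ha
        have hb' := hle b hb
        have := lip_eq hlip (a := τ k) (b := τ (k + 1))
          (by rw [(hτ k).2, (hτ (k + 1)).2, hdu, t1, t2]; ring)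
          (u k + g + a / N) (by rw [t1, t2]; constructor <;> linarith [ha'.1, ha'.2])
          (u k + g + b / N) (by rw [t1, t2]; constructor <;> linarith [hb'.1, hb'.2])
        rw [this, habs, hdu]; ring) x hxm
    have E2 := G.geod_unique _ _ hinjk (fun y => α (u k + y / N))
      (by simp)
      (by rw [hstep])
      (by
        intro a ha b hb
        have ha' := hle a ha
        have hb' := hle b hb
        rw [hiso, habs, hdu]
        · ring
        · rw [abs_le]; constructor <;> linarith [ha'.1, ha'.2, hb'.1, hb'.2]) x hxm
    simp only [hxs] at E1 E2
    rw [show u k + g + (s - g - u k) = s by ring] at E1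
    rw [show u k + (s - g - u k) = s - g by ring] at E2
    rw [E1, E2]
  refine ⟨-g, fun s => ?_⟩
  obtain ⟨m, hm⟩ := exists_nat_gt (u 0 + g - s)
  have := hpos (s + m) (by linarith)
  rw [hγn, show s + m - g = (s + -g) + m by ring, hαn] at this
  exact this

end PursuitAux

namespace PursuitAux

/-- The bugs move at speed at most one. -/
theorem speed {G : GeodesicStructure M} {n : ℕ} [NeZero n] {b : ZMod n → ℝ → M}
    (hb : IsCyclicPursuit G n b) {t : ℝ} (ht : 0 ≤ t)
    (hsep : ∀ i, dist (b i t) (b (i + 1) t) < G.inj) (i : ZMod n) {r : ℝ} (hr : 0 < r) :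
    ∀ᶠ h in 𝓝[>] (0:ℝ), dist (b i (t + h)) (b i t) ≤ (1 + r) * h := by
  have direct : ∀ i : ZMod n, b i t ≠ b (i + 1) t →
      ∀ᶠ h in 𝓝[>] (0:ℝ), dist (b i (t + h)) (b i t) ≤ (1 + r) * h := by
    intro i hne
    have hd : 0 < dist (b i t) (b (i + 1) t) := dist_pos.2 hne
    have hi := (hsep i).trans_le (G.inj_le_injAt (b i t))
    have hch := (hb.chase i t ht hne hi).def hr
    have hch := hch.filter_mono (nhdsWithin_mono _ Ioi_subset_Ici_self)
    filter_upwards [hch, Ioo_mem_nhdsGT hd] with h hh hmem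
    rw [Real.norm_of_nonneg dist_nonneg, Real.norm_of_nonneg hmem.1.le] at hh
    have h1 := G.geod_dist _ _ hi (h / dist (b i t) (b (i + 1) t))
      ⟨div_nonneg hmem.1.le hd.le, by rw [div_le_one hd]; exact hmem.2.le⟩ 0 ⟨le_rfl, zero_le_one⟩
    rw [G.geod_zero _ _ hi, sub_zero, abs_of_nonneg (div_nonneg hmem.1.le hd.le),
      div_mul_cancel₀ _ hd.ne'] at h1
    have := dist_triangle (b i (t + h))
      (G.geod (b i t) (b (i + 1) t) (h / dist (b i t) (b (i + 1) t))) (b i t)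
    linarith
  have walk : ∀ k : ℕ, ∀ i : ZMod n, b (i + k) t ≠ b (i + k + 1) t →
      ∀ᶠ h in 𝓝[>] (0:ℝ), dist (b i (t + h)) (b i t) ≤ (1 + r) * h := by
    intro k
    induction k with
    | zero =>
      intro i hi
      apply direct
      simpa using hi
    | succ k ih =>
      intro i hi
      by_cases hne : b i t = b (i + 1) t
      · have := ih (i + 1) (by
          push_cast at hi
          rwa [show i + 1 + (k : ZMod n) = i + (k + 1) by ring])
        filter_upwards [this, self_mem_nhdsWithin] with h hh hpos
        have hpos : 0 < h := hpos
        rw [hb.merge i t ht hne (t + h) (by linarith), hne]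
        exact hh
      · exact direct i hne
  by_cases hex : ∃ k : ℕ, b (i + k) t ≠ b (i + k + 1) t
  · obtain ⟨k, hk⟩ := hex
    exact walk k i hk
  · push Not at hex
    have hall : ∀ k : ℕ, b (i + k) t = b i t := by
      intro k
      induction k with
      | zero => simp
      | succ k ih => push_cast; rw [← add_assoc, ← hex k, ih]
    have hall' : ∀ j, b j t = b i t := by
      intro j
      have := hall (j - i).val
      rwa [ZMod.natCast_zmod_val, add_sub_cancel] at this
    filter_upwards [self_mem_nhdsWithin] with h hpos
    have hpos : 0 < h := hpos
    rw [hb.halt t ht (fun j => (hall' j).trans (hall' 0).symm) (t + h) (by linarith) i,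
      hall' 0, dist_self]
    positivity

theorem dini {G : GeodesicStructure M} {n : ℕ} [NeZero n] {b : ZMod n → ℝ → M}
    (hb : IsCyclicPursuit G n b) {t : ℝ} (ht : 0 ≤ t)
    (hsep : ∀ i, dist (b i t) (b (i + 1) t) < G.inj) (i : ZMod n) {r : ℝ} (hr : 0 < r) :
    ∀ᶠ h in 𝓝[>] (0:ℝ), dist (b i (t + h)) (b (i + 1) (t + h)) ≤
      dist (b i t) (b (i + 1) t) + r * h := by
  by_cases hne : b i t = b (i + 1) t
  · filter_upwards [self_mem_nhdsWithin] with h hpos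
    have hpos : 0 < h := hpos
    rw [hb.merge i t ht hne (t + h) (by linarith), dist_self]
    positivity
  · have hd : 0 < dist (b i t) (b (i + 1) t) := dist_pos.2 hne
    have hi := (hsep i).trans_le (G.inj_le_injAt (b i t))
    have hch := (hb.chase i t ht hne hi).def (half_pos hr)
    have hch := hch.filter_mono (nhdsWithin_mono _ Ioi_subset_Ici_self)
    filter_upwards [hch, Ioo_mem_nhdsGT hd, speed hb ht hsep (i + 1) (half_pos hr)]
      with h hh hmem hsp
    rw [Real.norm_of_nonneg dist_nonneg, Real.norm_of_nonneg hmem.1.le] at hh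
    have hle : h / dist (b i t) (b (i + 1) t) ≤ 1 := by rw [div_le_one hd]; exact hmem.2.le
    have h1 := G.geod_dist _ _ hi (h / dist (b i t) (b (i + 1) t))
      ⟨div_nonneg hmem.1.le hd.le, hle⟩ 1 ⟨zero_le_one, le_rfl⟩
    rw [G.geod_one _ _ hi, abs_sub_comm, abs_of_nonneg (by linarith), sub_mul,
      div_mul_cancel₀ _ hd.ne', one_mul] at h1
    have := dist_triangle4 (b i (t + h))
      (G.geod (b i t) (b (i + 1) t) (h / dist (b i t) (b (i + 1) t))) (b (i + 1) t)
      (b (i + 1) (t + h))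
    rw [dist_comm (b (i + 1) t)] at this
    linarith

theorem antitone_of_dini {f : ℝ → ℝ} (hf : ContinuousOn f (Ici 0))
    (hd : ∀ t, 0 ≤ t → ∀ r > 0, ∀ᶠ h in 𝓝[>] (0:ℝ), f (t + h) ≤ f t + r * h) :
    AntitoneOn f (Ici 0) := by
  intro s hs t ht hst
  have hs : 0 ≤ s := hs
  refine image_le_of_liminf_slope_right_le_deriv_boundary (f := f) (a := s) (b := t)
    (B := fun _ => f s) (B' := fun _ => 0)
    (hf.mono (fun x hx => hs.trans hx.1)) le_rfl continuousOn_const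
    (fun x _ => hasDerivWithinAt_const _ _ _) ?_ ⟨hst, le_rfl⟩
  intro x hx r hr
  have hr : 0 < r := hr
  apply Eventually.frequently
  have h1 := hd x (hs.trans hx.1) (r / 2) (half_pos hr)
  have h2 : Tendsto (fun z => z - x) (𝓝[>] x) (𝓝[>] (0:ℝ)) := by
    apply tendsto_nhdsWithin_of_tendsto_nhds_of_eventually_within
    · have : Tendsto (fun z : ℝ => z - x) (𝓝 x) (𝓝 (x - x)) := by
        exact (continuous_id.sub continuous_const).tendsto x
      rw [sub_self] at this
      exact this.mono_left nhdsWithin_le_nhds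
    · filter_upwards [self_mem_nhdsWithin] with z hz
      exact sub_pos.2 (mem_Ioi.1 hz)
  filter_upwards [h2.eventually h1, self_mem_nhdsWithin] with z hz hzx
  have hzx : x < z := hzx
  rw [add_sub_cancel] at hz
  rw [slope_def_field, div_lt_iff₀ (by linarith)]
  nlinarith

theorem sep {G : GeodesicStructure M} {n : ℕ} [NeZero n] {b : ZMod n → ℝ → M}
    (hb : IsCyclicPursuit G n b) : ∀ t, 0 ≤ t → ∀ i, dist (b i t) (b (i + 1) t) < G.inj := by
  set F : ℝ → ℝ := fun t => Finset.univ.sup' Finset.univ_nonempty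
    (fun i : ZMod n => dist (b i t) (b (i + 1) t)) with hF
  have hF0 : F 0 < G.inj := by
    rw [hF, Finset.sup'_lt_iff]
    exact fun i _ => hb.init_sep i
  obtain ⟨c, hc1, hc2⟩ := exists_between hF0
  have hFc : ContinuousOn F (Ici 0) := by
    apply ContinuousOn.finset_sup'_apply
    intro i _
    exact continuous_dist.comp_continuousOn (ContinuousOn.prodMk (hb.cont i) (hb.cont (i + 1)))
  have hanti : AntitoneOn (fun t => min (F t) c) (Ici 0) := by
    apply antitone_of_dini
    · exact hFc.inf continuousOn_const
    · intro t ht r hr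
      by_cases hlt : F t < G.inj
      · have hs : ∀ i, dist (b i t) (b (i + 1) t) < G.inj := by
          rw [hF, Finset.sup'_lt_iff] at hlt
          exact fun i => hlt i (Finset.mem_univ i)
        filter_upwards [eventually_all.2 fun i => dini hb ht hs i hr, self_mem_nhdsWithin]
          with h hh hpos
        have hpos : 0 < h := hpos
        have hrh : 0 < r * h := by positivity
        have : F (t + h) ≤ F t + r * h := by
          rw [hF, Finset.sup'_le_iff]
          intro i _
          refine (hh i).trans ?_
          have := Finset.le_sup' (fun i : ZMod n => dist (b i t) (b (i + 1) t))
            (Finset.mem_univ i)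
          simp only
          linarith
        rw [← min_add_add_right]
        exact min_le_min this (by linarith)
      · push Not at hlt
        filter_upwards [self_mem_nhdsWithin] with h hpos
        have hpos : 0 < h := hpos
        have hrh : 0 < r * h := by positivity
        rw [min_eq_right (a := F t) (by linarith)]
        exact (min_le_right _ _).trans (by linarith)
  intro t ht i
  have h1 := hanti (mem_Ici.2 le_rfl) (mem_Ici.2 ht) ht
  simp only at h1
  rw [min_eq_left hc1.le] at h1
  have h2 : F t < G.inj := by
    rcases min_choice (F t) c with h | h <;> rw [h] at h1 <;> linarith
  rw [hF, Finset.sup'_lt_iff] at h2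
  exact h2 i (Finset.mem_univ i)

theorem dist_antitone {G : GeodesicStructure M} {n : ℕ} [NeZero n] {b : ZMod n → ℝ → M}
    (hb : IsCyclicPursuit G n b) (i : ZMod n) :
    AntitoneOn (fun t => dist (b i t) (b (i + 1) t)) (Ici 0) :=
  antitone_of_dini (continuous_dist.comp_continuousOn (ContinuousOn.prodMk (hb.cont i) (hb.cont (i + 1))))
    fun _ ht _ hr => dini hb ht (sep hb _ ht) i hr

theorem length_tendsto {G : GeodesicStructure M} {n : ℕ} [NeZero n] {b : ZMod n → ℝ → M}
    (hb : IsCyclicPursuit G n b) :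
    ∃ ℓ : ℝ, Tendsto (fun t => ∑ i, dist (b i t) (b (i + 1) t)) atTop (𝓝 ℓ) := by
  have hanti : Antitone (fun t => ∑ i, dist (b i (max t 0)) (b (i + 1) (max t 0))) := by
    intro s t hst
    apply Finset.sum_le_sum
    intro i _
    exact dist_antitone hb i (mem_Ici.2 (le_max_right _ _)) (mem_Ici.2 (le_max_right _ _))
      (max_le_max_right 0 hst)
  have := tendsto_atTop_ciInf hanti ⟨0, by
    rintro _ ⟨t, rfl⟩
    exact Finset.sum_nonneg fun i _ => dist_nonneg⟩
  refine ⟨_, this.congr' ?_⟩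
  filter_upwards [eventually_ge_atTop 0] with t ht
  rw [max_eq_left ht]

end PursuitAux

namespace PursuitAux

structure PL (n : ℕ) (γ : ℝ → M) (σ : ℕ → ℝ) (p : ℕ → M) (ℓ : ℝ) : Prop where
  per : Function.Periodic γ 1
  zero : σ 0 = 0
  one : σ n = 1
  mono : ∀ i < n, σ i ≤ σ (i + 1)
  vert : ∀ i ≤ n, γ (σ i) = p i
  piece : ∀ i < n, ∀ s ∈ Icc (σ i) (σ (i + 1)), ∀ u ∈ Icc (σ i) (σ (i + 1)),
    dist (γ s) (γ u) = |s - u| * ℓ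

theorem pl_of_loop {G : GeodesicStructure M} {n : ℕ} [NeZero n] {b : ZMod n → M} {β : ℝ → M}
    (h : IsPursuitLoop G b β) (hsep : ∀ i, dist (b i) (b (i + 1)) < G.inj) :
    ∃ σ, PL n β σ (fun i => b (i : ZMod n)) (∑ i, dist (b i) (b (i + 1))) := by
  obtain ⟨hper, hb0, σ, h0, h1, hmono, hlen, hpc⟩ := h
  refine ⟨σ, hper, h0, h1, fun i _ => hmono (Nat.le_succ i), ?_, ?_⟩
  · intro i hi
    rcases hi.lt_or_eq with hi | rfl
    · rw [hpc i hi _ ⟨le_rfl, hmono (Nat.le_succ i)⟩, sub_self, zero_div, G.geod_zero]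
      exact (hsep _).trans_le (G.inj_le_injAt _)
    · have := hper 0
      rw [zero_add] at this
      rw [h1, this, hb0]
      simp
  · intro i hi s hs u hu
    have hle := hmono (Nat.le_succ i)
    rcases hle.eq_or_lt with heq | hlt
    · have : s = u := by
        have a1 := hs.1; have a2 := hs.2; have a3 := hu.1; have a4 := hu.2
        simp only [Nat.succ_eq_add_one] at heq
        linarith
      simp [this]
    · have hpos : 0 < σ (i + 1) - σ i := by
        simp only [Nat.succ_eq_add_one] at hlt
        linarith
      have hm : ∀ x ∈ Icc (σ i) (σ (i + 1)), (x - σ i) / (σ (i + 1) - σ i) ∈ Icc (0:ℝ) 1 := by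
        intro x hx
        refine ⟨div_nonneg (by linarith [hx.1]) hpos.le, ?_⟩
        rw [div_le_one hpos]; linarith [hx.2]
      rw [hpc i hi s hs, hpc i hi u hu,
        G.geod_dist _ _ ((hsep _).trans_le (G.inj_le_injAt _)) _ (hm s hs) _ (hm u hu),
        ← hlen i hi, ← sub_div, sub_sub_sub_cancel_right, abs_div, abs_of_pos hpos]
      field_simp

theorem lip_glue {γ : ℝ → M} {ℓ a b c : ℝ}
    (h1 : ∀ s ∈ Icc a b, ∀ u ∈ Icc a b, dist (γ s) (γ u) ≤ ℓ * |s - u|)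
    (h2 : ∀ s ∈ Icc b c, ∀ u ∈ Icc b c, dist (γ s) (γ u) ≤ ℓ * |s - u|) :
    ∀ s ∈ Icc a c, ∀ u ∈ Icc a c, dist (γ s) (γ u) ≤ ℓ * |s - u| := by
  have main : ∀ s ∈ Icc a c, ∀ u ∈ Icc a c, s ≤ u → dist (γ s) (γ u) ≤ ℓ * |s - u| := by
    intro s hs u hu hsu
    rcases le_total u b with hub | hub
    · exact h1 s ⟨hs.1, hsu.trans hub⟩ u ⟨hu.1, hub⟩
    · rcases le_total s b with hsb | hsb
      · have e1 := h1 s ⟨hs.1, hsb⟩ b ⟨hs.1.trans hsb, le_rfl⟩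
        have e2 := h2 b ⟨le_rfl, hub.trans hu.2⟩ u ⟨hub, hu.2⟩
        have := dist_triangle (γ s) (γ b) (γ u)
        rw [abs_sub_comm, abs_of_nonneg (by linarith)] at e1 e2 ⊢
        linarith
      · exact h2 s ⟨hsb, hs.2⟩ u ⟨hub, hu.2⟩
  intro s hs u hu
  rcases le_total s u with h | h
  · exact main s hs u hu h
  · rw [dist_comm, abs_sub_comm]; exact main u hu s hs h

theorem PL.lip {n : ℕ} {γ : ℝ → M} {σ : ℕ → ℝ} {p : ℕ → M} {ℓ : ℝ} (h : PL n γ σ p ℓ) :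
    ∀ s u, dist (γ s) (γ u) ≤ ℓ * |s - u| := by
  have triv : ∀ a : ℝ, ∀ s ∈ Icc a a, ∀ u ∈ Icc a a, dist (γ s) (γ u) ≤ ℓ * |s - u| := by
    intro a s hs u hu
    rw [Icc_self, mem_singleton_iff] at hs hu
    simp [hs, hu]
  have st1 : ∀ i ≤ n, ∀ s ∈ Icc 0 (σ i), ∀ u ∈ Icc 0 (σ i), dist (γ s) (γ u) ≤ ℓ * |s - u| := by
    intro i
    induction i with
    | zero => intro _; rw [h.zero]; exact triv 0
    | succ i ih =>
      intro hi
      refine lip_glue (ih (by omega)) fun s hs u hu => ?_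
      rw [h.piece i (by omega) s hs u hu, mul_comm]
  have st2 := st1 n le_rfl
  rw [h.one] at st2
  have hn : ∀ (x : ℝ) (m : ℕ), γ (x + m) = γ x := by
    intro x m
    have := h.per.nat_mul m x
    rwa [mul_one] at this
  have st3 : ∀ m : ℕ, ∀ s ∈ Icc 0 (m:ℝ), ∀ u ∈ Icc 0 (m:ℝ), dist (γ s) (γ u) ≤ ℓ * |s - u| := by
    intro m
    induction m with
    | zero => rw [Nat.cast_zero]; exact triv 0
    | succ m ih =>
      refine lip_glue ih fun s hs u hu => ?_
      push_cast at hs hu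
      have := st2 (s - m) ⟨by linarith [hs.1], by linarith [hs.2]⟩ (u - m)
        ⟨by linarith [hu.1], by linarith [hu.2]⟩
      rw [← hn (s - m) m, ← hn (u - m) m] at this
      simpa using this
  intro s u
  obtain ⟨m, hm⟩ := exists_nat_gt (max |s| |u|)
  have hs := abs_lt.1 ((le_max_left _ _).trans_lt hm)
  have hu := abs_lt.1 ((le_max_right _ _).trans_lt hm)
  have := st3 (m + m) (s + m) ⟨by linarith, by push_cast; linarith⟩ (u + m)
    ⟨by linarith, by push_cast; linarith⟩
  rw [hn, hn] at this
  simpa using this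

theorem PL.monoOn {n : ℕ} {γ : ℝ → M} {σ : ℕ → ℝ} {p : ℕ → M} {ℓ : ℝ} (h : PL n γ σ p ℓ) :
    ∀ i ≤ n, ∀ j ≤ i, σ j ≤ σ i := by
  intro i
  induction i with
  | zero => intro _ j hj; rw [Nat.le_zero.1 hj]
  | succ i ih =>
    intro hi j hj
    rcases Nat.le_succ_iff.1 hj with h' | rfl
    · exact (ih (by omega) j h').trans (h.mono i (by omega))
    · exact le_rfl

theorem PL.mem01 {n : ℕ} {γ : ℝ → M} {σ : ℕ → ℝ} {p : ℕ → M} {ℓ : ℝ} (h : PL n γ σ p ℓ) :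
    ∀ i ≤ n, σ i ∈ Icc (0:ℝ) 1 := by
  intro i hi
  rw [← h.zero, ← h.one]
  exact ⟨h.monoOn i hi 0 (Nat.zero_le _), h.monoOn n le_rfl i hi⟩

/-- every parameter in `[0,1]` lies in one of the pieces -/
theorem cover {σ : ℕ → ℝ} (h0 : σ 0 = 0) {s : ℝ} (hs : 0 ≤ s) : ∀ n : ℕ, s ≤ σ n →
    s = 0 ∨ ∃ i < n, s ∈ Icc (σ i) (σ (i + 1)) := by
  intro n
  induction n with
  | zero => intro h; left; rw [h0] at h; exact le_antisymm h hs
  | succ n ih =>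
    intro h
    rcases le_total s (σ n) with h' | h'
    · rcases ih h' with h | ⟨i, hi, hm⟩
      · exact Or.inl h
      · exact Or.inr ⟨i, by omega, hm⟩
    · exact Or.inr ⟨n, by omega, h', h⟩

theorem periodic_fract {X : Type*} {f : ℝ → X} (hf : Function.Periodic f 1) (s : ℝ) :
    f (Int.fract s) = f s := by
  have := hf.sub_int_mul_eq (x := s) ⌊s⌋
  rw [mul_one] at this
  exact this

theorem PL.unique (G : GeodesicStructure M) {n : ℕ} {γ γ' : ℝ → M} {σ σ' : ℕ → ℝ} {p : ℕ → M}
    {ℓ : ℝ} (hℓ : 0 < ℓ) (h : PL n γ σ p ℓ) (h' : PL n γ' σ' p ℓ)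
    (hsep : ∀ i < n, dist (p i) (p (i + 1)) < G.inj) : ∀ s, γ s = γ' s := by
  have hd : ∀ {γ : ℝ → M} {σ : ℕ → ℝ}, PL n γ σ p ℓ → ∀ i < n,
      dist (p i) (p (i + 1)) = (σ (i + 1) - σ i) * ℓ := by
    intro γ σ h i hi
    have hm := h.mono i hi
    rw [← h.vert i hi.le, ← h.vert (i + 1) hi, h.piece i hi _ ⟨le_rfl, hm⟩ _ ⟨hm, le_rfl⟩,
      abs_sub_comm, abs_of_nonneg (by linarith)]
  have hσ : ∀ i ≤ n, σ i = σ' i := by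
    intro i
    induction i with
    | zero => intro _; rw [h.zero, h'.zero]
    | succ i ih =>
      intro hi
      have e1 := hd h i (by omega)
      rw [hd h' i (by omega), ih (by omega)] at e1
      have := mul_right_cancel₀ hℓ.ne' e1
      linarith
  have geo : ∀ {γ : ℝ → M} {σ : ℕ → ℝ}, PL n γ σ p ℓ → ∀ i < n, ∀ s ∈ Icc (σ i) (σ (i + 1)),
      σ i < σ (i + 1) →
      γ s = G.geod (p i) (p (i + 1)) ((s - σ i) / (σ (i + 1) - σ i)) := by
    intro γ σ h i hi s hs hlt
    have hpos : 0 < σ (i + 1) - σ i := by linarith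
    have hmem : ∀ x ∈ Icc (0:ℝ) 1, σ i + x * (σ (i + 1) - σ i) ∈ Icc (σ i) (σ (i + 1)) := by
      intro x hx
      constructor <;> nlinarith [hx.1, hx.2]
    have := G.geod_unique (p i) (p (i + 1)) ((hsep i hi).trans_le (G.inj_le_injAt _))
      (fun x => γ (σ i + x * (σ (i + 1) - σ i)))
      (by simp only [zero_mul, add_zero]; exact h.vert i hi.le)
      (by simp only [one_mul, add_sub_cancel]; exact h.vert (i + 1) hi)
      (by
        intro x hx y hy
        rw [h.piece i hi _ (hmem x hx) _ (hmem y hy), hd h i hi, add_sub_add_left_eq_sub,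
          ← sub_mul, abs_mul, abs_of_pos hpos]
        ring)
      ((s - σ i) / (σ (i + 1) - σ i))
      ⟨div_nonneg (by linarith [hs.1]) hpos.le, by rw [div_le_one hpos]; linarith [hs.2]⟩
    rw [← this]
    rw [div_mul_cancel₀ _ hpos.ne', add_sub_cancel]
  intro s
  rw [← periodic_fract h.per, ← periodic_fract h'.per]
  rcases cover h.zero (Int.fract_nonneg s) n (by rw [h.one]; exact (Int.fract_lt_one s).le)
    with h0 | ⟨i, hi, hm⟩
  · rw [h0]
    have e1 := h.vert 0 (Nat.zero_le _)
    have e2 := h'.vert 0 (Nat.zero_le _)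
    rw [h.zero] at e1
    rw [h'.zero] at e2
    rw [e1, e2]
  · rcases (h.mono i hi).eq_or_lt with heq | hlt
    · have : Int.fract s = σ i := le_antisymm (hm.2.trans heq.ge) hm.1
      rw [this, h.vert i hi.le, hσ i hi.le, h'.vert i hi.le]
    · rw [geo h i hi _ hm hlt]
      rw [hσ i hi.le, hσ (i + 1) hi] at hm hlt ⊢
      rw [geo h' i hi _ hm hlt]

theorem exists_lim {I : Type*} (U : Ultrafilter I) {K : Set M} (hK : IsCompact K)
    (hne : K.Nonempty) (x : I → M) (hx : ∀ ε > 0, ∀ᶠ i in (U : Filter I), infDist (x i) K < ε) :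
    ∃ y ∈ K, Tendsto x U (𝓝 y) := by
  choose z hz hzd using fun i => hK.exists_infDist_eq_dist hne (x i)
  obtain ⟨y, hy, hle⟩ := hK.ultrafilter_le_nhds (U.map z) (by
    rw [Filter.le_principal_iff]
    exact Filter.Eventually.of_forall (f := (U : Filter I)) hz)
  have hzt : Tendsto z U (𝓝 y) := hle
  refine ⟨y, hy, ?_⟩
  rw [tendsto_iff_dist_tendsto_zero] at hzt ⊢
  have h0 : Tendsto (fun i => dist (x i) (z i)) U (𝓝 0) := by
    rw [Metric.tendsto_nhds]
    intro ε hε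
    filter_upwards [hx ε hε] with i hi
    rw [Real.dist_eq, sub_zero, abs_of_nonneg dist_nonneg, ← hzd i]
    exact hi
  have := h0.add hzt
  rw [add_zero] at this
  exact squeeze_zero (fun _ => dist_nonneg) (fun i => dist_triangle _ _ _) this

theorem exists_lim_real {I : Type*} (U : Ultrafilter I) (x : I → ℝ)
    (hx : ∀ᶠ i in (U : Filter I), x i ∈ Icc (0:ℝ) 1) :
    ∃ y ∈ Icc (0:ℝ) 1, Tendsto x U (𝓝 y) := by
  obtain ⟨y, hy, hle⟩ := (isCompact_Icc (a := (0:ℝ)) (b := 1)).ultrafilter_le_nhds (U.map x) (by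
    rw [Filter.le_principal_iff]; exact hx)
  exact ⟨y, hy, hle⟩

/-- Ultralimits of piecewise geodesic loops near a compact set. -/
theorem pl_limit {I : Type*} (U : Ultrafilter I) {K : Set M} (hK : IsCompact K)
    (hne : K.Nonempty) {n : ℕ} (γ : I → ℝ → M) (σ : I → ℕ → ℝ) (p : I → ℕ → M) (ℓ : I → ℝ)
    (hPL : ∀ᶠ i in (U : Filter I), PL n (γ i) (σ i) (p i) (ℓ i)) {l : ℝ} (hℓ : Tendsto ℓ U (𝓝 l))
    (hK' : ∀ s, ∀ ε > 0, ∀ᶠ i in (U : Filter I), infDist (γ i s) K < ε) :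
    ∃ (g : ℝ → M) (σ' : ℕ → ℝ) (q : ℕ → M), PL n g σ' q l ∧ (∀ s, g s ∈ K) ∧
      (∀ i ≤ n, Tendsto (fun k => p k i) U (𝓝 (q i))) ∧
      (∀ (x : I → ℝ) (s : ℝ), Tendsto x U (𝓝 s) → Tendsto (fun k => γ k (x k)) U (𝓝 (g s))) := by
  choose g hgK hg using fun s => exists_lim U hK hne (fun i => γ i s) (hK' s)
  have hσex : ∀ j, ∃ y, j ≤ n → Tendsto (fun i => σ i j) U (𝓝 y) := by
    intro j
    by_cases hj : j ≤ n
    · obtain ⟨y, _, hy⟩ := exists_lim_real U (fun i => σ i j) (by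
        filter_upwards [hPL] with i hi
        exact hi.mem01 j hj)
      exact ⟨y, fun _ => hy⟩
    · exact ⟨0, fun h => absurd h hj⟩
  choose σ' hσ' using hσex
  have hconv : ∀ (x : I → ℝ) (s : ℝ), Tendsto x U (𝓝 s) →
      Tendsto (fun k => γ k (x k)) U (𝓝 (g s)) := by
    intro x s hx
    have h1 := hg s
    rw [tendsto_iff_dist_tendsto_zero] at h1 ⊢
    have h2 : Tendsto (fun k => ℓ k * |x k - s|) U (𝓝 (l * |s - s|)) :=
      hℓ.mul (hx.sub tendsto_const_nhds).abs
    have h3 := h2.add h1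
    rw [sub_self, abs_zero, mul_zero, add_zero] at h3
    refine squeeze_zero' (Eventually.of_forall fun _ => dist_nonneg) ?_ h3
    filter_upwards [hPL] with k hk
    have := dist_triangle (γ k (x k)) (γ k s) (g s)
    have := hk.lip (x k) s
    linarith
  have hvert : ∀ i ≤ n, Tendsto (fun k => p k i) U (𝓝 (g (σ' i))) := by
    intro i hi
    refine (hconv _ _ (hσ' i hi)).congr' ?_
    filter_upwards [hPL] with k hk
    exact hk.vert i hi
  have hmono : ∀ i < n, σ' i ≤ σ' (i + 1) := by
    intro i hi
    refine le_of_tendsto_of_tendsto (hσ' i hi.le) (hσ' (i + 1) hi) ?_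
    filter_upwards [hPL] with k hk
    exact hk.mono i hi
  refine ⟨g, σ', fun i => g (σ' i), ⟨?_, ?_, ?_, hmono, fun _ _ => rfl, ?_⟩, hgK, hvert, hconv⟩
  · intro s
    refine tendsto_nhds_unique (hg (s + 1)) ((hg s).congr' ?_)
    filter_upwards [hPL] with k hk
    exact (hk.per s).symm
  · refine tendsto_nhds_unique (hσ' 0 (Nat.zero_le _)) (tendsto_const_nhds.congr' ?_)
    filter_upwards [hPL] with k hk
    exact hk.zero.symm
  · refine tendsto_nhds_unique (hσ' n le_rfl) (tendsto_const_nhds.congr' ?_)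
    filter_upwards [hPL] with k hk
    exact hk.one.symm
  · intro i hi s hs u hu
    have hcl : ∀ s ∈ Icc (σ' i) (σ' (i + 1)),
        Tendsto (fun k => max (σ k i) (min s (σ k (i + 1)))) U (𝓝 s) := by
      intro s hs
      have : Tendsto (fun k => max (σ k i) (min s (σ k (i + 1)))) U
          (𝓝 (max (σ' i) (min s (σ' (i + 1))))) :=
        (hσ' i hi.le).max (tendsto_const_nhds.min (hσ' (i + 1) hi))
      rwa [min_eq_left hs.2, max_eq_right hs.1] at this
    have e1 := (hconv _ _ (hcl s hs)).dist (hconv _ _ (hcl u hu))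
    have e2 := ((hcl s hs).sub (hcl u hu)).abs.mul hℓ
    refine tendsto_nhds_unique e1 (e2.congr' ?_)
    filter_upwards [hPL] with k hk
    have hm := hk.mono i hi
    have hmem : ∀ s, max (σ k i) (min s (σ k (i + 1))) ∈ Icc (σ k i) (σ k (i + 1)) :=
      fun s => ⟨le_max_left _ _, max_le hm (min_le_right _ _)⟩
    exact (hk.piece i hi _ (hmem s) _ (hmem u)).symm

end PursuitAux

namespace PursuitAux

theorem nat_ge_atTop {τ : ℕ → ℝ} (h : ∀ k : ℕ, (k:ℝ) ≤ τ k) :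
    Tendsto τ (hyperfilter ℕ : Filter ℕ) atTop :=
  (tendsto_atTop_mono h tendsto_natCast_atTop_atTop).mono_left Nat.hyperfilter_le_atTop

end PursuitAux

/-- Proposition `DONE`. Let `M` be a Riemannian manifold with
`inj M > 0`, `b` cyclic pursuit curves on `M`, `β t` the associated loops.  Suppose there
is a sequence `t j → ∞` and a closed geodesic `α` with `β (t j) → α` uniformly.  If
`sup_s d (β t s) (α (S¹))→ 0` as `t → ∞`, then `β t` converges to `α` as `t → ∞` in the
rotation-quotient sense: `inf_c sup_s d (β t s) (α (s+c)) → 0`. -/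
theorem riemannian_pursuit_convergence_criterion
    {M : Type*} [MetricSpace M] (G : GeodesicStructure M) (hinj : 0 < G.inj)
    (n : ℕ) [NeZero n] (b : ZMod n → ℝ → M) (hb : IsCyclicPursuit G n b)
    (β : ℝ → ℝ → M) (hβ : ∀ t : ℝ, 0 ≤ t → IsPursuitLoop G (fun i => b i t) (β t))
    (α : ℝ → M) (L : ℝ) (hα : IsClosedGeodesic α L)
    (tj : ℕ → ℝ) (htj : Tendsto tj atTop atTop)
    (hunif : ∀ ε > (0:ℝ), ∃ J : ℕ, ∀ j, J ≤ j → ∀ s : ℝ, dist (β (tj j) s) (α s) < ε)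
    (hsup : ∀ ε > (0:ℝ), ∃ T : ℝ, ∀ t, T ≤ t → ∀ s : ℝ,
      infDist (β t s) (range α) < ε) :
    LoopTendsto β α := by
  have hsep := PursuitAux.sep hb
  have hαc : Continuous α := by
    obtain ⟨_, hL, e, he, hiso⟩ := hα
    exact PursuitAux.cg_continuous hL he hiso
  have hαp : Function.Periodic α 1 := hα.1
  have hL : 0 < L := hα.2.1
  have hKc : IsCompact (range α) := by
    rw [PursuitAux.periodic_range hαp]
    exact isCompact_Icc.image hαc
  have hKn : (range α).Nonempty := range_nonempty α
  obtain ⟨l, hl⟩ := PursuitAux.length_tendsto hb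
  have hPL : ∀ t, ∃ σ, 0 ≤ t → PursuitAux.PL n (β t) σ (fun i => b (i : ZMod n) t)
      (∑ i, dist (b i t) (b (i + 1) t)) := by
    intro t
    by_cases ht : 0 ≤ t
    · obtain ⟨σ, h⟩ := PursuitAux.pl_of_loop (hβ t ht) (hsep t ht)
      exact ⟨σ, fun _ => h⟩
    · exact ⟨0, fun h => absurd h ht⟩
  choose σ hσ using hPL
  have lim : ∀ τ : ℕ → ℝ, Tendsto τ (hyperfilter ℕ : Filter ℕ) atTop →
      ∃ (g : ℝ → M) (σ' : ℕ → ℝ) (q : ℕ → M), PursuitAux.PL n g σ' q l ∧ (∀ s, g s ∈ range α) ∧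
      (∀ i ≤ n, Tendsto (fun k => b (i : ZMod n) (τ k)) (hyperfilter ℕ : Filter ℕ) (𝓝 (q i))) ∧
      (∀ (x : ℕ → ℝ) (s : ℝ), Tendsto x (hyperfilter ℕ : Filter ℕ) (𝓝 s) →
        Tendsto (fun k => β (τ k) (x k)) (hyperfilter ℕ : Filter ℕ) (𝓝 (g s))) := by
    intro τ hτ
    refine PursuitAux.pl_limit (hyperfilter ℕ) hKc hKn (fun k => β (τ k)) (fun k => σ (τ k))
      (fun k i => b (i : ZMod n) (τ k)) (fun k => ∑ i, dist (b i (τ k)) (b (i + 1) (τ k)))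
      ?_ (hl.comp hτ) ?_
    · filter_upwards [hτ.eventually (eventually_ge_atTop 0)] with k hk
      exact hσ _ hk
    · intro s ε hε
      obtain ⟨T, hT⟩ := hsup ε hε
      filter_upwards [hτ.eventually (eventually_ge_atTop T)] with k hk
      exact hT _ hk s
  -- the limiting length is `L`
  have hlL : l = L := by
    obtain ⟨g, σ', q, hg, -, -, hconv⟩ := lim tj (htj.mono_left Nat.hyperfilter_le_atTop)
    have hgα : ∀ s, g s = α s := by
      intro s
      refine tendsto_nhds_unique (hconv (fun _ => s) s tendsto_const_nhds) ?_
      refine Tendsto.mono_left ?_ Nat.hyperfilter_le_atTop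
      rw [Metric.tendsto_atTop]
      intro ε hε
      obtain ⟨J, hJ⟩ := hunif ε hε
      exact ⟨J, fun j hj => hJ j hj s⟩
    have hex : ∃ i < n, σ' i < σ' (i + 1) := by
      by_contra hcon
      push Not at hcon
      have : ∀ i ≤ n, σ' i ≤ 0 := by
        intro i
        induction i with
        | zero => intro _; exact hg.zero.le
        | succ i ih => intro hi; exact (hcon i (by omega)).trans (ih (by omega))
      have := this n le_rfl
      rw [hg.one] at this
      linarith
    obtain ⟨i, hi, hlt⟩ := hex
    obtain ⟨_, _, e, he, hiso⟩ := hα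
    have hr : 0 < min (σ' (i + 1) - σ' i) e := lt_min (by linarith) he
    have h1 := min_le_left (σ' (i + 1) - σ' i) e
    have h2 := min_le_right (σ' (i + 1) - σ' i) e
    set r := min (σ' (i + 1) - σ' i) e
    have habs : |σ' i + r - σ' i| = r := by rw [add_sub_cancel_left, abs_of_pos hr]
    have e1 := hg.piece i hi (σ' i + r) ⟨by linarith, by linarith⟩ (σ' i) ⟨le_rfl, hlt.le⟩
    rw [hgα, hgα, hiso _ _ (by rw [habs]; exact h2), habs, mul_comm] at e1
    exact (mul_left_cancel₀ hr.ne' e1).symm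
  rw [hlL] at lim
  -- coarse continuity in time
  have coarse : ∀ ε > 0, ∃ k : ℕ, ∀ t t' : ℝ, (k:ℝ) ≤ t → (k:ℝ) ≤ t' →
      (∀ i, dist (b i t) (b i t') < 1 / ((k:ℝ) + 1)) → ∀ s, dist (β t s) (β t' s) < ε := by
    intro ε hε
    by_contra hcon
    push Not at hcon
    choose t t' ht ht' hd s hs using hcon
    obtain ⟨g, σ₁, q, hg, -, hq, hconv⟩ := lim t (PursuitAux.nat_ge_atTop ht)
    obtain ⟨g', σ₂, q', hg', -, hq', hconv'⟩ := lim t' (PursuitAux.nat_ge_atTop ht')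
    have h0 : Tendsto (fun k : ℕ => 1 / ((k:ℝ) + 1)) (hyperfilter ℕ : Filter ℕ) (𝓝 0) :=
      tendsto_one_div_add_atTop_nhds_zero_nat.mono_left Nat.hyperfilter_le_atTop
    have hqq : ∀ i ≤ n, q i = q' i := by
      intro i hi
      have h1 := (hq i hi).dist (hq' i hi)
      have h2 := squeeze_zero (fun _ => dist_nonneg) (fun k => (hd k (i : ZMod n)).le) h0
      exact dist_eq_zero.1 (tendsto_nhds_unique h1 h2)
    have hg'' : PursuitAux.PL n g' σ₂ q L :=
      ⟨hg'.per, hg'.zero, hg'.one, hg'.mono, fun i hi => (hg'.vert i hi).trans (hqq i hi).symm,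
        hg'.piece⟩
    have hgg := PursuitAux.PL.unique G hL hg hg'' (by
      intro i hi
      refine lt_of_le_of_lt ?_ (hb.init_sep (i : ZMod n))
      refine le_of_tendsto ((hq i hi.le).dist (hq (i + 1) hi)) ?_
      refine Eventually.of_forall fun k => ?_
      have h0 : 0 ≤ t k := (Nat.cast_nonneg k).trans (ht k)
      push_cast
      exact PursuitAux.dist_antitone hb (i : ZMod n) (mem_Ici.2 le_rfl) (mem_Ici.2 h0) h0)
    obtain ⟨s', -, hs'⟩ := PursuitAux.exists_lim_real (hyperfilter ℕ) (fun k => Int.fract (s k))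
      (Eventually.of_forall fun k => ⟨Int.fract_nonneg _, (Int.fract_lt_one _).le⟩)
    have h1 := (hconv _ _ hs').dist (hconv' _ _ hs')
    rw [hgg s', dist_self] at h1
    have : ε ≤ 0 := by
      refine ge_of_tendsto h1 (Eventually.of_forall fun k => ?_)
      rw [PursuitAux.periodic_fract (hβ _ ((Nat.cast_nonneg k).trans (ht k))).1,
        PursuitAux.periodic_fract (hβ _ ((Nat.cast_nonneg k).trans (ht' k))).1]
      exact hs k
    linarith
  obtain ⟨ε₀, hε₀, hisol⟩ := PursuitAux.isolation G hinj hα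
  -- self-improvement
  have improve : ∀ ε > 0, 2 * ε < ε₀ → ∃ k : ℕ, ∀ t : ℝ, (k:ℝ) ≤ t →
      (∃ c, ∀ s, dist (β t s) (α (s + c)) < 2 * ε) → ∃ c, ∀ s, dist (β t s) (α (s + c)) < ε := by
    intro ε hε hεε
    by_contra hcon
    push Not at hcon
    choose t ht hex hs using hcon
    choose c hc using hex
    obtain ⟨g, σ₁, q, hg, hgr, -, hconv⟩ := lim t (PursuitAux.nat_ge_atTop ht)
    obtain ⟨c', -, hc'⟩ := PursuitAux.exists_lim_real (hyperfilter ℕ) (fun k => Int.fract (c k))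
      (Eventually.of_forall fun k => ⟨Int.fract_nonneg _, (Int.fract_lt_one _).le⟩)
    have hclose : ∀ s, dist (g s) (α (s + c')) < ε₀ := by
      intro s
      refine lt_of_le_of_lt ?_ hεε
      have h1 := hconv (fun _ => s) s tendsto_const_nhds
      have h2 : Tendsto (fun k => α (s + Int.fract (c k))) (hyperfilter ℕ : Filter ℕ)
          (𝓝 (α (s + c'))) := (hαc.tendsto _).comp (tendsto_const_nhds.add hc')
      refine le_of_tendsto (h1.dist h2) (Eventually.of_forall fun k => ?_)
      have hper : Function.Periodic (fun x => α (s + x)) 1 := by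
        intro x
        simp only
        rw [← add_assoc]
        exact hαp _
      have : α (s + Int.fract (c k)) = α (s + c k) := PursuitAux.periodic_fract hper (c k)
      rw [this]
      exact (hc k s).le
    obtain ⟨d, hd⟩ := hisol (fun s => g (s - c'))
      (by
        intro s
        simp only
        rw [show s + 1 - c' = (s - c') + 1 by ring]
        exact hg.per _)
      (fun s => hgr _)
      (by
        intro s u
        have := hg.lip (s - c') (u - c')
        rwa [sub_sub_sub_cancel_right] at this)
      (by
        intro s
        have := hclose (s - c')
        rwa [sub_add_cancel] at this)
    have hgα : ∀ s, g s = α (s + (c' + d)) := by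
      intro s
      have := hd (s + c')
      simp only [add_sub_cancel_right] at this
      rw [this, add_assoc]
    have hs₂ := fun k => hs k (c' + d)
    choose s hs using hs₂
    obtain ⟨s', -, hs'⟩ := PursuitAux.exists_lim_real (hyperfilter ℕ) (fun k => Int.fract (s k))
      (Eventually.of_forall fun k => ⟨Int.fract_nonneg _, (Int.fract_lt_one _).le⟩)
    have h1 := hconv _ _ hs'
    have h2 : Tendsto (fun k => α (Int.fract (s k) + (c' + d))) (hyperfilter ℕ : Filter ℕ)
        (𝓝 (α (s' + (c' + d)))) := (hαc.tendsto _).comp (hs'.add tendsto_const_nhds)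
    have h3 := h1.dist h2
    rw [hgα s', dist_self] at h3
    have : ε ≤ 0 := by
      refine ge_of_tendsto h3 (Eventually.of_forall fun k => ?_)
      have hper : Function.Periodic (fun x => α (x + (c' + d))) 1 := by
        intro x
        simp only
        rw [add_right_comm]
        exact hαp _
      have : α (Int.fract (s k) + (c' + d)) = α (s k + (c' + d)) :=
        PursuitAux.periodic_fract hper (s k)
      rw [PursuitAux.periodic_fract (hβ _ ((Nat.cast_nonneg k).trans (ht k))).1, this]
      exact hs k
    linarith
  -- conclusion by connectedness of `[T, ∞)`
  intro ε' hε'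
  obtain ⟨ε, hε, hεε', hεε⟩ : ∃ ε > 0, ε ≤ ε' ∧ 2 * ε < ε₀ :=
    ⟨min ε' (ε₀ / 3), by positivity, min_le_left _ _, by
      have := min_le_right ε' (ε₀ / 3); linarith⟩
  obtain ⟨k₁, hk₁⟩ := improve ε hε hεε
  obtain ⟨k₂, hk₂⟩ := coarse ε hε
  obtain ⟨J, hJ⟩ := hunif ε hε
  obtain ⟨j, hj1, hj2⟩ := ((htj.eventually (eventually_ge_atTop (max (k₁:ℝ) k₂))).and
    (eventually_ge_atTop J)).exists
  have hT0 : 0 ≤ tj j := (Nat.cast_nonneg k₁).trans ((le_max_left _ _).trans hj1)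
  have hpre : IsPreconnected (Ici (tj j)) := isPreconnected_Ici
  have step : ∀ t ∈ Ici (tj j), ∀ t' ∈ Ici (tj j),
      (∀ i, dist (b i t) (b i t') < 1 / ((k₂:ℝ) + 1)) →
      (∃ c, ∀ s, dist (β t s) (α (s + c)) < ε) → ∃ c, ∀ s, dist (β t' s) (α (s + c)) < ε := by
    intro t ht t' ht' hd ⟨c, hc⟩
    have ht : tj j ≤ t := ht
    have ht' : tj j ≤ t' := ht'
    refine hk₁ t' (((le_max_left _ _).trans hj1).trans ht') ⟨c, fun s => ?_⟩
    have h1 := hk₂ t t' (((le_max_right _ _).trans hj1).trans ht)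
      (((le_max_right _ _).trans hj1).trans ht') hd s
    have h2 := dist_triangle_left (β t' s) (α (s + c)) (β t s)
    have := hc s
    linarith
  have hiff : ∀ t ∈ Ici (tj j), ((∃ c, ∀ s, dist (β (tj j) s) (α (s + c)) < ε) ↔
      ∃ c, ∀ s, dist (β t s) (α (s + c)) < ε) := by
    intro t ht
    refine hpre.induction₂ (fun x y => ((∃ c, ∀ s, dist (β x s) (α (s + c)) < ε) ↔
      ∃ c, ∀ s, dist (β y s) (α (s + c)) < ε)) ?_ ?_ ?_ self_mem_Ici ht
    · intro x hx
      have hx0 : 0 ≤ x := hT0.trans hx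
      have hδ : (0:ℝ) < 1 / ((k₂:ℝ) + 1) := by positivity
      have hev : ∀ᶠ y in 𝓝[Ici (tj j)] x, ∀ i, dist (b i x) (b i y) < 1 / ((k₂:ℝ) + 1) := by
        refine eventually_all.2 fun i => ?_
        have hc : Tendsto (b i) (𝓝[Ici (tj j)] x) (𝓝 (b i x)) :=
          (hb.cont i x hx0).mono_left (nhdsWithin_mono _ (Ici_subset_Ici.2 hT0))
        filter_upwards [hc.eventually (Metric.ball_mem_nhds _ hδ)] with y hy
        rw [dist_comm]
        exact hy
      filter_upwards [hev, self_mem_nhdsWithin] with y hy hym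
      exact ⟨step x hx y hym hy, step y hym x hx (fun i => by rw [dist_comm]; exact hy i)⟩
    · intro x y z _ _ _ h1 h2
      exact h1.trans h2
    · intro x y _ _ h
      exact h.symm
  refine ⟨tj j, fun t ht => ?_⟩
  obtain ⟨c, hc⟩ := (hiff t ht).1 ⟨0, fun s => by rw [add_zero]; exact hJ j hj2 s⟩
  exact ⟨c, fun s => (hc s).trans_le hεε'⟩
end

section
/- Let M be a compact Riemannian manifold of nonpositive sectional curvature, and let {b_i(t)}_{i∈ℤ/n} be cyclic pursuit curves on M with associated loops β^t. If the pursuit does not end in finite time, then there is a closed geodesic α such that sup_{s∈S^1} d(β^t(s), α(S^1)) → 0 as t → ∞. -/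
open Set Filter Metric Asymptotics Function
open scoped Topology Real

variable {M : Type*} [MetricSpace M]

lemma cont_ind {P : ℝ → Prop} {a b : ℝ} (hs : IsClosed ({t | P t} ∩ Icc a b)) (ha : P a)
    (h : ∀ t ∈ Ico a b, P t → ∀ᶠ k in 𝓝[>] (0:ℝ), P (t + k)) : ∀ t ∈ Icc a b, P t := by
  have := IsClosed.Icc_subset_of_forall_exists_gt hs ha ?_
  · exact this
  · rintro x ⟨hx, hxI⟩ y hy
    have h1 := h x hxI hx
    have h2 : ∀ᶠ k in 𝓝[>] (0:ℝ), k ∈ Ioc 0 (y - x) :=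
      Ioc_mem_nhdsGT (sub_pos.2 hy)
    obtain ⟨k, hk1, hk2⟩ := (h1.and h2).exists
    exact ⟨x + k, hk1, by linarith [hk2.1], by linarith [hk2.2]⟩

lemma dini {f : ℝ → ℝ} {a b c : ℝ} (hab : a ≤ b) (hf : ContinuousOn f (Icc a b))
    (h : ∀ t ∈ Ico a b, ∀ ε > 0, ∀ᶠ k in 𝓝[>] (0:ℝ), f (t + k) ≤ f t + (c + ε) * k) :
    f b ≤ f a + c * (b - a) := by
  have key : ∀ ε > 0, f b ≤ f a + (c + ε) * (b - a) := by
    intro ε hε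
    refine cont_ind (P := fun t => f t ≤ f a + (c + ε) * (t - a)) (a := a) (b := b) ?_ ?_ ?_ b
      ⟨hab, le_rfl⟩
    · have : ({t | f t ≤ f a + (c + ε) * (t - a)} ∩ Icc a b)
          = {t ∈ Icc a b | f t ≤ f a + (c + ε) * (t - a)} := by
        ext; simp [and_comm]
      rw [this]
      exact isClosed_Icc.isClosed_le hf (by fun_prop)
    · simp
    · intro t ht hP
      filter_upwards [h t ht ε hε] with k hk
      linarith
  by_contra hcon
  push Not at hcon
  have := key ((f b - (f a + c * (b - a))) / (2 * (b - a + 1))) (by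
    apply div_pos <;> linarith)
  have h2 : (f b - (f a + c * (b - a))) / (2 * (b - a + 1)) * (b - a)
      ≤ (f b - (f a + c * (b - a))) / 2 := by
    rw [div_mul_eq_mul_div, div_le_div_iff₀ (by linarith) (by norm_num)]
    nlinarith
  nlinarith

namespace GeodesicStructure

lemma lt_injAt (G : GeodesicStructure M) {p q : M} (h : dist p q < G.inj) :
    dist p q < G.injAt p := h.trans_le (G.inj_le_injAt p)

lemma geod_sub (G : GeodesicStructure M) {p q : M} (h : dist p q < G.inj) {x y u : ℝ}
    (hx : x ∈ Icc (0:ℝ) 1) (hy : y ∈ Icc (0:ℝ) 1) (hu : u ∈ Icc (0:ℝ) 1) :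
    G.geod (G.geod p q x) (G.geod p q y) u = G.geod p q (x + u * (y - x)) := by
  have hd := G.geod_dist p q (G.lt_injAt h)
  have hin : ∀ s ∈ Icc (0:ℝ) 1, x + s * (y - x) ∈ Icc (0:ℝ) 1 := by
    rintro s ⟨h0, h1⟩
    obtain ⟨hx0, hx1⟩ := hx
    obtain ⟨hy0, hy1⟩ := hy
    constructor <;> nlinarith
  have hxy : |x - y| ≤ 1 := by
    rw [abs_le]; constructor <;> linarith [hx.1, hx.2, hy.1, hy.2]
  symm
  refine G.geod_unique _ _ (G.lt_injAt ?_) (fun s => G.geod p q (x + s * (y - x))) (by simp)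
    (by simp) ?_ u hu
  · rw [hd x hx y hy]
    refine lt_of_le_of_lt ?_ h
    exact mul_le_of_le_one_left dist_nonneg hxy
  · intro s hs v hv
    rw [hd _ (hin s hs) _ (hin v hv), hd x hx y hy, ← mul_assoc]
    congr 1
    rw [← abs_mul, ← abs_neg ((s - v) * _)]
    congr 1; ring

lemma geod_conv' (G : GeodesicStructure M) (hnp : NonposCurvedOn G Set.univ)
    {p p' q q' : M} (h1 : dist p p' < G.inj) (h2 : dist q q' < G.inj)
    {m : ℝ} (hm1 : dist p q ≤ m) (hm2 : dist p' q' ≤ m)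
    (h : (dist p p' + dist q q') / 2 + m < G.inj) {s : ℝ}
    (hs : s ∈ Icc (0:ℝ) 1) :
    dist (G.geod p p' s) (G.geod q q' s) ≤ (1 - s) * dist p q + s * dist p' q' := by
  have hz1 := G.geod_zero p p' (G.lt_injAt h1)
  have hz2 := G.geod_zero q q' (G.lt_injAt h2)
  have ho1 := G.geod_one p p' (G.lt_injAt h1)
  have ho2 := G.geod_one q q' (G.lt_injAt h2)
  have hc := hnp p p' q q' (G.lt_injAt h1) (G.lt_injAt h2) (by simp) (by simp) ?_ (by simp)
  · have := hc.2 (show (0:ℝ) ∈ Icc (0:ℝ) 1 by simp) (show (1:ℝ) ∈ Icc (0:ℝ) 1 by simp)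
      (show (0:ℝ) ≤ 1 - s by linarith [hs.2]) hs.1 (by ring)
    simpa [hz1, hz2, ho1, ho2] using this
  · intro u hu
    refine lt_of_lt_of_le ?_ (G.inj_le_injAt _)
    have a1 := G.geod_dist p p' (G.lt_injAt h1) u hu 0 (by simp)
    have a2 := G.geod_dist q q' (G.lt_injAt h2) u hu 0 (by simp)
    have b1 := G.geod_dist p p' (G.lt_injAt h1) u hu 1 (by simp)
    have b2 := G.geod_dist q q' (G.lt_injAt h2) u hu 1 (by simp)
    rw [hz1, sub_zero, abs_of_nonneg hu.1] at a1
    rw [hz2, sub_zero, abs_of_nonneg hu.1] at a2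
    rw [ho1, abs_of_nonpos (by linarith [hu.2])] at b1
    rw [ho2, abs_of_nonpos (by linarith [hu.2])] at b2
    have t1 := dist_triangle4 (G.geod p p' u) p q (G.geod q q' u)
    have t2 := dist_triangle4 (G.geod p p' u) p' q' (G.geod q q' u)
    rw [dist_comm q] at t1
    rw [dist_comm q'] at t2
    have := dist_nonneg (x := p) (y := q)
    have := dist_nonneg (x := p') (y := q')
    have := dist_nonneg (x := p) (y := p')
    have := dist_nonneg (x := q) (y := q')
    rcases le_total u (1/2) with hu2 | hu2 <;> nlinarith

lemma geod_conv (G : GeodesicStructure M) (hnp : NonposCurvedOn G Set.univ)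
    {p p' q q' : M} (h1 : dist p p' < G.inj) (h2 : dist q q' < G.inj)
    (h : (dist p p' + dist q q') / 2 + dist p q + dist p' q' < G.inj) {s : ℝ}
    (hs : s ∈ Icc (0:ℝ) 1) :
    dist (G.geod p p' s) (G.geod q q' s) ≤ (1 - s) * dist p q + s * dist p' q' :=
  G.geod_conv' hnp h1 h2 (m := dist p q + dist p' q') (by simp) (by simp) (by linarith) hs

/-- joint continuity of geodesics -/
lemma geod_tendsto (G : GeodesicStructure M) (hnp : NonposCurvedOn G Set.univ)
    {ι : Type*} {F : Filter ι} {p q : ι → M} {u : ι → ℝ} {p0 q0 : M} {u0 : ℝ}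
    (hp : Tendsto p F (𝓝 p0)) (hq : Tendsto q F (𝓝 q0)) (hu : Tendsto u F (𝓝 u0))
    (hu0 : u0 ∈ Icc (0:ℝ) 1) (huI : ∀ᶠ t in F, u t ∈ Icc (0:ℝ) 1) (h : dist p0 q0 < G.inj) :
    Tendsto (fun t => G.geod (p t) (q t) (u t)) F (𝓝 (G.geod p0 q0 u0)) := by
  rw [tendsto_iff_dist_tendsto_zero]
  have hpq : Tendsto (fun t => dist (p t) (q t)) F (𝓝 (dist p0 q0)) := hp.dist hq
  have hp0 := tendsto_iff_dist_tendsto_zero.1 hp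
  have hq0 := tendsto_iff_dist_tendsto_zero.1 hq
  have hu1 : Tendsto (fun t => |u t - u0|) F (𝓝 0) := by
    have := (hu.sub_const u0).abs
    simpa using this
  have hlim : Tendsto (fun t => |u t - u0| * dist p0 q0 + (dist (p t) p0 + dist (q t) q0)) F
      (𝓝 (0 * dist p0 q0 + (0 + 0))) := (hu1.mul_const _).add (hp0.add hq0)
  have hcond : Tendsto (fun t => (dist (p t) (q t) + dist p0 q0) / 2 + dist (p t) p0
      + dist (q t) q0) F (𝓝 ((dist p0 q0 + dist p0 q0) / 2 + 0 + 0)) :=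
    ((((hpq.add_const _).div_const 2)).add hp0).add hq0
  have e1 := (tendsto_order.1 hcond).2 G.inj (by linarith)
  have e2 := (tendsto_order.1 hpq).2 G.inj h
  simp only [zero_mul, add_zero] at hlim
  refine squeeze_zero' (Eventually.of_forall fun _ => dist_nonneg) ?_ hlim
  filter_upwards [e1, e2, huI] with t h1 h2 h3
  have k1 := G.geod_conv hnp h2 h h1 h3
  have k2 := G.geod_dist p0 q0 (G.lt_injAt h) (u t) h3 u0 hu0
  have k3 := dist_triangle (G.geod (p t) (q t) (u t)) (G.geod p0 q0 (u t)) (G.geod p0 q0 u0)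
  have := dist_nonneg (x := p t) (y := p0)
  have := dist_nonneg (x := q t) (y := q0)
  nlinarith [h3.1, h3.2]

end GeodesicStructure

lemma zmod_next {n : ℕ} [NeZero n] {p : ZMod n → Prop} (h : ∃ i, p i) (i : ZMod n) :
    ∃ k : ℕ, k < n ∧ p (i + k) ∧ ∀ l < k, ¬ p (i + l) := by
  classical
  obtain ⟨j, hj⟩ := h
  have hj' : p (i + ((j - i).val : ℕ)) := by
    rw [ZMod.natCast_zmod_val]; simpa using hj
  have hex : ∃ k : ℕ, p (i + (k : ZMod n)) := ⟨_, hj'⟩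
  refine ⟨Nat.find hex, ?_, Nat.find_spec hex, fun l hl => Nat.find_min hex hl⟩
  exact lt_of_le_of_lt (Nat.find_min' hex hj') (ZMod.val_lt _)

namespace IsCyclicPursuit

variable {G : GeodesicStructure M} {n : ℕ} {b : ZMod n → ℝ → M}

lemma chase_ev (hb : IsCyclicPursuit G n b) {i : ZMod n} {t : ℝ} (ht : 0 ≤ t)
    (hne : b i t ≠ b (i + 1) t) (hlt : dist (b i t) (b (i + 1) t) < G.inj) {ε : ℝ} (hε : 0 < ε) :
    ∀ᶠ h in 𝓝[>] (0:ℝ), 0 < h ∧ h / dist (b i t) (b (i + 1) t) ∈ Icc (0:ℝ) 1 ∧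
      dist (b i (t + h)) (G.geod (b i t) (b (i + 1) t) (h / dist (b i t) (b (i + 1) t)))
        ≤ ε * h := by
  have hd : 0 < dist (b i t) (b (i + 1) t) := dist_pos.2 hne
  have h1 := (hb.chase i t ht hne (G.lt_injAt hlt)).def hε
  have h2 := nhdsWithin_mono (0:ℝ) Ioi_subset_Ici_self h1
  have h3 : ∀ᶠ k in 𝓝[>] (0:ℝ), k ∈ Ioc 0 (dist (b i t) (b (i + 1) t)) := Ioc_mem_nhdsGT hd
  filter_upwards [h2, h3] with h k1 k2
  refine ⟨k2.1, ⟨by have := k2.1; positivity, ?_⟩, ?_⟩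
  · rw [div_le_one hd]; exact k2.2
  · have : ‖dist (b i (t + h)) (G.geod (b i t) (b (i + 1) t)
      (h / dist (b i t) (b (i + 1) t)))‖ ≤ ε * ‖h‖ := k1
    rwa [Real.norm_of_nonneg dist_nonneg, Real.norm_of_nonneg k2.1.le] at this

lemma chain (hb : IsCyclicPursuit G n b) {i : ZMod n} {t : ℝ} (ht : 0 ≤ t) (k : ℕ)
    (h : ∀ l < k, b (i + (l : ℕ)) t = b (i + (l : ℕ) + 1) t) {s : ℝ} (hs : t ≤ s) :
    b i s = b (i + (k : ℕ)) s := by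
  induction k with
  | zero => simp
  | succ k ih =>
    rw [ih (fun l hl => h l (by omega))]
    have h1 := h k (by omega)
    push_cast
    rw [← add_assoc]
    rcases hs.eq_or_lt with rfl | hs
    · exact h1
    · exact hb.merge _ t ht h1 s hs

lemma all_eq [NeZero n] (hb : IsCyclicPursuit G n b) {t : ℝ} (ht : 0 ≤ t)
    (h : ∀ i, b i t = b (i + 1) t) (i : ZMod n) : b i t = b 0 t := by
  have := hb.chain (i := 0) ht i.val (fun l _ => h _) le_rfl
  rw [ZMod.natCast_zmod_val, zero_add] at this
  exact this.symm

lemma speed [NeZero n] (hb : IsCyclicPursuit G n b) {t : ℝ} (ht : 0 ≤ t)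
    (hlt : ∀ i, dist (b i t) (b (i + 1) t) < G.inj) (i : ZMod n) {ε : ℝ} (hε : 0 < ε) :
    ∀ᶠ h in 𝓝[>] (0:ℝ), dist (b i (t + h)) (b i t) ≤ (1 + ε) * h := by
  by_cases hall : ∃ j, b j t ≠ b (j + 1) t
  · obtain ⟨k, -, hk, hl⟩ := zmod_next hall i
    filter_upwards [hb.chase_ev ht hk (hlt _) hε] with h hh
    obtain ⟨h0, hI, hd⟩ := hh
    have hl' : ∀ l < k, b (i + (l : ℕ)) t = b (i + (l : ℕ) + 1) t := fun l hlk => by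
      simpa using hl l hlk
    rw [hb.chain ht k hl' (by linarith : t ≤ t + h), hb.chain ht k hl' le_rfl]
    set j := i + (k : ZMod n)
    have hpos : 0 < dist (b j t) (b (j + 1) t) := dist_pos.2 hk
    have h3 := G.geod_dist _ _ (G.lt_injAt (hlt j)) _ hI 0 (by simp)
    rw [G.geod_zero _ _ (G.lt_injAt (hlt j)), sub_zero, abs_of_nonneg hI.1,
      div_mul_cancel₀ _ hpos.ne'] at h3
    linarith [dist_triangle (b j (t + h))
      (G.geod (b j t) (b (j + 1) t) (h / dist (b j t) (b (j + 1) t))) (b j t)]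
  · push Not at hall
    have hz := hb.all_eq ht hall
    filter_upwards [self_mem_nhdsWithin] with h hh
    have hh : 0 < h := hh
    rw [hb.halt t ht hz (t + h) (by linarith) i, hz i, dist_self]
    positivity

lemma mono_step [NeZero n] (hb : IsCyclicPursuit G n b) {t : ℝ} (ht : 0 ≤ t)
    (hlt : ∀ i, dist (b i t) (b (i + 1) t) < G.inj) (i : ZMod n) {ε : ℝ} (hε : 0 < ε) :
    ∀ᶠ h in 𝓝[>] (0:ℝ), dist (b i (t + h)) (b (i + 1) (t + h))
      ≤ dist (b i t) (b (i + 1) t) + ε * h := by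
  by_cases hne : b i t = b (i + 1) t
  · filter_upwards [self_mem_nhdsWithin] with h hh
    have hh : 0 < h := hh
    rw [hb.merge i t ht hne (t + h) (by linarith), dist_self]
    positivity
  · filter_upwards [hb.chase_ev ht hne (hlt i) (half_pos hε),
      hb.speed ht hlt (i + 1) (half_pos hε)] with h hh h4
    obtain ⟨h0, hI, hd⟩ := hh
    have hpos : 0 < dist (b i t) (b (i + 1) t) := dist_pos.2 hne
    have h3 := G.geod_dist _ _ (G.lt_injAt (hlt i)) _ hI 1 (by simp)
    rw [G.geod_one _ _ (G.lt_injAt (hlt i)), abs_of_nonpos (by linarith [hI.2]), neg_sub, sub_mul,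
      div_mul_cancel₀ _ hpos.ne'] at h3
    rw [dist_comm] at h4
    linarith [dist_triangle4 (b i (t + h))
      (G.geod (b i t) (b (i + 1) t) (h / dist (b i t) (b (i + 1) t))) (b (i + 1) t)
      (b (i + 1) (t + h))]

lemma cont_dist (hb : IsCyclicPursuit G n b) (i j : ZMod n) :
    ContinuousOn (fun t => dist (b i t) (b j t)) (Ici 0) :=
  fun x hx => Filter.Tendsto.dist (hb.cont i x hx) (hb.cont j x hx)

lemma le_init_aux [NeZero n] (hb : IsCyclicPursuit G n b) {m T ε : ℝ} (hε : 0 < ε)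
    (hm : ∀ i, dist (b i 0) (b (i + 1) 0) ≤ m) (hT : m + ε * T < G.inj) :
    ∀ t ∈ Icc 0 T, ∀ i, dist (b i t) (b (i + 1) t) ≤ dist (b i 0) (b (i + 1) 0) + ε * t := by
  apply cont_ind
  · have : ({t | ∀ i, dist (b i t) (b (i + 1) t) ≤ dist (b i 0) (b (i + 1) 0) + ε * t} ∩ Icc 0 T)
        = ⋂ i, {t ∈ Icc 0 T | dist (b i t) (b (i + 1) t) ≤ dist (b i 0) (b (i + 1) 0) + ε * t} := by
      ext t
      simp only [mem_inter_iff, mem_ofPred_eq, mem_iInter]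
      exact ⟨fun h i => ⟨h.2, h.1 i⟩, fun h => ⟨fun i => (h i).2, (h 0).1⟩⟩
    rw [this]
    refine isClosed_iInter fun i => isClosed_Icc.isClosed_le ?_ (by fun_prop)
    exact (hb.cont_dist i (i + 1)).mono Icc_subset_Ici_self
  · simp
  · intro t ht hP
    have hlt : ∀ i, dist (b i t) (b (i + 1) t) < G.inj := fun i => by
      have := hP i
      have := hm i
      nlinarith [ht.2]
    have := eventually_all.2 fun i => hb.mono_step ht.1 hlt i hε
    filter_upwards [this] with h hh i
    linarith [hh i, hP i]

lemma le_init [NeZero n] (hb : IsCyclicPursuit G n b) {t : ℝ} (ht : 0 ≤ t) (i : ZMod n) :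
    dist (b i t) (b (i + 1) t) ≤ dist (b i 0) (b (i + 1) 0) := by
  obtain ⟨k, -, hk⟩ := Finset.exists_max_image (Finset.univ : Finset (ZMod n))
    (fun i => dist (b i 0) (b (i + 1) 0)) ⟨0, Finset.mem_univ _⟩
  set m := dist (b k 0) (b (k + 1) 0)
  have hm : m < G.inj := hb.init_sep k
  have key : ∀ᶠ ε in 𝓝[>] (0:ℝ), dist (b i t) (b (i + 1) t)
      ≤ dist (b i 0) (b (i + 1) 0) + ε * t := by
    have h1 : Tendsto (fun ε => m + ε * t) (𝓝[>] (0:ℝ)) (𝓝 (m + 0 * t)) := by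
      have : Continuous (fun ε => m + ε * t) := by fun_prop
      exact (this.tendsto 0).mono_left nhdsWithin_le_nhds
    filter_upwards [self_mem_nhdsWithin, (tendsto_order.1 h1).2 G.inj (by simpa using hm)]
      with ε hε h2
    exact hb.le_init_aux hε (fun i => hk i (Finset.mem_univ _)) h2 t ⟨ht, le_rfl⟩ i
  have h1 : Tendsto (fun ε => dist (b i 0) (b (i + 1) 0) + ε * t) (𝓝[>] (0:ℝ))
      (𝓝 (dist (b i 0) (b (i + 1) 0) + 0 * t)) := by
    have : Continuous (fun ε => dist (b i 0) (b (i + 1) 0) + ε * t) := by fun_prop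
    exact (this.tendsto 0).mono_left nhdsWithin_le_nhds
  simpa using ge_of_tendsto h1 key

lemma lt_inj [NeZero n] (hb : IsCyclicPursuit G n b) {t : ℝ} (ht : 0 ≤ t) (i : ZMod n) :
    dist (b i t) (b (i + 1) t) < G.inj := (hb.le_init ht i).trans_lt (hb.init_sep i)

lemma anti [NeZero n] (hb : IsCyclicPursuit G n b) {s t : ℝ} (hs : 0 ≤ s) (hst : s ≤ t)
    (i : ZMod n) : dist (b i t) (b (i + 1) t) ≤ dist (b i s) (b (i + 1) s) := by
  have := dini (c := 0) hst ((hb.cont_dist i (i + 1)).mono fun x hx => hs.trans hx.1) ?_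
  · simpa using this
  · intro u hu ε hε
    have hu0 : 0 ≤ u := hs.trans hu.1
    simpa using hb.mono_step hu0 (hb.lt_inj hu0) i hε

lemma lip [NeZero n] (hb : IsCyclicPursuit G n b) {s t : ℝ} (hs : 0 ≤ s) (hst : s ≤ t)
    (i : ZMod n) : dist (b i t) (b i s) ≤ t - s := by
  have := dini (c := 1) (f := fun t => dist (b i t) (b i s)) hst
    (fun x hx => Filter.Tendsto.dist ((hb.cont i x (hs.trans hx.1)).mono
      fun y hy => hs.trans hy.1) tendsto_const_nhds) ?_
  · simpa using this
  · intro u hu ε hε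
    have hu0 : 0 ≤ u := hs.trans hu.1
    filter_upwards [hb.speed hu0 (hb.lt_inj hu0) i hε] with h hh
    linarith [dist_triangle (b i (u + h)) (b i u) (b i s)]

end IsCyclicPursuit

lemma GeodesicStructure.geod_contOn (G : GeodesicStructure M) {p q : M}
    (h : dist p q < G.inj) : ContinuousOn (G.geod p q) (Icc 0 1) := by
  refine LipschitzOnWith.continuousOn (K := ⟨dist p q, dist_nonneg⟩) ?_
  refine LipschitzOnWith.of_dist_le_mul fun x hx y hy => ?_
  rw [G.geod_dist p q (G.lt_injAt h) x hx y hy, Real.dist_eq, mul_comm]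
  rfl

lemma IsCyclicPursuit.quad {G : GeodesicStructure M} {n : ℕ} {b : ZMod n → ℝ → M} [NeZero n]
    (hb : IsCyclicPursuit G n b) (hnp : NonposCurvedOn G Set.univ)
    {i : ZMod n} {D : ℝ} (hD : 0 < D) (hDle : ∀ t, 0 ≤ t → D ≤ dist (b i t) (b (i + 1) t))
    {t : ℝ} (ht : 0 ≤ t) {H : ℝ} (hH0 : 0 ≤ H) (hH : H ≤ D / 2)
    (hH2 : 4 * H < G.inj - dist (b i 0) (b (i + 1) 0)) :
    dist (b i (t + H)) (G.geod (b i t) (b (i + 1) t) (H / dist (b i t) (b (i + 1) t)))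
      ≤ 4 * H / D * H := by
  set p := b i t with hp
  set q := b (i + 1) t with hq
  set d := dist p q with hd
  have hdD : D ≤ d := hDle t ht
  have hdpos : 0 < d := by linarith
  have hdinj : d < G.inj := hb.lt_inj ht i
  have hd0 : d ≤ dist (b i 0) (b (i + 1) 0) := hb.le_init ht i
  have hz := G.geod_zero p q (G.lt_injAt hdinj)
  have ho := G.geod_one p q (G.lt_injAt hdinj)
  have main := dini (f := fun h => dist (b i (t + h)) (G.geod p q (h / d))) (a := 0) (b := H)
    (c := 4 * H / D) hH0 ?_ ?_
  · simp only [add_zero, zero_div, hz, ← hp, dist_self, zero_add, sub_zero] at main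
    exact main
  · intro x hx
    have hbx : ContinuousWithinAt (fun h => b i (t + h)) (Icc 0 H) x := by
      have : ContinuousOn (fun h => b i (t + h)) (Icc 0 H) :=
        (hb.cont i).comp (by fun_prop) (fun y hy => by simp only [mem_Ici]; linarith [hy.1])
      exact this x hx
    have hgx : ContinuousWithinAt (fun h => G.geod p q (h / d)) (Icc 0 H) x := by
      have : ContinuousOn (fun h => G.geod p q (h / d)) (Icc 0 H) :=
        (G.geod_contOn hdinj).comp (by fun_prop) (fun y hy =>
          ⟨div_nonneg hy.1 hdpos.le, (div_le_one hdpos).2 (by linarith [hy.2])⟩)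
      exact this x hx
    exact Filter.Tendsto.dist hbx hgx
  · intro h hh ε hε
    obtain ⟨hh0, hhH⟩ := hh
    have hth : 0 ≤ t + h := by linarith
    have hne : b i (t + h) ≠ b (i + 1) (t + h) := dist_pos.1 (by linarith [hDle _ hth])
    have hk2 : ∀ᶠ k in 𝓝[>] (0:ℝ), k ∈ Ioc 0 (d - h) := Ioc_mem_nhdsGT (by linarith)
    filter_upwards [hb.chase_ev hth hne (hb.lt_inj hth i) hε, hk2] with k hk hk2
    obtain ⟨hk0, hkI, hkd⟩ := hk
    have hdD' := hDle _ hth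
    have hd'inj := hb.lt_inj hth i
    have hd'0 := hb.le_init hth i
    have hpp := hb.lip ht (by linarith : t ≤ t + h) i
    have hqq := hb.lip ht (by linarith : t ≤ t + h) (i + 1)
    rw [add_assoc] at hkd
    set p' := b i (t + h) with hp'
    set q' := b (i + 1) (t + h) with hq'
    set d' := dist p' q' with hd'
    have hd'pos : 0 < d' := by linarith
    have hhI : h / d ∈ Icc (0:ℝ) 1 := ⟨div_nonneg hh0 hdpos.le, (div_le_one hdpos).2 (by linarith)⟩
    have hhkI : (h + k) / d ∈ Icc (0:ℝ) 1 :=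
      ⟨div_nonneg (by linarith) hdpos.le, (div_le_one hdpos).2 (by linarith [hk2.2])⟩
    set x := G.geod p q (h / d) with hx
    have hpx : dist x p = h := by
      have := G.geod_dist p q (G.lt_injAt hdinj) _ hhI 0 (by simp)
      rw [hz, sub_zero, abs_of_nonneg hhI.1, div_mul_cancel₀ _ hdpos.ne'] at this
      exact this
    have hqx : dist x q = d - h := by
      have := G.geod_dist p q (G.lt_injAt hdinj) _ hhI 1 (by simp)
      rw [ho, abs_of_nonpos (by linarith [hhI.2]), neg_sub, sub_mul,
        div_mul_cancel₀ _ hdpos.ne', one_mul] at this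
      exact this
    have hphi : dist p' x ≤ 2 * h := by
      linarith [dist_triangle p' p x, dist_comm p x]
    have hxq : dist x q < G.inj := by rw [hqx]; linarith
    have hcv := G.geod_conv hnp hd'inj hxq (by rw [hqx]; linarith) hkI
    have hsub : G.geod x q (k / d') = G.geod p q (h / d + k / d' * (1 - h / d)) := by
      have := G.geod_sub hdinj (x := h / d) (y := 1) hhI (by simp) hkI
      rwa [ho] at this
    have hin : h / d + k / d' * (1 - h / d) ∈ Icc (0:ℝ) 1 := by
      obtain ⟨a1, a2⟩ := hhI
      obtain ⟨b1, b2⟩ := hkI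
      constructor <;> nlinarith
    have hgd := G.geod_dist p q (G.lt_injAt hdinj) _ hin _ hhkI
    rw [← hsub] at hgd
    have hgd2 : dist (G.geod x q (k / d')) (G.geod p q ((h + k) / d)) = k / d' * |d - h - d'| := by
      rw [hgd]
      have e1 : (h / d + k / d' * (1 - h / d) - (h + k) / d) * d = k / d' * (d - h - d') := by
        field_simp; ring
      change _ * d = _
      rw [← abs_of_pos hdpos, ← abs_mul, abs_of_pos hdpos, e1, abs_mul,
        abs_of_nonneg hkI.1]
    have habs : |d - h - d'| ≤ 3 * h := by
      rw [← hqx, abs_le]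
      have := dist_triangle4 x p' q' q
      have := dist_triangle4 p' x q q'
      rw [dist_comm x p'] at *
      rw [dist_comm q q'] at *
      constructor <;> linarith
    have hkD : k / d' ≤ k / D := by gcongr
    have t1 := dist_triangle4 (b i (t + (h + k))) (G.geod p' q' (k / d')) (G.geod x q (k / d'))
      (G.geod p q ((h + k) / d))
    rw [hgd2] at t1
    have hmul : k / d' * |d - h - d'| ≤ k / D * (3 * H) :=
      mul_le_mul hkD (by linarith) (abs_nonneg _) (by positivity)
    have hmul2 : k / d' * dist q' q ≤ k / D * H :=
      mul_le_mul hkD (by linarith) dist_nonneg (by positivity)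
    have hmul3 : (1 - k / d') * dist p' x ≤ dist p' x := by
      nlinarith [hkI.1, dist_nonneg (x := p') (y := x)]
    have e2 : (4 * H / D + ε) * k = k / D * (3 * H) + k / D * H + ε * k := by ring
    change dist (b i (t + (h + k))) (G.geod p q ((h + k) / d)) ≤ dist p' x + _
    rw [e2]
    linarith

lemma sum_range_zmod {n : ℕ} [NeZero n] (g : ZMod n → ℝ) :
    ∑ l ∈ Finset.range n, g (l : ZMod n) = ∑ j, g j := by
  refine Finset.sum_bij (fun l _ => (l : ZMod n)) (by simp) ?_ ?_ (by simp)
  · intro a ha c hc h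
    rw [Finset.mem_range] at ha hc
    have := congrArg ZMod.val h
    rwa [ZMod.val_natCast_of_lt ha, ZMod.val_natCast_of_lt hc] at this
  · intro j _
    exact ⟨j.val, Finset.mem_range.2 (ZMod.val_lt j), ZMod.natCast_zmod_val j⟩

lemma dist_le_sum {n : ℕ} [NeZero n] (c : ZMod n → M) (i j : ZMod n) :
    dist (c i) (c j) ≤ ∑ l, dist (c l) (c (l + 1)) := by
  have h1 := dist_le_range_sum_dist (fun l : ℕ => c (i + l)) (j - i).val
  simp only [Nat.cast_zero, add_zero, ZMod.natCast_zmod_val, add_sub_cancel] at h1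
  refine h1.trans ?_
  have h2 : ∑ l ∈ Finset.range (j - i).val, dist (c (i + (l : ZMod n))) (c (i + ((l + 1 : ℕ) : ZMod n)))
      ≤ ∑ l ∈ Finset.range n, dist (c (i + (l : ZMod n))) (c (i + ((l + 1 : ℕ) : ZMod n))) := by
    apply Finset.sum_le_sum_of_subset_of_nonneg
    · exact Finset.range_subset_range.2 (ZMod.val_lt _).le
    · intros; exact dist_nonneg
  refine h2.trans (le_of_eq ?_)
  rw [← Equiv.sum_comp (Equiv.addLeft i), ← sum_range_zmod]
  refine Finset.sum_congr rfl fun l _ => ?_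
  simp [add_assoc]

lemma GeodesicStructure.geod_self (G : GeodesicStructure M) (hinj : 0 < G.inj) (p : M) {s : ℝ}
    (hs : s ∈ Icc (0:ℝ) 1) : G.geod p p s = p := by
  have h : dist p p < G.injAt p := G.lt_injAt (by simpa using hinj)
  have := G.geod_dist p p h s hs 0 (by simp)
  rw [G.geod_zero p p h, dist_self p, mul_zero] at this
  exact dist_eq_zero.1 this

lemma GeodesicStructure.conv_pt (G : GeodesicStructure M) (hinj : 0 < G.inj)
    (hnp : NonposCurvedOn G Set.univ)
    {p p' z : M} (h1 : dist p p' < G.inj)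
    (h : dist p p' / 2 + dist p z + dist p' z < G.inj) {s : ℝ}
    (hs : s ∈ Icc (0:ℝ) 1) :
    dist (G.geod p p' s) z ≤ (1 - s) * dist p z + s * dist p' z := by
  have := G.geod_conv hnp h1 (q := z) (q' := z) (by simpa using hinj) (by simpa using h) hs
  rwa [G.geod_self hinj z hs] at this

namespace IsCyclicPursuit

variable {G : GeodesicStructure M} {n : ℕ} {b : ZMod n → ℝ → M}

set_option maxHeartbeats 1000000 in
lemma pair_step [NeZero n] (hb : IsCyclicPursuit G n b) (hinj : 0 < G.inj)
    (hnp : NonposCurvedOn G Set.univ) {t : ℝ} (ht : 0 ≤ t)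
    (hS : ∑ l, dist (b l t) (b (l + 1) t) < G.inj / 4) (i j : ZMod n) {ε : ℝ} (hε : 0 < ε) :
    ∀ᶠ h in 𝓝[>] (0:ℝ),
      dist (b i t) (b (i + 1) t) * dist (b j t) (b (j + 1) t) * dist (b i (t + h)) (b j (t + h))
      ≤ dist (b i t) (b (i + 1) t) * dist (b j t) (b (j + 1) t) * dist (b i t) (b j t)
        + h * (dist (b j t) (b (j + 1) t) * (dist (b (i + 1) t) (b j t) - dist (b i t) (b j t))
          + dist (b i t) (b (i + 1) t) * (dist (b i t) (b (j + 1) t) - dist (b i t) (b j t))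
          - if i = j then 2 * dist (b j t) (b (j + 1) t) ^ 2 else 0) + ε * h := by
  set S := ∑ l, dist (b l t) (b (l + 1) t) with hSdef
  have hr : ∀ k l, dist (b k t) (b l t) ≤ S := fun k l => dist_le_sum (fun l => b l t) k l
  have hS0 : 0 ≤ S := Finset.sum_nonneg fun _ _ => dist_nonneg
  by_cases hij : i = j
  · subst hij
    filter_upwards [self_mem_nhdsWithin] with h hh
    have hh : 0 < h := hh
    simp only [dist_self, mul_zero, if_true, dist_comm (b (i + 1) t)]
    nlinarith [mul_pos hε hh]
  rw [if_neg hij]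
  by_cases hi : b i t = b (i + 1) t
  · filter_upwards [self_mem_nhdsWithin] with h hh
    have hh : 0 < h := hh
    simp only [← hi, dist_self, sub_self]
    nlinarith [mul_pos hε hh]
  by_cases hj : b j t = b (j + 1) t
  · filter_upwards [self_mem_nhdsWithin] with h hh
    have hh : 0 < h := hh
    simp only [← hj, dist_self, sub_self]
    nlinarith [mul_pos hε hh]
  have hdi : 0 < dist (b i t) (b (i + 1) t) := dist_pos.2 hi
  have hdj : 0 < dist (b j t) (b (j + 1) t) := dist_pos.2 hj
  have hli := hb.lt_inj ht i
  have hlj := hb.lt_inj ht j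
  have hri := hr i (i + 1)
  have hrj := hr j (j + 1)
  have hA := hr i j
  have hB := hr (i + 1) j
  have hC := hr i (j + 1)
  have hE := hr (i + 1) (j + 1)
  set p := b i t
  set p' := b (i + 1) t
  set q := b j t
  set q' := b (j + 1) t
  set d := dist p p' with hd
  set e := dist q q' with he
  have hε1 : 0 < ε / (4 * (d * e)) := by positivity
  have hsm : ∀ᶠ h in 𝓝[>] (0:ℝ), h ∈ Ioc 0 (ε / (4 * (S + 1))) :=
    Ioc_mem_nhdsGT (by positivity)
  filter_upwards [hb.chase_ev ht hi hli hε1, hb.chase_ev ht hj hlj hε1, hsm] with h h1 h2 h3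
  obtain ⟨h0, hI, ha⟩ := h1
  obtain ⟨-, hJ, hc⟩ := h2
  change h / d ∈ _ at hI
  change h / e ∈ _ at hJ
  change dist _ (G.geod p p' (h / d)) ≤ _ at ha
  change dist _ (G.geod q q' (h / e)) ≤ _ at hc
  have k1 := G.conv_pt hinj hnp (p := p) (p' := p') (z := q) hli (by linarith) hI
  have k2 := G.conv_pt hinj hnp (p := p) (p' := p') (z := q') hli (by linarith) hI
  set x := G.geod p p' (h / d)
  set y := G.geod q q' (h / e)
  have hxq : dist x q ≤ S := by nlinarith [hI.1, hI.2]
  have hxq' : dist x q' ≤ S := by nlinarith [hI.1, hI.2]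
  have k3 := G.conv_pt hinj hnp (p := q) (p' := q') (z := x) hlj
    (by rw [dist_comm q x, dist_comm q' x]; linarith) hJ
  rw [dist_comm q x, dist_comm q' x, dist_comm _ x] at k3
  have k4 : dist x y ≤ (1 - h / e) * ((1 - h / d) * dist p q + h / d * dist p' q)
      + h / e * ((1 - h / d) * dist p q' + h / d * dist p' q') := by
    refine k3.trans ?_
    have := hJ.1
    have : 0 ≤ 1 - h / e := by linarith [hJ.2]
    gcongr
  have k5 := dist_triangle4 (b i (t + h)) x y (b j (t + h))
  rw [dist_comm y] at k5
  have k6 : d * e * dist (b i (t + h)) (b j (t + h)) ≤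
      d * e * ((1 - h / e) * ((1 - h / d) * dist p q + h / d * dist p' q)
      + h / e * ((1 - h / d) * dist p q' + h / d * dist p' q') + 2 * (ε / (4 * (d * e)) * h)) := by
    gcongr
    linarith
  refine k6.trans ?_
  have k7 : d * e * ((1 - h / e) * ((1 - h / d) * dist p q + h / d * dist p' q)
      + h / e * ((1 - h / d) * dist p q' + h / d * dist p' q') + 2 * (ε / (4 * (d * e)) * h))
      = d * e * dist p q + h * (e * (dist p' q - dist p q) + d * (dist p q' - dist p q))
        + h * h * (dist p q - dist p' q - dist p q' + dist p' q') + ε / 2 * h := by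
    field_simp; ring
  rw [k7]
  have k8 : h * (4 * (S + 1)) ≤ ε := by
    have := h3.2
    rwa [le_div_iff₀ (by positivity)] at this
  have k9 : dist p q - dist p' q - dist p q' + dist p' q' ≤ 2 * S := by
    linarith [dist_nonneg (x := p') (y := q), dist_nonneg (x := p) (y := q')]
  have k10 : h * h * (dist p q - dist p' q - dist p q' + dist p' q') ≤ ε / 2 * h := by
    have m1 := mul_le_mul_of_nonneg_left k9 h0.le
    have m2 : h * (4 * (S + 1)) = 2 * (h * (2 * S)) + 4 * h := by ring
    have m3 : h * (dist p q - dist p' q - dist p q' + dist p' q') ≤ ε / 2 := by linarith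
    have m4 := mul_le_mul_of_nonneg_right m3 h0.le
    calc _ = h * (dist p q - dist p' q - dist p q' + dist p' q') * h := by ring
      _ ≤ _ := m4
  linarith

lemma V_step [NeZero n] (hb : IsCyclicPursuit G n b) (hinj : 0 < G.inj)
    (hnp : NonposCurvedOn G Set.univ) {t : ℝ} (ht : 0 ≤ t)
    (hS : ∑ l, dist (b l t) (b (l + 1) t) < G.inj / 4) {ε : ℝ} (hε : 0 < ε) :
    ∀ᶠ h in 𝓝[>] (0:ℝ),
      ∑ i, ∑ j, dist (b i (t + h)) (b (i + 1) (t + h)) * dist (b j (t + h)) (b (j + 1) (t + h))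
        * dist (b i (t + h)) (b j (t + h))
      ≤ (∑ i, ∑ j, dist (b i t) (b (i + 1) t) * dist (b j t) (b (j + 1) t) * dist (b i t) (b j t))
        + (- 2 * ∑ j, dist (b j t) (b (j + 1) t) ^ 2 + ε) * h := by
  have hn : (0:ℝ) < n := Nat.cast_pos.2 (NeZero.pos n)
  have hε1 : 0 < ε / (n * n) := by positivity
  have hev := eventually_all.2 fun i => eventually_all.2 fun j =>
    hb.pair_step hinj hnp ht hS i j hε1
  filter_upwards [hev, self_mem_nhdsWithin] with h hh h0
  have h0 : 0 < h := h0
  have hanti := fun i => hb.anti ht (by linarith : t ≤ t + h) i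
  have step1 : ∑ i, ∑ j, dist (b i (t + h)) (b (i + 1) (t + h))
        * dist (b j (t + h)) (b (j + 1) (t + h)) * dist (b i (t + h)) (b j (t + h))
      ≤ ∑ i, ∑ j, dist (b i t) (b (i + 1) t) * dist (b j t) (b (j + 1) t)
        * dist (b i (t + h)) (b j (t + h)) := by
    refine Finset.sum_le_sum fun i _ => Finset.sum_le_sum fun j _ => ?_
    have := hanti i
    have := hanti j
    gcongr
  refine step1.trans ?_
  refine (Finset.sum_le_sum fun i _ => Finset.sum_le_sum fun j _ => hh i j).trans (le_of_eq ?_)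
  simp only [Finset.sum_add_distrib, Finset.sum_sub_distrib, ← Finset.mul_sum,
    Finset.sum_const, Finset.card_univ, ZMod.card, nsmul_eq_mul, Finset.sum_ite_eq,
    Finset.mem_univ, if_true]
  have z1 : ∀ i, ∑ j, dist (b i t) (b (j + 1) t) = ∑ j, dist (b i t) (b j t) := fun i =>
    Equiv.sum_comp (Equiv.addRight (1 : ZMod n)) (fun j => dist (b i t) (b j t))
  have z2 : ∑ i, ∑ j, dist (b j t) (b (j + 1) t) * (dist (b (i + 1) t) (b j t)
      - dist (b i t) (b j t)) = 0 := by
    rw [Finset.sum_comm]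
    refine Finset.sum_eq_zero fun j _ => ?_
    rw [← Finset.mul_sum, Finset.sum_sub_distrib]
    have := Equiv.sum_comp (Equiv.addRight (1 : ZMod n)) (fun i => dist (b i t) (b j t))
    simp only [Equiv.coe_addRight] at this
    rw [this, sub_self, mul_zero]
  simp only [z1, sub_self, mul_zero, Finset.sum_const_zero]
  rw [z2]
  field_simp
  ring

/-- The perimeter. -/
noncomputable def per [NeZero n] (b : ZMod n → ℝ → M) (t : ℝ) : ℝ :=
  ∑ l, dist (b l t) (b (l + 1) t)

lemma per_anti [NeZero n] (hb : IsCyclicPursuit G n b) {s t : ℝ} (hs : 0 ≤ s) (hst : s ≤ t) :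
    per b t ≤ per b s := Finset.sum_le_sum fun i _ => hb.anti hs hst i

lemma halving [NeZero n] (hb : IsCyclicPursuit G n b) (hinj : 0 < G.inj)
    (hnp : NonposCurvedOn G Set.univ) {t s : ℝ} (ht : 0 ≤ t) (hs : 0 < s)
    (hS : per b t < G.inj / 4) (hSs : per b t ≤ s) : per b (t + 4 * n * s) ≤ s / 2 := by
  have hn : (0:ℝ) < n := Nat.cast_pos.2 (NeZero.pos n)
  by_contra hcon
  push Not at hcon
  have hle : t ≤ t + 4 * n * s := by have : 0 < 4 * n * s := by positivity
                                     linarith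
  set V : ℝ → ℝ := fun t => ∑ i, ∑ j, dist (b i t) (b (i + 1) t) * dist (b j t) (b (j + 1) t)
    * dist (b i t) (b j t) with hV
  have hV0 : 0 ≤ V (t + 4 * n * s) := Finset.sum_nonneg fun i _ => Finset.sum_nonneg fun j _ =>
    mul_nonneg (mul_nonneg dist_nonneg dist_nonneg) dist_nonneg
  have hV1 : V t ≤ s ^ 3 := by
    have : V t ≤ per b t * per b t * per b t := by
      rw [hV]
      unfold per
      rw [Finset.sum_mul_sum, Finset.sum_mul]
      refine Finset.sum_le_sum fun i _ => ?_
      rw [Finset.sum_mul]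
      refine Finset.sum_le_sum fun j _ => ?_
      have := dist_le_sum (fun l => b l t) i j
      gcongr
    have h0 : 0 ≤ per b t := Finset.sum_nonneg fun _ _ => dist_nonneg
    calc V t ≤ per b t ^ 3 := by linarith [this, (by ring : per b t * per b t * per b t = per b t ^ 3)]
      _ ≤ s ^ 3 := by gcongr
  have := dini (f := V) (c := - (s ^ 2 / (2 * n))) hle ?_ ?_
  · have e : -(s ^ 2 / (2 * n)) * (t + 4 * n * s - t) = - 2 * s ^ 3 := by field_simp; ring
    rw [e] at this
    have : 0 < s ^ 3 := by positivity
    linarith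
  · have hc : ContinuousOn V (Ici 0) := by
      refine continuousOn_finsetSum _ fun i _ => continuousOn_finsetSum _ fun j _ => ?_
      exact ((hb.cont_dist i (i + 1)).mul (hb.cont_dist j (j + 1))).mul (hb.cont_dist i j)
    exact hc.mono fun x hx => ht.trans hx.1
  · intro u hu ε hε
    have hu0 : 0 ≤ u := ht.trans hu.1
    have hSu : per b u < G.inj / 4 := (hb.per_anti ht hu.1).trans_lt hS
    have hSl : s / 2 < per b u := hcon.trans_le (hb.per_anti hu0 hu.2.le)
    have hsq : s ^ 2 / (2 * n) ≤ 2 * ∑ j, dist (b j u) (b (j + 1) u) ^ 2 := by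
      have h1 := sq_sum_le_card_mul_sum_sq (s := (Finset.univ : Finset (ZMod n)))
        (f := fun j => dist (b j u) (b (j + 1) u))
      rw [Finset.card_univ, ZMod.card] at h1
      have h2 : (s / 2) ^ 2 ≤ per b u ^ 2 := by gcongr
      have h3 : (s / 2) ^ 2 ≤ n * ∑ j, dist (b j u) (b (j + 1) u) ^ 2 := h2.trans h1
      rw [div_le_iff₀ (by positivity)]
      nlinarith
    filter_upwards [hb.V_step hinj hnp hu0 hSu hε, self_mem_nhdsWithin] with h h1 h0
    have h0 : 0 < h := h0
    refine h1.trans ?_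
    have : (- 2 * ∑ j, dist (b j u) (b (j + 1) u) ^ 2 + ε) * h ≤ (- (s ^ 2 / (2 * n)) + ε) * h := by
      apply mul_le_mul_of_nonneg_right _ h0.le
      linarith
    simpa [hV] using this

lemma collapse [NeZero n] (hb : IsCyclicPursuit G n b) (hinj : 0 < G.inj)
    (hnp : NonposCurvedOn G Set.univ) {t : ℝ} (ht : 0 ≤ t) (hS : per b t < G.inj / 4) :
    ∃ u, 0 ≤ u ∧ ∀ i, b i u = b 0 u := by
  have hn : (0:ℝ) < n := Nat.cast_pos.2 (NeZero.pos n)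
  set s := G.inj / 4 with hs
  have hs0 : 0 < s := by positivity
  have hk : ∀ k : ℕ, per b (t + 8 * n * s * (1 - (1 / 2) ^ k)) ≤ s * (1 / 2) ^ k := by
    intro k
    induction k with
    | zero => simpa using hS.le
    | succ k ih =>
      have hp : (1 / 2 : ℝ) ^ k ≤ 1 := pow_le_one₀ (by norm_num) (by norm_num)
      have hpp : (0:ℝ) < (1 / 2 : ℝ) ^ k := by positivity
      have h1 : 0 ≤ 8 * n * s * (1 - (1 / 2) ^ k) := by
        have : (0:ℝ) ≤ 1 - (1 / 2) ^ k := by linarith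
        positivity
      have := hb.halving hinj hnp (t := t + 8 * n * s * (1 - (1 / 2) ^ k)) (s := s * (1 / 2) ^ k)
        (by linarith) (by positivity) ((hb.per_anti ht (by linarith)).trans_lt hS) ih
      convert this using 1
      · congr 1; ring
      · ring
  have hfin : per b (t + 8 * n * s) ≤ 0 := by
    have hlim : Tendsto (fun k : ℕ => s * (1 / 2 : ℝ) ^ k) atTop (𝓝 (s * 0)) :=
      (tendsto_pow_atTop_nhds_zero_of_lt_one (by norm_num) (by norm_num)).const_mul s
    rw [mul_zero] at hlim
    refine ge_of_tendsto' hlim fun k => le_trans ?_ (hk k)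
    have hp : (1 / 2 : ℝ) ^ k ≤ 1 := pow_le_one₀ (by norm_num) (by norm_num)
    have hpp : (0:ℝ) < (1 / 2 : ℝ) ^ k := by positivity
    have h1 : 0 ≤ 8 * n * s * (1 - (1 / 2) ^ k) := by
      have : (0:ℝ) ≤ 1 - (1 / 2) ^ k := by linarith
      positivity
    have h2 : 0 < 8 * n * s := by positivity
    exact hb.per_anti (by linarith) (by nlinarith)
  have hu : 0 ≤ t + 8 * n * s := by positivity
  refine ⟨t + 8 * n * s, hu, hb.all_eq hu fun i => ?_⟩
  have h1 : dist (b i (t + 8 * n * s)) (b (i + 1) (t + 8 * n * s)) ≤ per b (t + 8 * n * s) :=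
    Finset.single_le_sum (f := fun l => dist (b l (t + 8 * n * s)) (b (l + 1) (t + 8 * n * s)))
      (fun _ _ => dist_nonneg) (Finset.mem_univ i)
  exact dist_le_zero.1 (h1.trans hfin)

end IsCyclicPursuit

lemma local_lip {α : ℝ → M} {L e : ℝ} (he : 0 < e)
    (hα : ∀ s u : ℝ, |s - u| ≤ e → dist (α s) (α u) = L * |s - u|) :
    Continuous α ∧ ∀ s u : ℝ, dist (α s) (α u) ≤ L * |s - u| := by
  have hc : Continuous α := by
    rw [continuous_iff_continuousAt]
    intro x
    rw [ContinuousAt, tendsto_iff_dist_tendsto_zero]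
    have h1 : Tendsto (fun y => L * |y - x|) (𝓝 x) (𝓝 0) := by
      have : Continuous (fun y => L * |y - x|) := by fun_prop
      simpa using this.tendsto x
    refine h1.congr' ?_
    filter_upwards [Metric.closedBall_mem_nhds x he] with y hy
    exact (hα y x (by simpa [Real.dist_eq] using hy)).symm
  refine ⟨hc, ?_⟩
  have key : ∀ s u : ℝ, s ≤ u → dist (α u) (α s) ≤ L * (u - s) := by
    intro s u hsu
    have := dini (f := fun v => dist (α v) (α s)) (c := L) hsu
      (by fun_prop) ?_
    · simpa using this
    · intro v hv ε hε
      have : ∀ᶠ k in 𝓝[>] (0:ℝ), k ∈ Ioc 0 e := Ioc_mem_nhdsGT he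
      filter_upwards [this] with k hk
      have h1 := hα (v + k) v (by rw [add_sub_cancel_left, abs_of_pos hk.1]; exact hk.2)
      rw [add_sub_cancel_left, abs_of_pos hk.1] at h1
      have := dist_triangle (α (v + k)) (α v) (α s)
      nlinarith [hk.1]
  intro s u
  rcases le_total s u with h | h
  · have := key s u h
    rw [dist_comm, abs_sub_comm, abs_of_nonneg (by linarith)]; exact this
  · have := key u s h
    rw [abs_of_nonneg (by linarith)]; exact this

/-- A local geodesic of length less than `inj` is the shortest geodesic. -/
lemma GeodesicStructure.local_geod (G : GeodesicStructure M) (hnp : NonposCurvedOn G Set.univ)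
    {α : ℝ → M} {L e : ℝ} (hL : 0 < L) (he : 0 < e)
    (hα : ∀ s u : ℝ, |s - u| ≤ e → dist (α s) (α u) = L * |s - u|) {x y : ℝ}
    (h : L * |y - x| < G.inj) :
    ∀ u ∈ Icc (0:ℝ) 1, G.geod (α x) (α y) u = α (x + u * (y - x)) := by
  obtain ⟨hc, hlip⟩ := local_lip he hα
  set ℓ := L * |y - x| with hℓ
  have hℓ0 : 0 ≤ ℓ := by positivity
  have hxyd : dist (α x) (α y) ≤ ℓ := by rw [hℓ, abs_sub_comm]; exact hlip x y
  have hxy : dist (α x) (α y) < G.inj := hxyd.trans_lt h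
  have hz := G.geod_zero _ _ (G.lt_injAt hxy)
  have ho := G.geod_one _ _ (G.lt_injAt hxy)
  have hσd := G.geod_dist _ _ (G.lt_injAt hxy)
  set σ := G.geod (α x) (α y) with hσ
  set γ : ℝ → M := fun u => α (x + u * (y - x)) with hγ
  have hγlip : ∀ u v, dist (γ u) (γ v) ≤ |u - v| * ℓ := by
    intro u v
    refine (hlip _ _).trans (le_of_eq ?_)
    rw [hℓ, show x + u * (y - x) - (x + v * (y - x)) = (u - v) * (y - x) by ring, abs_mul]; ring
  have hγ0 : γ 0 = α x := by simp [hγ]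
  have hγ1 : γ 1 = α y := by simp [hγ]
  set f : ℝ → ℝ := fun u => dist (γ u) (σ u) with hf
  have hfc : ContinuousOn f (Icc 0 1) := fun u hu =>
    Filter.Tendsto.dist (by
      have : Continuous γ := by fun_prop
      exact this.continuousWithinAt) (G.geod_contOn hxy u hu)
  have hfle : ∀ u ∈ Icc (0:ℝ) 1, f u ≤ ℓ := by
    intro u hu
    have a1 := hσd 0 (by simp) u hu
    have a2 := hσd 1 (by simp) u hu
    have a3 := hγlip u 0
    have a4 := hγlip u 1
    rw [hz] at a1
    rw [ho] at a2
    rw [hγ0] at a3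
    rw [hγ1] at a4
    have b1 := dist_triangle (γ u) (α x) (σ u)
    have b2 := dist_triangle (γ u) (α y) (σ u)
    rw [zero_sub, abs_neg, abs_of_nonneg hu.1] at a1
    rw [abs_of_nonneg (by linarith [hu.2])] at a2
    rw [sub_zero, abs_of_nonneg hu.1] at a3
    rw [abs_of_nonpos (by linarith [hu.2])] at a4
    obtain ⟨u0, u1⟩ := hu
    have c1 : u * dist (α x) (α y) ≤ u * ℓ := by gcongr
    have c2 : (1 - u) * dist (α x) (α y) ≤ (1 - u) * ℓ :=
      mul_le_mul_of_nonneg_left hxyd (by linarith)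
    change dist (γ u) (σ u) ≤ ℓ
    linarith
  have hzero : ∀ u ∈ Icc (0:ℝ) 1, f u ≤ 0 := by
    by_contra hcon
    push Not at hcon
    obtain ⟨u1, hu1, hfu1⟩ := hcon
    obtain ⟨um, hum, hmax⟩ := isCompact_Icc.exists_isMaxOn (⟨u1, hu1⟩ : (Icc (0:ℝ) 1).Nonempty) hfc
    set m := f um with hm
    have hmpos : 0 < m := hfu1.trans_le (hmax hu1)
    have hZc : IsClosed (Icc (0:ℝ) 1 ∩ f ⁻¹' {m}) :=
      hfc.preimage_isClosed_of_isClosed isClosed_Icc isClosed_singleton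
    have hZ : IsCompact (Icc (0:ℝ) 1 ∩ f ⁻¹' {m}) :=
      isCompact_Icc.of_isClosed_subset hZc inter_subset_left
    obtain ⟨u0, ⟨hu0, hfu0⟩, hleast⟩ := hZ.exists_isLeast ⟨um, hum, rfl⟩
    have hfu0 : f u0 = m := hfu0
    have hf0 : f 0 = 0 := by simp [hf, hγ0, hz]
    have hf1 : f 1 = 0 := by simp [hf, hγ1, ho]
    have hpos_u : 0 < u0 := by
      rcases hu0.1.eq_or_lt with h0 | h0
      · rw [← h0, hf0] at hfu0; linarith
      · exact h0
    have hlt_u : u0 < 1 := by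
      rcases hu0.2.eq_or_lt with h0 | h0
      · rw [h0, hf1] at hfu0; linarith
      · exact h0
    have hr : ∀ᶠ r in 𝓝[>] (0:ℝ), 0 < r ∧ r ≤ u0 ∧ r ≤ 1 - u0 ∧ 2 * r * |y - x| ≤ e ∧
        2 * r * ℓ + ℓ < G.inj := by
      have e1 : ∀ᶠ r in 𝓝[>] (0:ℝ), r ∈ Ioc 0 u0 := Ioc_mem_nhdsGT hpos_u
      have e2 : ∀ᶠ r in 𝓝[>] (0:ℝ), r ∈ Ioc 0 (1 - u0) := Ioc_mem_nhdsGT (by linarith)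
      have e3 : Tendsto (fun r : ℝ => 2 * r * |y - x|) (𝓝[>] 0) (𝓝 (2 * 0 * |y - x|)) := by
        have : Continuous (fun r : ℝ => 2 * r * |y - x|) := by fun_prop
        exact (this.tendsto 0).mono_left nhdsWithin_le_nhds
      have e4 : Tendsto (fun r : ℝ => 2 * r * ℓ + ℓ) (𝓝[>] 0) (𝓝 (2 * 0 * ℓ + ℓ)) := by
        have : Continuous (fun r : ℝ => 2 * r * ℓ + ℓ) := by fun_prop
        exact (this.tendsto 0).mono_left nhdsWithin_le_nhds
      filter_upwards [e1, e2, (tendsto_order.1 e3).2 e (by simpa using he),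
        (tendsto_order.1 e4).2 G.inj (by simpa using h)] with r h1 h2 h3 h4
      exact ⟨h1.1, h1.2, h2.2, h3.le, h4⟩
    obtain ⟨r, hr0, hr1, hr2, hr3, hr4⟩ := hr.exists
    have hA : u0 - r ∈ Icc (0:ℝ) 1 := ⟨by linarith, by linarith⟩
    have hB : u0 + r ∈ Icc (0:ℝ) 1 := ⟨by linarith, by linarith⟩
    have hhalf : (1/2:ℝ) ∈ Icc (0:ℝ) 1 := by norm_num
    have hγd : ∀ s ∈ Icc (0:ℝ) 1, ∀ v ∈ Icc (0:ℝ) 1,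
        dist (γ (u0 - r + s * (2 * r))) (γ (u0 - r + v * (2 * r))) = |s - v| * (2 * r * ℓ) := by
      intro s hs v hv
      have e1 : x + (u0 - r + s * (2 * r)) * (y - x) - (x + (u0 - r + v * (2 * r)) * (y - x))
        = (s - v) * (2 * r) * (y - x) := by ring
      have hsv : |s - v| ≤ 1 := by rw [abs_le]; constructor <;> linarith [hs.1, hs.2, hv.1, hv.2]
      have := hα (x + (u0 - r + s * (2 * r)) * (y - x)) (x + (u0 - r + v * (2 * r)) * (y - x)) ?_
      · rw [e1, abs_mul, abs_mul, abs_of_pos (by linarith : 0 < 2 * r)] at this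
        rw [hγ]; rw [this, hℓ]; ring
      · rw [e1, abs_mul, abs_mul, abs_of_pos (by linarith : 0 < 2 * r), mul_assoc]
        exact (mul_le_of_le_one_left (by positivity) hsv).trans hr3
    have hAB : dist (γ (u0 - r)) (γ (u0 + r)) = 2 * r * ℓ := by
      have := hγd 0 (by simp) 1 (by simp)
      rw [show u0 - r + 0 * (2 * r) = u0 - r by ring, show u0 - r + 1 * (2 * r) = u0 + r by ring]
        at this
      simpa using this
    have hABi : dist (γ (u0 - r)) (γ (u0 + r)) < G.inj := by rw [hAB]; linarith
    have g1 : γ u0 = G.geod (γ (u0 - r)) (γ (u0 + r)) (1/2) := by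
      have := G.geod_unique _ _ (G.lt_injAt hABi) (fun s => γ (u0 - r + s * (2 * r)))
        (by simp) (by congr 1; ring) (by rw [hAB]; exact hγd) (1/2) hhalf
      rw [← this]; congr 1; ring
    have g2 : σ u0 = G.geod (σ (u0 - r)) (σ (u0 + r)) (1/2) := by
      have := G.geod_sub hxy hA hB hhalf
      rw [← hσ] at this
      rw [this]; congr 1; ring
    have hsAB : dist (σ (u0 - r)) (σ (u0 + r)) ≤ 2 * r * ℓ := by
      rw [hσd _ hA _ hB, show u0 - r - (u0 + r) = - (2 * r) by ring, abs_neg,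
        abs_of_pos (by linarith)]
      gcongr
    have hcv := G.geod_conv' hnp hABi (q := σ (u0 - r)) (q' := σ (u0 + r))
      (by linarith) (m := ℓ) (hfle _ hA) (hfle _ hB) (by rw [hAB]; linarith) hhalf
    rw [← g1, ← g2] at hcv
    have hcv : f u0 ≤ (1 - 1/2) * f (u0 - r) + 1/2 * f (u0 + r) := hcv
    have i1 : f (u0 - r) ≤ m := hmax hA
    have i2 : f (u0 + r) ≤ m := hmax hB
    have i3 : f (u0 - r) ≠ m := fun hh => by
      have := hleast ⟨hA, hh⟩
      linarith
    have i4 := lt_of_le_of_ne i1 i3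
    linarith
  intro u hu
  exact (dist_le_zero.1 (hzero u hu)).symm

/-- total length of a cyclic configuration -/
noncomputable def tlen {n : ℕ} [NeZero n] (c : ZMod n → M) : ℝ :=
  ∑ l, dist (c l) (c (l + 1))

/-- break points of the constant speed parametrization -/
noncomputable def tau {n : ℕ} [NeZero n] (c : ZMod n → M) (i : ℕ) : ℝ :=
  (∑ l ∈ Finset.range i, dist (c (l : ZMod n)) (c ((l : ZMod n) + 1))) / tlen c

/-- `β` runs along the geodesic segments of the configuration `c` -/
def Pieces (G : GeodesicStructure M) {n : ℕ} [NeZero n] (c : ZMod n → M) (β : ℝ → M) : Prop :=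
  ∀ i : ℕ, ∀ u ∈ Icc (0:ℝ) 1, β (tau c i + u * (tau c (i + 1) - tau c i))
    = G.geod (c (i : ZMod n)) (c ((i : ZMod n) + 1)) u

section pieces

variable {n : ℕ} [NeZero n] {c : ZMod n → M}

lemma tau_zero : tau c 0 = 0 := by simp [tau]

lemma tau_succ_sub (hS : 0 < tlen c) (i : ℕ) :
    (tau c (i + 1) - tau c i) * tlen c = dist (c (i : ZMod n)) (c ((i : ZMod n) + 1)) := by
  unfold tau
  rw [Finset.sum_range_succ]
  field_simp
  ring

lemma tau_mono (hS : 0 < tlen c) : Monotone (tau c) := by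
  refine monotone_nat_of_le_succ fun i => ?_
  have h1 := tau_succ_sub hS i
  have h2 : 0 ≤ dist (c (i : ZMod n)) (c ((i : ZMod n) + 1)) := dist_nonneg
  rw [← h1] at h2
  have := nonneg_of_mul_nonneg_left h2 hS
  linarith

lemma tau_add_n (hS : 0 < tlen c) (i : ℕ) : tau c (i + n) = tau c i + 1 := by
  have h1 : ∑ l ∈ Finset.range (i + n), dist (c (l : ZMod n)) (c ((l : ZMod n) + 1))
      = tlen c + ∑ l ∈ Finset.range i, dist (c (l : ZMod n)) (c ((l : ZMod n) + 1)) := by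
    rw [add_comm i n, Finset.sum_range_add]
    congr 1
    · exact sum_range_zmod (fun l => dist (c l) (c (l + 1)))
    · refine Finset.sum_congr rfl fun l _ => ?_
      simp
  unfold tau
  rw [h1]
  field_simp
  ring

lemma tau_mul_n (hS : 0 < tlen c) (k : ℕ) : tau c (k * n) = k := by
  induction k with
  | zero => simp [tau_zero]
  | succ k ih => rw [Nat.succ_mul, tau_add_n hS, ih]; push_cast; ring

lemma exists_lt_tau (hS : 0 < tlen c) (x : ℝ) : ∃ k, x < tau c k := by
  obtain ⟨k, hk⟩ := exists_nat_gt x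
  exact ⟨k * n, by rwa [tau_mul_n hS]⟩

lemma exists_piece_right (hS : 0 < tlen c) {x : ℝ} (hx : 0 ≤ x) :
    ∃ i, tau c i ≤ x ∧ x < tau c (i + 1) := by
  classical
  have hex := exists_lt_tau (c := c) hS x
  have h1 := Nat.find_spec hex
  rcases hk : Nat.find hex with _ | i
  · rw [hk, tau_zero] at h1; linarith
  · rw [hk] at h1
    refine ⟨i, ?_, h1⟩
    have := Nat.find_min hex (m := i) (by omega)
    linarith

lemma exists_piece_left (hS : 0 < tlen c) {x : ℝ} (hx : 0 < x) :
    ∃ i, tau c i < x ∧ x ≤ tau c (i + 1) := by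
  classical
  have hex : ∃ k, x ≤ tau c k := (exists_lt_tau (c := c) hS x).imp fun _ h => h.le
  have h1 := Nat.find_spec hex
  rcases hk : Nat.find hex with _ | i
  · rw [hk, tau_zero] at h1; linarith
  · rw [hk] at h1
    refine ⟨i, ?_, h1⟩
    have := Nat.find_min hex (m := i) (by omega)
    linarith

/-- every point of a segment is of the form used in `Pieces`. -/
lemma exists_param {a b s : ℝ} (h : s ∈ Icc a b) : ∃ u ∈ Icc (0:ℝ) 1, s = a + u * (b - a) := by
  rcases eq_or_lt_of_le (h.1.trans h.2) with hab | hab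
  · exact ⟨0, by simp, by subst hab; simpa using le_antisymm h.2 h.1⟩
  · have : 0 < b - a := by linarith
    refine ⟨(s - a) / (b - a), ⟨div_nonneg (by linarith [h.1]) this.le,
      (div_le_one this).2 (by linarith [h.2])⟩, ?_⟩
    field_simp; ring

lemma IsPursuitLoop.pieces {G : GeodesicStructure M} (hinj : 0 < G.inj) {β : ℝ → M}
    (hβ : IsPursuitLoop G c β) (hS : 0 < tlen c) : Pieces G c β := by
  obtain ⟨hper, -, σ, hσ0, -, hmono, hlen, hseg⟩ := hβ
  change ∀ i : ℕ, i < n → (σ (i + 1) - σ i) * tlen c = _ at hlen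
  have hσ : ∀ i ≤ n, σ i = tau c i := by
    intro i
    induction i with
    | zero => intro; rw [hσ0, tau_zero]
    | succ i ih =>
      intro hi
      have h1 := hlen i (by omega)
      rw [← tau_succ_sub hS i, ih (by omega)] at h1
      have := mul_right_cancel₀ hS.ne' h1
      linarith
  have hbase : ∀ i < n, ∀ u ∈ Icc (0:ℝ) 1, β (tau c i + u * (tau c (i + 1) - tau c i))
    = G.geod (c (i : ZMod n)) (c ((i : ZMod n) + 1)) u := by
    intro i hi u hu
    have hle := tau_mono hS (Nat.le_succ i)
    have h1 := hseg i hi (tau c i + u * (tau c (i + 1) - tau c i)) ?_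
    · rw [h1, hσ i (by omega), hσ (i + 1) (by omega)]
      rcases eq_or_lt_of_le hle with he | hlt
      · have h2 := tau_succ_sub hS i
        change tau c i = tau c (i + 1) at he
        rw [← he, sub_self, zero_mul] at h2
        have h3 := dist_eq_zero.1 h2.symm
        rw [← he, sub_self, mul_zero, add_zero, sub_self, zero_div, ← h3,
          G.geod_self hinj _ (by simp), G.geod_self hinj _ hu]
      · congr 1
        have : tau c (i + 1) - tau c i ≠ 0 := by
          change tau c i < tau c (i + 1) at hlt
          linarith
        field_simp; ring
    · change tau c i ≤ tau c (i + 1) at hle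
      rw [hσ i (by omega), hσ (i + 1) (by omega)]
      obtain ⟨u0, u1⟩ := hu
      constructor <;> nlinarith
  intro i
  induction i using Nat.strong_induction_on with
  | _ i ih =>
    intro u hu
    by_cases hi : i < n
    · exact hbase i hi u hu
    · obtain ⟨j, rfl⟩ : ∃ j, i = j + n := ⟨i - n, by omega⟩
      have := ih j (by have := NeZero.pos n; omega) u hu
      rw [show j + n + 1 = j + 1 + n by omega, tau_add_n hS, tau_add_n hS]
      rw [show tau c j + 1 + u * (tau c (j + 1) + 1 - (tau c j + 1))
        = tau c j + u * (tau c (j + 1) - tau c j) + 1 by ring, hper, this]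
      simp

variable {G : GeodesicStructure M} {β : ℝ → M}

lemma Pieces.dist_eq (hβ : Pieces G c β) (hS : 0 < tlen c)
    (hlt : ∀ i, dist (c i) (c (i + 1)) < G.inj) {i : ℕ} {s u : ℝ}
    (hs : s ∈ Icc (tau c i) (tau c (i + 1))) (hu : u ∈ Icc (tau c i) (tau c (i + 1))) :
    dist (β s) (β u) = tlen c * |s - u| := by
  obtain ⟨v, hv, rfl⟩ := exists_param hs
  obtain ⟨w, hw, rfl⟩ := exists_param hu
  rw [hβ i v hv, hβ i w hw, G.geod_dist _ _ (G.lt_injAt (hlt _)) v hv w hw, ← tau_succ_sub hS i]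
  have : (0:ℝ) ≤ tau c (i + 1) - tau c i := sub_nonneg.2 (tau_mono hS (Nat.le_succ i))
  rw [show tau c i + v * (tau c (i + 1) - tau c i) - (tau c i + w * (tau c (i + 1) - tau c i))
    = (v - w) * (tau c (i + 1) - tau c i) by ring, abs_mul, abs_of_nonneg this]
  ring

lemma Pieces.lip (hβ : Pieces G c β) (hS : 0 < tlen c)
    (hlt : ∀ i, dist (c i) (c (i + 1)) < G.inj) {s u : ℝ} (hs : 0 ≤ s) (hu : 0 ≤ u) :
    dist (β s) (β u) ≤ tlen c * |s - u| := by
  have key : ∀ k : ℕ, ∀ s u, 0 ≤ s → s ≤ u → u ≤ tau c k → dist (β s) (β u) ≤ tlen c * (u - s) := by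
    intro k
    induction k with
    | zero =>
      intro s u h0 h1 h2
      rw [tau_zero] at h2
      have : s = u := by linarith
      subst this; simp
    | succ k ih =>
      intro s u h0 h1 h2
      rcases le_total u (tau c k) with h3 | h3
      · exact ih s u h0 h1 h3
      rcases le_total (tau c k) s with h4 | h4
      · rw [hβ.dist_eq hS hlt (i := k) ⟨h4, h1.trans h2⟩ ⟨h3, h2⟩, abs_sub_comm,
          abs_of_nonneg (by linarith)]
      · have a1 := ih s (tau c k) h0 h4 le_rfl
        have a2 := hβ.dist_eq hS hlt (i := k) (s := tau c k) (u := u)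
          ⟨le_rfl, h3.trans h2⟩ ⟨h3, h2⟩
        rw [abs_sub_comm, abs_of_nonneg (by linarith)] at a2
        have := dist_triangle (β s) (β (tau c k)) (β u)
        nlinarith
  rcases le_total s u with h | h
  · obtain ⟨k, hk⟩ := exists_lt_tau (c := c) hS u
    have := key k s u hs h hk.le
    rwa [abs_sub_comm, abs_of_nonneg (by linarith)]
  · obtain ⟨k, hk⟩ := exists_lt_tau (c := c) hS s
    have := key k u s hu h hk.le
    rwa [dist_comm, abs_of_nonneg (by linarith)]

end pieces

section limit

variable {G : GeodesicStructure M} {n : ℕ} [NeZero n] {b : ZMod n → ℝ → M} {c : ZMod n → M}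
  {U : Filter ℝ} [U.NeBot]

lemma lim_le (hb : IsCyclicPursuit G n b) (hU : U ≤ atTop) (hc : ∀ i, Tendsto (b i) U (𝓝 (c i)))
    {t : ℝ} (ht : 0 ≤ t) (i : ZMod n) :
    dist (c i) (c (i + 1)) ≤ dist (b i t) (b (i + 1) t) :=
  le_of_tendsto (Filter.Tendsto.dist (hc i) (hc (i + 1)))
    (((eventually_ge_atTop t).filter_mono hU).mono fun _ hs => hb.anti ht hs i)

lemma vertex (hb : IsCyclicPursuit G n b) (hnp : NonposCurvedOn G Set.univ)
    (hU : U ≤ atTop) (hc : ∀ i, Tendsto (b i) U (𝓝 (c i))) {i' i : ℕ} (hii : i' < i)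
    (h0 : ∀ l : ℕ, i' < l → l < i → dist (c (l : ZMod n)) (c ((l : ZMod n) + 1)) = 0)
    (hD' : 0 < dist (c (i' : ZMod n)) (c ((i' : ZMod n) + 1)))
    (hD : 0 < dist (c (i : ZMod n)) (c ((i : ZMod n) + 1))) :
    ∃ C : ℝ, ∀ᶠ h in 𝓝[>] (0:ℝ), dist (c (i' : ZMod n)) (c ((i' : ZMod n) + 1)) - C * h * h ≤
      dist (G.geod (c (i' : ZMod n)) (c ((i' : ZMod n) + 1))
          (h / dist (c (i' : ZMod n)) (c ((i' : ZMod n) + 1))))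
        (G.geod (c (i : ZMod n)) (c ((i : ZMod n) + 1))
          (h / dist (c (i : ZMod n)) (c ((i : ZMod n) + 1)))) := by
  set D' := dist (c (i' : ZMod n)) (c ((i' : ZMod n) + 1)) with hD'e
  set D := dist (c (i : ZMod n)) (c ((i : ZMod n) + 1)) with hDe
  refine ⟨4 / D' + 4 / D, ?_⟩
  have s' := hb.init_sep (i' : ZMod n)
  have s := hb.init_sep (i : ZMod n)
  have e1 : ∀ᶠ h in 𝓝[>] (0:ℝ), h ∈ Ioc 0 (D' / 2) := Ioc_mem_nhdsGT (by positivity)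
  have e2 : ∀ᶠ h in 𝓝[>] (0:ℝ), h ∈ Ioc 0 (D / 2) := Ioc_mem_nhdsGT (by positivity)
  have e3 : ∀ᶠ h in 𝓝[>] (0:ℝ), h ∈ Ioo 0 ((G.inj - dist (b i' 0) (b (i' + 1) 0)) / 4) :=
    Ioo_mem_nhdsGT (by linarith)
  have e4 : ∀ᶠ h in 𝓝[>] (0:ℝ), h ∈ Ioo 0 ((G.inj - dist (b i 0) (b (i + 1) 0)) / 4) :=
    Ioo_mem_nhdsGT (by linarith)
  filter_upwards [e1, e2, e3, e4] with h h1 h2 h3 h4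
  have hlt : ∀ j, dist (c j) (c (j + 1)) < G.inj := fun j =>
    (lim_le hb hU hc le_rfl j).trans_lt (hb.init_sep j)
  have hg : ∀ j : ZMod n, 0 < dist (c j) (c (j + 1)) → h ≤ dist (c j) (c (j + 1)) / 2 →
      Tendsto (fun t => G.geod (b j t) (b (j + 1) t) (h / dist (b j t) (b (j + 1) t))) U
      (𝓝 (G.geod (c j) (c (j + 1)) (h / dist (c j) (c (j + 1))))) := by
    intro j hj hhj
    refine G.geod_tendsto hnp (hc j) (hc (j + 1))
      (tendsto_const_nhds.div (Filter.Tendsto.dist (hc j) (hc (j + 1))) hj.ne')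
      ⟨div_nonneg h1.1.le hj.le, (div_le_one hj).2 (by linarith)⟩ ?_ (hlt j)
    filter_upwards [(eventually_ge_atTop 0).filter_mono hU] with t ht
    have := lim_le hb hU hc ht j
    exact ⟨div_nonneg h1.1.le dist_nonneg, (div_le_one (by linarith)).2 (by linarith)⟩
  have hlim := (Filter.Tendsto.dist (hg _ hD' h1.2) (hg _ hD h2.2)).add
    (tendsto_finsetSum (Finset.Ico (i' + 1) i) fun l _ =>
      Filter.Tendsto.dist (hc (l : ZMod n)) (hc ((l : ZMod n) + 1)))
  have hz : ∑ l ∈ Finset.Ico (i' + 1) i, dist (c (l : ZMod n)) (c ((l : ZMod n) + 1)) = 0 := by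
    refine Finset.sum_eq_zero fun l hl => ?_
    rw [Finset.mem_Ico] at hl
    exact h0 l (by omega) hl.2
  rw [hz, add_zero] at hlim
  refine ge_of_tendsto hlim ?_
  filter_upwards [(eventually_ge_atTop 0).filter_mono hU] with t ht
  have q1 := hb.quad hnp hD' (fun t ht => lim_le hb hU hc ht _) ht h1.1.le h1.2 (by linarith [h3.2])
  have q2 := hb.quad hnp hD (fun t ht => lim_le hb hU hc ht _) ht h1.1.le h2.2 (by linarith [h4.2])
  have q3 := lim_le hb hU hc (t := t + h) (by linarith [h1.1]) (i' : ZMod n)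
  have q4 := dist_le_Ico_sum_dist (fun l : ℕ => b (l : ZMod n) (t + h)) (m := i' + 1) (n := i) hii
  have q5 : ∑ l ∈ Finset.Ico (i' + 1) i, dist (b (l : ZMod n) (t + h)) (b ((l + 1 : ℕ) : ZMod n) (t + h))
      ≤ ∑ l ∈ Finset.Ico (i' + 1) i, dist (b (l : ZMod n) t) (b ((l : ZMod n) + 1) t) := by
    refine Finset.sum_le_sum fun l _ => ?_
    push_cast
    exact hb.anti ht (by linarith [h1.1]) _
  have q6 := q4.trans q5
  simp only [Nat.cast_add, Nat.cast_one] at q6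
  set g1 := G.geod (b i' t) (b (i' + 1) t) (h / dist (b i' t) (b (i' + 1) t))
  set g2 := G.geod (b i t) (b (i + 1) t) (h / dist (b i t) (b (i + 1) t))
  have t1 := dist_triangle (b i' (t + h)) g1 (b (i' + 1) (t + h))
  have t2 := dist_triangle g1 g2 (b (i' + 1) (t + h))
  have t3 := dist_triangle g2 (b i (t + h)) (b (i' + 1) (t + h))
  rw [dist_comm] at q2 q6
  have : (4 / D' + 4 / D) * h * h = 4 * h / D' * h + 4 * h / D * h := by ring
  linarith

end limit

lemma local_iso {G : GeodesicStructure M} {n : ℕ} [NeZero n] {c : ZMod n → M} {α : ℝ → M}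
    (hα : Pieces G c α) (hS : 0 < tlen c) (hlt : ∀ i, dist (c i) (c (i + 1)) < G.inj)
    (hnp : NonposCurvedOn G Set.univ) (hinj : 0 < G.inj)
    (hvert : ∀ i' i : ℕ, i' < i →
      (∀ l : ℕ, i' < l → l < i → dist (c (l : ZMod n)) (c ((l : ZMod n) + 1)) = 0) →
      0 < dist (c (i' : ZMod n)) (c ((i' : ZMod n) + 1)) →
      0 < dist (c (i : ZMod n)) (c ((i : ZMod n) + 1)) →
      ∃ C : ℝ, ∀ᶠ h in 𝓝[>] (0:ℝ), dist (c (i' : ZMod n)) (c ((i' : ZMod n) + 1)) - C * h * h ≤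
      dist (G.geod (c (i' : ZMod n)) (c ((i' : ZMod n) + 1))
          (h / dist (c (i' : ZMod n)) (c ((i' : ZMod n) + 1))))
        (G.geod (c (i : ZMod n)) (c ((i : ZMod n) + 1))
          (h / dist (c (i : ZMod n)) (c ((i : ZMod n) + 1)))))
    {x : ℝ} (hx : 0 < x) :
    ∃ a > 0, ∀ s ∈ Icc (x - a) (x + a), ∀ u ∈ Icc (x - a) (x + a),
      dist (α s) (α u) = tlen c * |s - u| := by
  obtain ⟨i', hi1, hi2⟩ := exists_piece_left (c := c) hS hx
  obtain ⟨i, hi3, hi4⟩ := exists_piece_right (c := c) hS hx.le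
  have hmono := tau_mono (c := c) hS
  have htn : ∀ k, 0 ≤ tau c k := fun k => by
    have := hmono (Nat.zero_le k); rwa [tau_zero] at this
  rcases lt_trichotomy i' i with hii | hii | hii
  rotate_left
  · subst hii
    refine ⟨min (x - tau c i') (tau c (i' + 1) - x), by simp [hi1, hi4], fun s hs u hu => ?_⟩
    have m1 := min_le_left (x - tau c i') (tau c (i' + 1) - x)
    have m2 := min_le_right (x - tau c i') (tau c (i' + 1) - x)
    exact hα.dist_eq hS hlt (i := i') ⟨by linarith [hs.1], by linarith [hs.2]⟩
      ⟨by linarith [hu.1], by linarith [hu.2]⟩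
  · have := hmono (show i + 1 ≤ i' from hii)
    linarith
  set L := tlen c with hL
  have hxe : tau c (i' + 1) = x := by
    have := hmono (show i' + 1 ≤ i from hii)
    linarith
  have hxe2 : tau c i = x := by
    have := hmono (show i' + 1 ≤ i from hii)
    linarith
  have hD'e := tau_succ_sub hS i'
  have hDe := tau_succ_sub hS i
  rw [hxe] at hD'e
  rw [hxe2] at hDe
  obtain ⟨C, hC⟩ := hvert i' i hii (fun l h1 h2 => by
      have a1 := hmono (show i' + 1 ≤ l from h1)
      have a2 := hmono (show l ≤ l + 1 by omega)
      have a3 := hmono (show l + 1 ≤ i from h2)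
      rw [← tau_succ_sub hS l, show tau c (l + 1) - tau c l = 0 by linarith, zero_mul])
    (by rw [← hD'e]; exact mul_pos (by linarith) hS)
    (by rw [← hDe]; exact mul_pos (by linarith) hS)
  obtain ⟨a, ha, ha1, ha2, ha3⟩ : ∃ a > 0, a ≤ x - tau c i' ∧ a ≤ tau c (i + 1) - x ∧
      3 * (L * a) < G.inj := by
    have e1 : ∀ᶠ h in 𝓝[>] (0:ℝ), h ∈ Ioc 0 (x - tau c i') := Ioc_mem_nhdsGT (by linarith)
    have e2 : ∀ᶠ h in 𝓝[>] (0:ℝ), h ∈ Ioc 0 (tau c (i + 1) - x) := Ioc_mem_nhdsGT (by linarith)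
    have e3 : Tendsto (fun r : ℝ => 3 * (L * r)) (𝓝[>] 0) (𝓝 (3 * (L * 0))) := by
      have : Continuous (fun r : ℝ => 3 * (L * r)) := by fun_prop
      exact (this.tendsto 0).mono_left nhdsWithin_le_nhds
    obtain ⟨a, h1, h2, h3⟩ := (e1.and (e2.and ((tendsto_order.1 e3).2 G.inj (by simpa using hinj)))).exists
    exact ⟨a, h1.1, h1.2, h2.2, h3⟩
  have dl : ∀ s ∈ Icc (tau c i') x, ∀ u ∈ Icc (tau c i') x, dist (α s) (α u) = L * |s - u| := by
    intro s hs u hu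
    rw [← hxe] at hs hu
    exact hα.dist_eq hS hlt hs hu
  have dr : ∀ s ∈ Icc x (tau c (i + 1)), ∀ u ∈ Icc x (tau c (i + 1)),
      dist (α s) (α u) = L * |s - u| := by
    intro s hs u hu
    rw [← hxe2] at hs hu
    exact hα.dist_eq hS hlt hs hu
  have ta : ∀ τ ∈ Icc (0:ℝ) 1, 0 ≤ τ * a ∧ τ * a ≤ a := fun τ hτ =>
    ⟨mul_nonneg hτ.1 ha.le, mul_le_of_le_one_left ha.le hτ.2⟩
  have pl : dist (α x) (α (x - a)) = L * a := by
    rw [dl x ⟨by linarith, le_rfl⟩ (x - a) ⟨by linarith, by linarith⟩, sub_sub_cancel, abs_of_pos ha]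
  have pr : dist (α x) (α (x + a)) = L * a := by
    rw [dr x ⟨le_rfl, by linarith⟩ (x + a) ⟨by linarith, by linarith⟩,
      show x - (x + a) = - a by ring, abs_neg, abs_of_pos ha]
  have hLa : 0 < L * a := mul_pos hS ha
  have gl : ∀ τ ∈ Icc (0:ℝ) 1, α (x - τ * a) = G.geod (α x) (α (x - a)) τ := by
    refine G.geod_unique _ _ (G.lt_injAt (by linarith)) (fun τ => α (x - τ * a)) (by simp) (by simp) ?_
    intro s hs u hu
    have := ta s hs
    have := ta u hu
    rw [pl, dl _ ⟨by linarith, by linarith⟩ _ ⟨by linarith, by linarith⟩,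
      show x - s * a - (x - u * a) = -((s - u) * a) by ring, abs_neg, abs_mul, abs_of_pos ha]
    ring
  have gr : ∀ τ ∈ Icc (0:ℝ) 1, α (x + τ * a) = G.geod (α x) (α (x + a)) τ := by
    refine G.geod_unique _ _ (G.lt_injAt (by linarith)) (fun τ => α (x + τ * a)) (by simp) (by simp) ?_
    intro s hs u hu
    have := ta s hs
    have := ta u hu
    rw [pr, dr _ ⟨by linarith, by linarith⟩ _ ⟨by linarith, by linarith⟩,
      show x + s * a - (x + u * a) = (s - u) * a by ring, abs_mul, abs_of_pos ha]
    ring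
  set E := dist (α (x - a)) (α (x + a)) with hE
  have hE2 : E ≤ 2 * (L * a) := by
    have := dist_triangle (α (x - a)) (α x) (α (x + a))
    rw [dist_comm (α (x - a)) (α x)] at this
    linarith
  have hcv : ∀ τ ∈ Icc (0:ℝ) 1, dist (α (x - τ * a)) (α (x + τ * a)) ≤ τ * E := by
    intro τ hτ
    rw [gl τ hτ, gr τ hτ]
    have := G.geod_conv hnp (p := α x) (p' := α (x - a)) (q := α x) (q' := α (x + a))
      (by linarith) (by linarith) (by rw [dist_self]; linarith) hτ
    simpa using this
  have hEge : 2 * (L * a) ≤ E := by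
    have hl : Tendsto (fun τ : ℝ => 2 * (L * a) - C * τ * (L * a) * (L * a)) (𝓝[>] 0)
        (𝓝 (2 * (L * a) - C * 0 * (L * a) * (L * a))) := by
      have : Continuous (fun τ : ℝ => 2 * (L * a) - C * τ * (L * a) * (L * a)) := by fun_prop
      exact (this.tendsto 0).mono_left nhdsWithin_le_nhds
    rw [mul_zero, zero_mul, zero_mul, sub_zero] at hl
    have hmul : Tendsto (fun τ : ℝ => τ * (L * a)) (𝓝[>] 0) (𝓝[>] 0) := by
      refine tendsto_nhdsWithin_iff.2 ⟨?_, ?_⟩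
      · have : Continuous (fun τ : ℝ => τ * (L * a)) := by fun_prop
        simpa using (this.tendsto 0).mono_left nhdsWithin_le_nhds
      · filter_upwards [self_mem_nhdsWithin] with τ hτ
        exact mul_pos hτ hLa
    have e0 : ∀ᶠ h in 𝓝[>] (0:ℝ), h ∈ Ioc 0 (1/2:ℝ) := Ioc_mem_nhdsGT (by norm_num)
    refine le_of_tendsto hl ?_
    filter_upwards [hmul.eventually hC, e0] with τ hτ h0
    have hτp : 0 < τ := h0.1
    have hτI : τ ∈ Icc (0:ℝ) 1 := ⟨h0.1.le, by linarith [h0.2]⟩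
    have hta := ta τ hτI
    have hta2 : τ * a ≤ a / 2 := by
      have := mul_le_mul_of_nonneg_right h0.2 ha.le
      linarith
    have hLne : L ≠ 0 := hS.ne'
    have r1 : ∀ y : ℝ, y ≠ 0 → τ * (L * a) / (y * L) * y = τ * a := by
      intro y hy
      field_simp
    have hm1 : τ * (L * a) / ((x - tau c i') * L) ∈ Icc (0:ℝ) 1 := by
      have : 0 < x - tau c i' := by linarith
      refine ⟨by positivity, (div_le_one (by positivity)).2 ?_⟩
      nlinarith
    have hm2 : τ * (L * a) / ((tau c (i + 1) - x) * L) ∈ Icc (0:ℝ) 1 := by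
      have : 0 < tau c (i + 1) - x := by linarith
      refine ⟨by positivity, (div_le_one (by positivity)).2 ?_⟩
      nlinarith
    have w1 := hα i' _ hm1
    have w2 := hα i _ hm2
    rw [hxe, r1 _ (by linarith)] at w1
    rw [hxe2, r1 _ (by linarith)] at w2
    rw [← hD'e, ← hDe] at hτ
    rw [← w1, ← w2] at hτ
    have v1 := dist_triangle (α (tau c i' + τ * a)) (α (x - τ * a)) (α (x + τ * a))
    rw [dl _ ⟨by linarith, by linarith⟩ (x - τ * a) ⟨by linarith, by linarith⟩,
      abs_of_nonpos (by linarith)] at v1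
    have v2 := hcv τ hτI
    have v3 : τ * (2 * (L * a) - C * τ * (L * a) * (L * a)) ≤ τ * E := by linarith
    exact le_of_mul_le_mul_left v3 h0.1
  have key : ∀ s u, x - a ≤ s → s ≤ u → u ≤ x + a → dist (α s) (α u) = L * (u - s) := by
    intro s u h1 h2 h3
    have h0 := htn i'
    have l1 := hα.lip hS hlt (s := x - a) (u := s) (by linarith) (by linarith)
    have l2 := hα.lip hS hlt (s := s) (u := u) (by linarith) (by linarith)
    have l3 := hα.lip hS hlt (s := u) (u := x + a) (by linarith) (by linarith)
    rw [abs_of_nonpos (by linarith)] at l1 l2 l3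
    have t1 := dist_triangle (α (x - a)) (α s) (α (x + a))
    have t2 := dist_triangle (α s) (α u) (α (x + a))
    refine le_antisymm (by linarith) (by linarith)
  refine ⟨a, ha, fun s hs u hu => ?_⟩
  rcases le_total s u with h | h
  · rw [key s u hs.1 h hu.2, abs_of_nonpos (by linarith)]; ring
  · rw [dist_comm, key u s hu.1 h hs.2, abs_of_nonneg (by linarith)]

lemma uniform_iso {α : ℝ → M} {L : ℝ} (hper : Function.Periodic α 1)
    (h : ∀ x : ℝ, 0 < x → ∃ a > 0, ∀ s ∈ Icc (x - a) (x + a), ∀ u ∈ Icc (x - a) (x + a),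
      dist (α s) (α u) = L * |s - u|) :
    ∃ e > (0:ℝ), ∀ s u : ℝ, |s - u| ≤ e → dist (α s) (α u) = L * |s - u| := by
  choose! a ha hiso using h
  obtain ⟨δ, hδ, hleb⟩ := lebesgue_number_lemma_of_metric (s := Icc (1:ℝ) 2)
    (c := fun x : Icc (1:ℝ) 2 => ball (x : ℝ) (a x)) isCompact_Icc (fun _ => isOpen_ball)
    (fun x hx => mem_iUnion.2 ⟨⟨x, hx⟩, mem_ball_self (ha x (by linarith [hx.1]))⟩)
  refine ⟨δ / 2, by positivity, fun s u hsu => ?_⟩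
  have hp : ∀ y : ℝ, α (y - ((⌊s⌋ - 1 : ℤ) : ℝ)) = α y := fun y => by
    simpa using hper.sub_zsmul_eq (x := y) (⌊s⌋ - 1)
  rw [← hp s, ← hp u]
  set s' := s - ((⌊s⌋ - 1 : ℤ) : ℝ) with hs'
  set u' := u - ((⌊s⌋ - 1 : ℤ) : ℝ) with hu'
  have hsu' : s - u = s' - u' := by rw [hs', hu']; ring
  rw [hsu'] at hsu ⊢
  have hsI : s' ∈ Icc (1:ℝ) 2 := by
    have h1 := Int.floor_le s
    have h2 := Int.lt_floor_add_one s
    rw [hs']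
    push_cast
    constructor <;> linarith
  obtain ⟨x, hx⟩ := hleb s' hsI
  have m1 := hx (mem_ball_self hδ)
  have m2 : u' ∈ ball (x : ℝ) (a x) := hx (by
    rw [mem_ball, Real.dist_eq, abs_sub_comm]; linarith)
  rw [Real.ball_eq_Ioo] at m1 m2
  exact hiso x (by linarith [x.2.1]) s' ⟨m1.1.le, m1.2.le⟩ u' ⟨m2.1.le, m2.2.le⟩

lemma GeodesicStructure.local_geod_dist (G : GeodesicStructure M)
    (hnp : NonposCurvedOn G Set.univ)
    {α : ℝ → M} {L e : ℝ} (hL : 0 < L) (he : 0 < e)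
    (hα : ∀ s u : ℝ, |s - u| ≤ e → dist (α s) (α u) = L * |s - u|) {x y : ℝ}
    (h : L * |y - x| < G.inj) : dist (α x) (α y) = L * |y - x| := by
  have hlip := (local_lip he hα).2
  have hd : dist (α x) (α y) < G.inj := by
    refine (hlip x y).trans_lt ?_
    rwa [abs_sub_comm]
  obtain ⟨u, hu0, hu1, hu2⟩ : ∃ u : ℝ, 0 < u ∧ u ≤ 1 ∧ u * |y - x| ≤ e := by
    have e1 : ∀ᶠ r in 𝓝[>] (0:ℝ), r ∈ Ioc 0 (1:ℝ) := Ioc_mem_nhdsGT one_pos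
    have e3 : Tendsto (fun r : ℝ => r * |y - x|) (𝓝[>] 0) (𝓝 (0 * |y - x|)) := by
      have : Continuous (fun r : ℝ => r * |y - x|) := by fun_prop
      exact (this.tendsto 0).mono_left nhdsWithin_le_nhds
    obtain ⟨u, h1, h2⟩ := (e1.and ((tendsto_order.1 e3).2 e (by simpa using he))).exists
    exact ⟨u, h1.1, h1.2, h2.le⟩
  have huI : u ∈ Icc (0:ℝ) 1 := ⟨hu0.le, hu1⟩
  have h1 := G.geod_dist _ _ (G.lt_injAt hd) 0 (by simp) u huI
  rw [G.local_geod hnp hL he hα h 0 (by simp), G.local_geod hnp hL he hα h u huI] at h1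
  have h2 : |x + 0 * (y - x) - (x + u * (y - x))| = u * |y - x| := by
    rw [show x + 0 * (y - x) - (x + u * (y - x)) = -(u * (y - x)) by ring, abs_neg, abs_mul,
      abs_of_pos hu0]
  rw [hα _ _ (by rw [h2]; exact hu2), h2, zero_sub, abs_neg, abs_of_pos hu0] at h1
  have h3 : u * dist (α x) (α y) = u * (L * |y - x|) := by rw [← h1]; ring
  exact mul_left_cancel₀ hu0.ne' h3

lemma gap_sum {x : ℕ → ℝ} {L A : ℝ} (hL : 0 < L) (i k : ℕ)
    (h : ∀ l < k, L * |x (i + l + 1) - x (i + l)| ≤ A) : L * |x (i + k) - x i| ≤ k * A := by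
  induction k with
  | zero => simp
  | succ k ih =>
    have h1 := ih fun l hl => h l (by omega)
    have h2 := h k (by omega)
    have h3 := mul_le_mul_of_nonneg_left (abs_sub_le (x (i + k + 1)) (x (i + k)) (x i)) hL.le
    push_cast
    rw [← add_assoc i k 1]
    linarith

/-- The tuple `x` tracks the configuration `c` along `α` with error `E`. -/
def Tracks (G : GeodesicStructure M) {n : ℕ} (α : ℝ → M) (L : ℝ) (c : ZMod n → M) (E : ℝ)
    (x : ℕ → ℝ) : Prop :=
  ∀ i : ℕ, dist (c (i : ZMod n)) (α (x i)) ≤ E ∧ L * |x (i + 1) - x i| < G.inj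

section tracking

variable {G : GeodesicStructure M} {n : ℕ} [NeZero n] {b : ZMod n → ℝ → M}
  {α : ℝ → M} {L e : ℝ}

lemma Tracks.conv {c : ZMod n → M} (hnp : NonposCurvedOn G Set.univ) (hL : 0 < L) (he : 0 < e)
    (hα : ∀ s u : ℝ, |s - u| ≤ e → dist (α s) (α u) = L * |s - u|) {E : ℝ} {x : ℕ → ℝ}
    (hx : Tracks G α L c E x) (i : ℕ)
    (hE : dist (c (i : ZMod n)) (c ((i : ZMod n) + 1)) + 2 * E < G.inj)
    {u : ℝ} (hu : u ∈ Icc (0:ℝ) 1) :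
    L * |x (i + 1) - x i| ≤ dist (c (i : ZMod n)) (c ((i : ZMod n) + 1)) + 2 * E ∧
    dist (G.geod (c (i : ZMod n)) (c ((i : ZMod n) + 1)) u) (α (x i + u * (x (i + 1) - x i)))
      ≤ E := by
  have h1 := (hx i).1
  have h2 := (hx (i + 1)).1
  have h3 := (hx i).2
  push_cast at h2
  have hE0 : 0 ≤ E := dist_nonneg.trans h1
  have hd := G.local_geod_dist hnp hL he hα h3
  have t1 := dist_triangle (α (x i)) (c (i : ZMod n)) (α (x (i + 1)))
  have t2 := dist_triangle (c (i : ZMod n)) (c ((i : ZMod n) + 1)) (α (x (i + 1)))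
  rw [dist_comm (α (x i)) (c (i : ZMod n))] at t1
  refine ⟨by rw [← hd]; linarith, ?_⟩
  have := G.geod_conv' hnp (p := c (i : ZMod n)) (p' := c ((i : ZMod n) + 1)) (q := α (x i))
    (q' := α (x (i + 1))) (by linarith) (by linarith) h1 h2 (by linarith) hu
  rw [G.local_geod hnp hL he hα h3 u hu] at this
  refine this.trans ?_
  nlinarith [mul_le_mul_of_nonneg_left h1 (by linarith [hu.2] : 0 ≤ 1 - u),
    mul_le_mul_of_nonneg_left h2 hu.1]

lemma track_step (hb : IsCyclicPursuit G n b) (hnp : NonposCurvedOn G Set.univ) (hinj : 0 < G.inj)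
    (hL : 0 < L) (he : 0 < e)
    (hα : ∀ s u : ℝ, |s - u| ≤ e → dist (α s) (α u) = L * |s - u|)
    {ε1 η t : ℝ} (hε1 : 0 < ε1) (hη : 0 < η) (ht : 0 ≤ t)
    (hm : ∀ i, dist (b i 0) (b (i + 1) 0) + (4 * n + 4) * ε1 < G.inj)
    (hall : ∃ j, b j t ≠ b (j + 1) t) :
    ∀ᶠ k in 𝓝[>] (0:ℝ), ∀ E ≤ ε1, ∀ x, Tracks G α L (fun i => b i t) E x →
      ∃ x', Tracks G α L (fun i => b i (t + k)) (E + η * k) x' := by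
  choose κ hκn hκ hκl using fun i => zmod_next hall i
  have ev : ∀ᶠ k in 𝓝[>] (0:ℝ), ∀ j : ZMod n, b j t ≠ b (j + 1) t →
      0 < k ∧ k / dist (b j t) (b (j + 1) t) ∈ Icc (0:ℝ) 1 ∧
      dist (b j (t + k)) (G.geod (b j t) (b (j + 1) t) (k / dist (b j t) (b (j + 1) t))) ≤ η * k ∧
      k / dist (b j t) (b (j + 1) t) * G.inj ≤ ε1 := by
    rw [eventually_all]
    intro j
    by_cases hj : b j t = b (j + 1) t
    · exact Eventually.of_forall fun k hk => absurd hj hk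
    · have e3 : Tendsto (fun k : ℝ => k / dist (b j t) (b (j + 1) t) * G.inj) (𝓝[>] 0)
          (𝓝 (0 / dist (b j t) (b (j + 1) t) * G.inj)) := by
        have : Continuous (fun k : ℝ => k / dist (b j t) (b (j + 1) t) * G.inj) := by fun_prop
        exact (this.tendsto 0).mono_left nhdsWithin_le_nhds
      filter_upwards [hb.chase_ev ht hj (hb.lt_inj ht j) hη,
        (tendsto_order.1 e3).2 ε1 (by simpa using hε1)] with k h1 h2 _
      exact ⟨h1.1, h1.2.1, h1.2.2, h2.le⟩
  filter_upwards [ev, self_mem_nhdsWithin] with k hk hk0 E hE x hx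
  have hk0 : 0 < k := hk0
  have hn : (1:ℝ) ≤ n := by exact_mod_cast NeZero.one_le
  have hcond : ∀ j : ZMod n, dist (b j t) (b (j + 1) t) + 2 * E < G.inj := by
    intro j
    have h1 := hb.le_init ht j
    have h2 := hm j
    nlinarith
  have hconv := fun (i : ℕ) {u : ℝ} (hu : u ∈ Icc (0:ℝ) 1) =>
    hx.conv hnp hL he hα i (hcond i) hu
  set N : ℕ → ℕ := fun i => i + κ (i : ZMod n) with hN
  set lam : ℕ → ℝ := fun i => k / dist (b ((N i : ℕ) : ZMod n) t) (b (((N i : ℕ) : ZMod n) + 1) t)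
    with hlam
  have hNc : ∀ i : ℕ, ((N i : ℕ) : ZMod n) = (i : ZMod n) + (κ (i : ZMod n) : ℕ) := by
    intro i; simp [hN]
  have hNne : ∀ i : ℕ, b ((N i : ℕ) : ZMod n) t ≠ b (((N i : ℕ) : ZMod n) + 1) t := by
    intro i; rw [hNc]; exact hκ _
  have hmerged : ∀ i : ℕ, ∀ l < κ (i : ZMod n),
      b ((i : ZMod n) + (l : ℕ)) t = b ((i : ZMod n) + (l : ℕ) + 1) t := by
    intro i l hl
    simpa using hκl (i : ZMod n) l hl
  have hjump : ∀ i : ℕ, L * |x (N i) - x i| ≤ 2 * n * ε1 := by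
    intro i
    have := gap_sum (A := 2 * ε1) (x := x) hL i (κ (i : ZMod n)) (fun l hl => by
      have h1 := (hconv (i + l) (u := 0) (by simp)).1
      have h2 := hmerged i l hl
      push_cast at h1
      rw [← h2, dist_self] at h1
      linarith)
    refine this.trans ?_
    have : (κ (i : ZMod n) : ℝ) ≤ n := by exact_mod_cast (hκn _).le
    nlinarith
  have hmove : ∀ i : ℕ, L * |lam i * (x (N i + 1) - x (N i))| ≤ ε1 := by
    intro i
    obtain ⟨-, h1, -, h2⟩ := hk _ (hNne i)
    rw [abs_mul, abs_of_nonneg h1.1]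
    have h3 := mul_le_mul_of_nonneg_left (hx (N i)).2.le h1.1
    calc L * (lam i * |x (N i + 1) - x (N i)|) = lam i * (L * |x (N i + 1) - x (N i)|) := by ring
      _ ≤ _ := h3.trans h2
  refine ⟨fun i => x (N i) + lam i * (x (N i + 1) - x (N i)), fun i => ⟨?_, ?_⟩⟩
  · obtain ⟨-, h1, h2, -⟩ := hk _ (hNne i)
    have h3 := (hconv (N i) h1).2
    have h4 : b (i : ZMod n) (t + k) = b ((N i : ℕ) : ZMod n) (t + k) := by
      rw [hNc]
      exact hb.chain ht _ (hmerged i) (by linarith)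
    change dist (b (i : ZMod n) (t + k)) _ ≤ _
    rw [h4]
    have h5 := (dist_triangle _ _ _).trans (add_le_add h2 h3)
    rw [add_comm E]
    exact h5
  · have g1 := hmove i
    have g2 := hmove (i + 1)
    have g3 := hjump i
    have g4 := hjump (i + 1)
    have g5 := (hconv i (u := 0) (by simp)).1
    have h1 := hb.le_init ht (i : ZMod n)
    have h2 := hm (i : ZMod n)
    set A := lam i * (x (N i + 1) - x (N i))
    set B := lam (i + 1) * (x (N (i + 1) + 1) - x (N (i + 1)))
    have : |x (N (i + 1)) + B - (x (N i) + A)| ≤ |B| + |x (N (i + 1)) - x (i + 1)|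
        + |x (i + 1) - x i| + |x (N i) - x i| + |A| := by
      rw [show x (N (i + 1)) + B - (x (N i) + A) = B + (x (N (i + 1)) - x (i + 1))
        + (x (i + 1) - x i) - (x (N i) - x i) - A by ring]
      refine (abs_sub _ _).trans (add_le_add_left ((abs_sub _ _).trans (add_le_add_left ?_ _)) _)
      exact abs_add_three _ _ _
    have h3 := mul_le_mul_of_nonneg_left this hL.le
    refine h3.trans_lt ?_
    linarith

lemma track_all (hb : IsCyclicPursuit G n b) (hnp : NonposCurvedOn G Set.univ) (hinj : 0 < G.inj)
    (hL : 0 < L) (he : 0 < e)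
    (hα : ∀ s u : ℝ, |s - u| ≤ e → dist (α s) (α u) = L * |s - u|)
    {ε1 ε0 η t0 T : ℝ} (hη : 0 < η) (ht : 0 ≤ t0) (hε0 : 0 ≤ ε0) (htT : t0 ≤ T)
    (hlast : ε0 + η * (T - t0) < ε1)
    (hm : ∀ i, dist (b i 0) (b (i + 1) 0) + (4 * n + 4) * ε1 < G.inj)
    (hall : ∀ t, 0 ≤ t → ∃ j, b j t ≠ b (j + 1) t) {x : ℕ → ℝ}
    (hx : Tracks G α L (fun i => b i t0) ε0 x) :
    ∃ x, Tracks G α L (fun i => b i T) ε1 x := by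
  have hε1 : 0 < ε1 := by nlinarith
  have key := cont_ind (P := fun t => ∀ δ > (0:ℝ), ∃ x,
      Tracks G α L (fun i => b i t) (ε0 + η * (t - t0) + δ) x) (a := t0) (b := T) ?_ ?_ ?_ T
      ⟨htT, le_rfl⟩
  · obtain ⟨x, hx⟩ := key (ε1 - (ε0 + η * (T - t0))) (by linarith)
    exact ⟨x, by simpa using hx⟩
  · refine isClosed_of_closure_subset fun t htc => ?_
    have htI : t ∈ Icc t0 T := by
      have := closure_mono inter_subset_right htc
      rwa [isClosed_Icc.closure_eq] at this
    refine ⟨fun δ hδ => ?_, htI⟩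
    obtain ⟨t', ⟨hP, hI⟩, hd⟩ := Metric.mem_closure_iff.1 htc (δ / (2 * (1 + η))) (by positivity)
    rw [lt_div_iff₀ (by positivity), Real.dist_eq] at hd
    obtain ⟨y, hy⟩ := hP (δ / 2) (by positivity)
    refine ⟨y, fun i => ⟨?_, (hy i).2⟩⟩
    have h1 := (hy i).1
    have h2 : dist (b (i : ZMod n) t) (b (i : ZMod n) t') ≤ |t - t'| := by
      rcases le_total t t' with h | h
      · rw [dist_comm, abs_sub_comm, abs_of_nonneg (by linarith)]
        exact hb.lip (ht.trans htI.1) h _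
      · rw [abs_of_nonneg (by linarith)]
        exact hb.lip (ht.trans hI.1) h _
    have h3 := dist_triangle (b (i : ZMod n) t) (b (i : ZMod n) t') (α (y i))
    have h4 : t' - t ≤ |t - t'| := by rw [abs_sub_comm]; exact le_abs_self _
    change dist (b (i : ZMod n) t) _ ≤ _
    change dist (b (i : ZMod n) t') _ ≤ _ at h1
    nlinarith
  · intro δ hδ
    refine ⟨x, fun i => ⟨(hx i).1.trans (by simpa using hδ.le), (hx i).2⟩⟩
  · intro t htI hP
    have ht0 : 0 ≤ t := ht.trans htI.1
    filter_upwards [track_step hb hnp hinj hL he hα hε1 hη ht0 hm (hall t ht0)] with k hk δ hδ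
    have hlt : 0 < ε1 - (ε0 + η * (t - t0)) := by nlinarith [htI.2]
    obtain ⟨y, hy⟩ := hP (min δ (ε1 - (ε0 + η * (t - t0)))) (lt_min hδ hlt)
    have m1 := min_le_left δ (ε1 - (ε0 + η * (t - t0)))
    have m2 := min_le_right δ (ε1 - (ε0 + η * (t - t0)))
    obtain ⟨z, hz⟩ := hk _ (by linarith) y hy
    refine ⟨z, fun i => ⟨(hz i).1.trans ?_, (hz i).2⟩⟩
    linarith

end tracking

lemma limit_pieces {G : GeodesicStructure M} {n : ℕ} [NeZero n] {b : ZMod n → ℝ → M}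
    {c : ZMod n → M} {U : Filter ℝ} [U.NeBot] {β : ℝ → ℝ → M} {α : ℝ → M}
    (hnp : NonposCurvedOn G Set.univ)
    (hc : ∀ i, Tendsto (b i) U (𝓝 (c i))) (hα : ∀ s, Tendsto (fun t => β t s) U (𝓝 (α s)))
    (hS : 0 < tlen c) (hlt : ∀ i, dist (c i) (c (i + 1)) < G.inj)
    (hbt : ∀ᶠ t in U, 0 < tlen (fun i => b i t) ∧ Pieces G (fun i => b i t) (β t) ∧
      ∀ i, dist (b i t) (b (i + 1) t) < G.inj) : Pieces G c α := by
  have htl : Tendsto (fun t => tlen (fun i => b i t)) U (𝓝 (tlen c)) :=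
    tendsto_finsetSum _ fun l _ => Filter.Tendsto.dist (hc l) (hc (l + 1))
  have htau : ∀ i, Tendsto (fun t => tau (fun i => b i t) i) U (𝓝 (tau c i)) := fun i =>
    (tendsto_finsetSum _ fun l _ => Filter.Tendsto.dist (hc _) (hc _)).div htl hS.ne'
  intro i u hu
  have hst : Tendsto (fun t => tau (fun i => b i t) i
      + u * (tau (fun i => b i t) (i + 1) - tau (fun i => b i t) i)) U
      (𝓝 (tau c i + u * (tau c (i + 1) - tau c i))) :=
    (htau i).add (((htau (i + 1)).sub (htau i)).const_mul u)
  have hnn : ∀ d : ZMod n → M, 0 < tlen d → 0 ≤ tau d i + u * (tau d (i + 1) - tau d i) := by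
    intro d hd
    have h1 := tau_mono hd (Nat.zero_le i)
    have h2 := tau_mono hd (Nat.le_succ i)
    rw [tau_zero] at h1
    have := mul_nonneg hu.1 (sub_nonneg.2 h2)
    linarith
  set s := tau c i + u * (tau c (i + 1) - tau c i) with hs
  have h1 : Tendsto (fun t => G.geod (b i t) (b (i + 1) t) u) U
      (𝓝 (G.geod (c i) (c (i + 1)) u)) :=
    G.geod_tendsto hnp (hc _) (hc _) tendsto_const_nhds hu (Eventually.of_forall fun _ => hu) (hlt _)
  have h2 : Tendsto (fun t => tlen (fun i => b i t) * |s - (tau (fun i => b i t) i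
      + u * (tau (fun i => b i t) (i + 1) - tau (fun i => b i t) i))|) U (𝓝 0) := by
    have := htl.mul ((tendsto_const_nhds (x := s)).sub hst).abs
    simpa using this
  refine dist_le_zero.1 (le_of_tendsto_of_tendsto (Filter.Tendsto.dist (hα s) h1) h2 ?_)
  filter_upwards [hbt] with t ht
  obtain ⟨p1, p2, p3⟩ := ht
  have := p2.lip p1 p3 (hnn c hS) (hnn _ p1)
  rw [p2 i u hu] at this
  exact this

lemma exists_gap {G : GeodesicStructure M} {n : ℕ} [NeZero n] {b : ZMod n → ℝ → M}
    (hb : IsCyclicPursuit G n b) : ∃ ε1 > (0:ℝ), ∀ ε ≤ ε1,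
      ∀ i, dist (b i 0) (b (i + 1) 0) + (4 * n + 4) * ε < G.inj := by
  have key : ∀ᶠ ε in 𝓝[>] (0:ℝ), ∀ i, dist (b i 0) (b (i + 1) 0) + (4 * n + 4) * ε < G.inj := by
    rw [eventually_all]
    intro i
    have e3 : Tendsto (fun ε : ℝ => dist (b i 0) (b (i + 1) 0) + (4 * n + 4) * ε) (𝓝[>] 0)
        (𝓝 (dist (b i 0) (b (i + 1) 0) + (4 * n + 4) * 0)) := by
      have : Continuous (fun ε : ℝ => dist (b i 0) (b (i + 1) 0) + (4 * n + 4) * ε) := by fun_prop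
      exact (this.tendsto 0).mono_left nhdsWithin_le_nhds
    exact (tendsto_order.1 e3).2 _ (by simpa using hb.init_sep i)
  obtain ⟨ε1, h1, h0⟩ := (key.and self_mem_nhdsWithin).exists
  refine ⟨ε1, h0, fun ε hε i => lt_of_le_of_lt ?_ (h1 i)⟩
  gcongr

/-- Proposition `SUP`. If cyclic pursuit on a nonpositively curved
compact Riemannian manifold `M` does not end in finite time, then there is a closed
geodesic `α` such that `sup_s d (β t s) (α (S¹)) → 0` as `t → ∞`. -/
theorem riemannian_pursuit_sup_dist_to_geodesic_tendsto_zero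
    {M : Type*} [MetricSpace M] [CompactSpace M]
    (G : GeodesicStructure M) (hinj : 0 < G.inj)
    (hnp : NonposCurvedOn G Set.univ)
    (n : ℕ) [NeZero n] (b : ZMod n → ℝ → M) (hb : IsCyclicPursuit G n b)
    (β : ℝ → ℝ → M) (hβ : ∀ t : ℝ, 0 ≤ t → IsPursuitLoop G (fun i => b i t) (β t))
    (hne : ¬ ∃ t₀ : ℝ, 0 ≤ t₀ ∧ ∀ t, t₀ ≤ t → ∀ i, b i t = b 0 t₀) :
    ∃ (α : ℝ → M) (L : ℝ), IsClosedGeodesic α L ∧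
      ∀ ε > (0:ℝ), ∃ T : ℝ, ∀ t, T ≤ t → ∀ s : ℝ, infDist (β t s) (range α) < ε := by
  have hnever : ∀ t, 0 ≤ t → ¬ ∀ i, b i t = b 0 t := by
    intro t ht hall
    refine hne ⟨t, ht, fun s hs i => ?_⟩
    rcases hs.eq_or_lt with h | h
    · rw [← h]; exact hall i
    · exact hb.halt t ht hall s h i
  have hall : ∀ t, 0 ≤ t → ∃ j, b j t ≠ b (j + 1) t := by
    intro t ht
    by_contra hcon
    push Not at hcon
    exact hnever t ht (hb.all_eq ht hcon)
  have htpos : ∀ t, 0 ≤ t → 0 < tlen (fun i => b i t) := by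
    intro t ht
    obtain ⟨j, hj⟩ := hall t ht
    exact Finset.sum_pos' (fun _ _ => dist_nonneg) ⟨j, Finset.mem_univ _, dist_pos.2 hj⟩
  set U : Ultrafilter ℝ := Ultrafilter.of atTop with hUdef
  have hU : (U : Filter ℝ) ≤ atTop := Ultrafilter.of_le _
  have hlim : ∀ f : ℝ → M, ∃ p, Tendsto f U (𝓝 p) := by
    intro f
    obtain ⟨p, -, hp⟩ := isCompact_univ.ultrafilter_le_nhds (U.map f) (by simp)
    exact ⟨p, hp⟩
  have hev : ∀ᶠ t in (U : Filter ℝ), 0 ≤ t := (eventually_ge_atTop 0).filter_mono hU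
  choose c hc using fun i => hlim (b i)
  choose α hα using fun s => hlim (fun t => β t s)
  have hlt : ∀ j, dist (c j) (c (j + 1)) < G.inj := fun j =>
    (lim_le hb hU hc le_rfl j).trans_lt (hb.init_sep j)
  have hS : 0 < tlen c := by
    by_contra hcon
    have htl : Tendsto (fun t => IsCyclicPursuit.per b t) U (𝓝 (tlen c)) :=
      tendsto_finsetSum _ fun l _ => Filter.Tendsto.dist (hc l) (hc (l + 1))
    obtain ⟨t, h1, h2⟩ :=
      (hev.and ((tendsto_order.1 htl).2 (G.inj / 4) (by linarith))).exists
    obtain ⟨u, hu0, hu⟩ := hb.collapse hinj hnp h1 h2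
    exact hnever u hu0 hu
  have hpieces : ∀ t, 0 ≤ t → Pieces G (fun i => b i t) (β t) := fun t ht =>
    (hβ t ht).pieces hinj (htpos t ht)
  have hαp : Pieces G c α := limit_pieces hnp hc hα hS hlt
    (hev.mono fun t ht => ⟨htpos t ht, hpieces t ht, hb.lt_inj ht⟩)
  have hper : Function.Periodic α 1 := fun s =>
    tendsto_nhds_unique (hα (s + 1)) ((hα s).congr' (hev.mono fun t ht => ((hβ t ht).1 s).symm))
  obtain ⟨e, he, hiso⟩ := uniform_iso hper (fun x hx => local_iso hαp hS hlt hnp hinj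
    (fun i' i hii h0 hD' hD => vertex hb hnp hU hc hii h0 hD' hD) hx)
  refine ⟨α, tlen c, ⟨hper, hS, e, he, hiso⟩, ?_⟩
  obtain ⟨ε1, hε1, hgap⟩ := exists_gap hb
  intro ε hε
  set δ := min (ε / 2) ε1 with hδ
  have hδ0 : 0 < δ := lt_min (by positivity) hε1
  have hδε : δ < ε := (min_le_left _ _).trans_lt (by linarith)
  have hclose : ∀ᶠ t in (U : Filter ℝ), ∀ i, dist (b i t) (c i) < δ / 2 := by
    rw [eventually_all]
    intro i
    exact (tendsto_order.1 (tendsto_iff_dist_tendsto_zero.1 (hc i))).2 _ (by positivity)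
  obtain ⟨t0, ht0, hct⟩ := (hev.and hclose).exists
  have hinit : Tracks G α (tlen c) (fun i => b i t0) (δ / 2) (tau c) := by
    intro i
    refine ⟨?_, ?_⟩
    · have := hαp i 0 (by simp)
      rw [G.geod_zero _ _ (G.lt_injAt (hlt _)), zero_mul, add_zero] at this
      rw [this]
      exact (hct i).le
    · rw [abs_of_nonneg (sub_nonneg.2 (tau_mono hS (Nat.le_succ i))), mul_comm,
        tau_succ_sub hS i]
      exact hlt _
  refine ⟨t0, fun t ht s => ?_⟩
  have ht' : 0 ≤ t := ht0.trans ht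
  have hgapδ := hgap δ (min_le_right _ _)
  obtain ⟨x, hx⟩ := track_all hb hnp hinj hS he hiso (ε1 := δ) (ε0 := δ / 2)
    (η := δ / (4 * (t - t0 + 1))) (T := t) (by
      have : 0 < t - t0 + 1 := by linarith
      positivity) ht0 (by positivity) ht (by
      have h1 : 0 < t - t0 + 1 := by linarith
      have h2 : δ / (4 * (t - t0 + 1)) * (t - t0) ≤ δ / 4 := by
        rw [div_mul_eq_mul_div, div_le_div_iff₀ (by positivity) (by norm_num)]
        nlinarith
      linarith) hgapδ hall hinit
  have hfr : β t s = β t (Int.fract s) := by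
    have := (hβ t ht').1.sub_zsmul_eq (x := s) ⌊s⌋
    rw [← this, Int.fract]
    simp
  rw [hfr]
  obtain ⟨i, hi1, hi2⟩ := exists_piece_right (htpos t ht') (Int.fract_nonneg s)
  obtain ⟨u, hu, hue⟩ := exists_param ⟨hi1, hi2.le⟩
  rw [hue, hpieces t ht' i u hu]
  have hn : (1:ℝ) ≤ n := by exact_mod_cast NeZero.one_le
  have hfin := (hx.conv hnp hS he hiso i (by
    have h1 := hb.le_init ht' (i : ZMod n)
    have h2 := hgapδ i
    nlinarith) hu).2
  exact ((infDist_le_dist_of_mem (mem_range_self _)).trans hfin).trans_lt hδε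
end
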